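/- Let φ be a partially monotone anisotropy on ℝ², I ⊂ ℝ a bounded open interval, p ∈ [1,+∞), g ∈ L^∞(I), and let u ∈ BV(I) ∩ L^∞(I) be a minimizer of G. Then for every γ > 2‖g‖_∞, u is a (γ,Λ)-local minimizer of 𝒜_φ in I with Λ = p·(γ + ‖g‖_∞)^{p−1}. -/

import Mathlib

open MeasureTheory Set Filter Topology Bornology
open scoped ENNReal NNReal RealInnerProductSpace symmDiff

noncomputable section

abbrev E2 : Type := EuclideanSpace ℝ (Fin 2)

def vec2 (a b : ℝ) : E2 := (WithLp.equiv 2 (Fin 2 → ℝ)).symm ![a, b]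

def e1 : E2 := vec2 1 0
def e2 : E2 := vec2 0 1

/-- `φ` is an anisotropy (a norm) on `ℝ²`. -/
structure IsAnisotropy (φ : E2 → ℝ) : Prop where
  nonneg : ∀ x, 0 ≤ φ x
  eq_zero_iff : ∀ x, φ x = 0 ↔ x = 0
  smul_eq : ∀ (c : ℝ) (x : E2), φ (c • x) = |c| * φ x
  add_le : ∀ x y, φ (x + y) ≤ φ x + φ y
  bounds : ∃ c ∈ Set.Ioc (0:ℝ) 1, ∀ x : E2, ‖x‖ = 1 → c ≤ φ x ∧ φ x ≤ 1 / c

/-- The dual anisotropy `φ°(ξ) = max {⟪ξ,η⟫ : φ(η) = 1}`. -/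
def dualA (φ : E2 → ℝ) (ξ : E2) : ℝ := sSup {r : ℝ | ∃ η : E2, φ η = 1 ∧ r = ⟪ξ, η⟫}

/-- The Wulff shape `W^φ = {φ ≤ 1}`. -/
def wulff (φ : E2 → ℝ) : Set E2 := {x | φ x ≤ 1}

/-- The Wulff shape of radius `r` centered at `x`. -/
def wulffBall (φ : E2 → ℝ) (r : ℝ) (x : E2) : Set E2 := {y | φ (y - x) ≤ r}

/-- `φ` is partially monotone, i.e. even in each coordinate separately. -/
def PartiallyMonotone (φ : E2 → ℝ) : Prop := ∀ x : E2, φ x = φ (vec2 |x 0| |x 1|)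

/-- The Wulff shape of `φ` is symmetric with respect to both coordinate axes. -/
def AxisSymmetric (φ : E2 → ℝ) : Prop :=
  ∀ x : E2, φ (vec2 (-(x 0)) (x 1)) = φ x ∧ φ (vec2 (x 0) (-(x 1))) = φ x

/-- `W^φ` has no vertical facets: `±e₁` is an outer normal to `W^φ` only at `±e₁/φ(e₁)`. -/
def NoVerticalFacets (φ : E2 → ℝ) : Prop :=
  (∀ η ∈ wulff φ, (∀ y ∈ wulff φ, ⟪e1, y - η⟫ ≤ 0) → η = (φ e1)⁻¹ • e1) ∧
  (∀ η ∈ wulff φ, (∀ y ∈ wulff φ, ⟪-e1, y - η⟫ ≤ 0) → η = -((φ e1)⁻¹ • e1))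

/-- `φ` is elliptic: `φ - λ|·|` is again a norm for some `λ > 0`. -/
def IsElliptic (φ : E2 → ℝ) : Prop :=
  ∃ lam > (0:ℝ), IsAnisotropy (fun x => φ x - lam * ‖x‖)

/-- `φ` is a `C²`-anisotropy. -/
def IsC2Aniso (φ : E2 → ℝ) : Prop := ContDiffOn ℝ 2 φ {(0:E2)}ᶜ

/-- The anisotropic area `𝒜_φ(u,J)` (φ-total variation of `(-Du, L¹)`). -/
def aniArea (φ : E2 → ℝ) (u : ℝ → ℝ) (J : Set ℝ) : ℝ≥0∞ :=
  ⨆ (h₁ : ℝ → ℝ) (h₂ : ℝ → ℝ) (_ : ContDiff ℝ 1 h₁) (_ : ContDiff ℝ 1 h₂)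
    (_ : HasCompactSupport h₁) (_ : HasCompactSupport h₂)
    (_ : tsupport h₁ ⊆ J) (_ : tsupport h₂ ⊆ J)
    (_ : ∀ s ∈ J, φ (vec2 (h₁ s) (h₂ s)) ≤ 1),
    ENNReal.ofReal (∫ s in J, (u s * deriv h₁ s + h₂ s))

/-- The (Euclidean) total variation of `Du` on `J`. -/
def totalVar (u : ℝ → ℝ) (J : Set ℝ) : ℝ≥0∞ :=
  ⨆ (h : ℝ → ℝ) (_ : ContDiff ℝ 1 h) (_ : HasCompactSupport h) (_ : tsupport h ⊆ J)
    (_ : ∀ s ∈ J, |h s| ≤ 1), ENNReal.ofReal (∫ s in J, u s * deriv h s)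

/-- `u ∈ BV(I)`. -/
def BVOn (u : ℝ → ℝ) (I : Set ℝ) : Prop := IntegrableOn u I ∧ totalVar u I < ⊤

/-- `u ∈ BV_loc(I)`. -/
def BVLocOn (u : ℝ → ℝ) (I : Set ℝ) : Prop :=
  ∀ J : Set ℝ, IsOpen J → IsCompact (closure J) → closure J ⊆ I → BVOn u J

/-- The `L^∞`-norm of `u` on `I`. -/
def supNorm (u : ℝ → ℝ) (I : Set ℝ) : ℝ≥0∞ :=
  essSup (fun s => (‖u s‖₊ : ℝ≥0∞)) (volume.restrict I)

/-- The functional `G(u) = 𝒜_φ(u,I) + ∫_I |u-g|^p ds` (with value `+∞` when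
`u ∉ BV(I)` or `u - g ∉ L^p(I)`). -/
def Gfun (φ : E2 → ℝ) (p : ℝ) (g : ℝ → ℝ) (I : Set ℝ) (u : ℝ → ℝ) : ℝ≥0∞ :=
  aniArea φ u I + ∫⁻ s in I, ENNReal.ofReal (|u s - g s| ^ p)

/-- `u` minimizes `G` over `L¹(I)`. -/
def IsMinimizerG (φ : E2 → ℝ) (p : ℝ) (g : ℝ → ℝ) (I : Set ℝ) (u : ℝ → ℝ) : Prop :=
  IntegrableOn u I ∧ ∀ v : ℝ → ℝ, IntegrableOn v I → Gfun φ p g I u ≤ Gfun φ p g I v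

/-- `u` is a `Λ`-local minimizer of `𝒜_φ` in `I`. -/
def IsLambdaLocMin (φ : E2 → ℝ) (Λ : ℝ) (I : Set ℝ) (u : ℝ → ℝ) : Prop :=
  ∀ J : Set ℝ, IsOpen J → IsCompact (closure J) → closure J ⊆ I →
    ∀ ψ : ℝ → ℝ, ContDiff ℝ 1 ψ → HasCompactSupport ψ → tsupport ψ ⊆ J →
      aniArea φ u J ≤ aniArea φ (fun s => u s + ψ s) J + ENNReal.ofReal (Λ * ∫ s in J, |ψ s|)

/-- `ν` is the measure-theoretic outer unit normal of `E` at `x` (De Giorgi blow-up). -/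
def IsOuterNormalAt (E : Set E2) (x ν : E2) : Prop :=
  ‖ν‖ = 1 ∧ Tendsto
    (fun r : ℝ => volume (({y : E2 | x + r • y ∈ E} ∆ {y : E2 | ⟪y, ν⟫ ≤ 0}) ∩ Metric.ball (0:E2) 1))
    (𝓝[>] 0) (𝓝 0)

/-- The reduced boundary `∂*E`. -/
def redBoundary (E : Set E2) : Set E2 := {x | ∃ ν, IsOuterNormalAt E x ν}

open Classical in
/-- The generalized outer unit normal `ν_E`. -/
def genNormal (E : Set E2) (x : E2) : E2 :=
  if h : ∃ ν, IsOuterNormalAt E x ν then h.choose else 0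

/-- The anisotropic perimeter `P_φ(E,Ω) = ∫_{Ω ∩ ∂*E} φ°(ν_E) dH¹`. -/
def aniPer (φ : E2 → ℝ) (E : Set E2) (Ω : Set E2) : ℝ≥0∞ :=
  ∫⁻ x in Ω ∩ redBoundary E, ENNReal.ofReal (dualA φ (genNormal E x)) ∂μH[1]

/-- The divergence of a vector field on `ℝ²`. -/
def div2 (T : E2 → E2) (x : E2) : ℝ :=
  ∑ i : Fin 2, fderiv ℝ T x (EuclideanSpace.single i 1) i

/-- Distributional perimeter of `F` in an open set `Ω`. -/
def perVar (F : Set E2) (Ω : Set E2) : ℝ≥0∞ :=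
  ⨆ (T : E2 → E2) (_ : ContDiff ℝ 1 T) (_ : HasCompactSupport T) (_ : tsupport T ⊆ Ω)
    (_ : ∀ x, ‖T x‖ ≤ 1), ENNReal.ofReal (∫ x in F, div2 T x)

/-- `F` has locally finite perimeter in `Ω`. -/
def LocFinPer (F : Set E2) (Ω : Set E2) : Prop :=
  MeasurableSet F ∧ ∀ Ω' : Set E2, IsOpen Ω' → IsCompact (closure Ω') → closure Ω' ⊆ Ω →
    perVar F Ω' < ⊤

/-- `E` is a `Λ`-local minimizer of `P_φ` in `Ω`. -/
def IsLambdaLocMinPer (φ : E2 → ℝ) (Λ : ℝ) (Ω : Set E2) (E : Set E2) : Prop :=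
  LocFinPer E Ω ∧ ∀ Ω' : Set E2, IsOpen Ω' → IsCompact (closure Ω') → closure Ω' ⊆ Ω →
    ∀ F : Set E2, LocFinPer F Ω → IsCompact (closure (E ∆ F)) → closure (E ∆ F) ⊆ Ω' →
      aniPer φ E Ω' ≤ aniPer φ F Ω' + ENNReal.ofReal Λ * volume (E ∆ F)

/-- The (strict) subgraph of `u` over `I`. -/
def subg (I : Set ℝ) (u : ℝ → ℝ) : Set E2 := {q : E2 | q 0 ∈ I ∧ q 1 < u (q 0)}

/-- The (strict) epigraph of `u` over `I`. -/
def epig (I : Set ℝ) (u : ℝ → ℝ) : Set E2 := {q : E2 | q 0 ∈ I ∧ u (q 0) < q 1}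

/-- The vertical strip `I × ℝ`. -/
def strip (I : Set ℝ) : Set E2 := {q : E2 | q 0 ∈ I}

/-- The vertical box `I × A`. -/
def box (I A : Set ℝ) : Set E2 := {q : E2 | q 0 ∈ I ∧ q 1 ∈ A}

/-- `u` is a `(γ,Λ)`-local minimizer of `𝒜_φ` in `I`. -/
def IsGammaLambdaLocMin (φ : E2 → ℝ) (γ Λ : ℝ) (I : Set ℝ) (u : ℝ → ℝ) : Prop :=
  ∀ Ω : Set E2, IsOpen Ω → IsCompact (closure Ω) → closure Ω ⊆ box I (Set.Ioo (-γ) γ) →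
    ∀ F : Set E2, LocFinPer F (strip I) →
      IsCompact (closure (subg I u ∆ F)) → closure (subg I u ∆ F) ⊆ Ω →
        aniPer φ (subg I u) Ω ≤ aniPer φ F Ω + ENNReal.ofReal Λ * volume (subg I u ∆ F)

/-- The constant `α₀(φ)`. -/
def alpha0 (φ : E2 → ℝ) : ℝ :=
  (aniPer φ (wulff φ) univ).toReal /
    ((2 * (aniPer φ (wulff φ) univ).toReal + 1) * Real.sqrt (volume (wulff φ)).toReal)

/-- `u` admits a Lipschitz representative on `I`. -/
def HasLipschitzRep (u : ℝ → ℝ) (I : Set ℝ) : Prop :=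
  ∃ v : ℝ → ℝ, (∀ᵐ s ∂(volume.restrict I), u s = v s) ∧ ∃ K : ℝ≥0, LipschitzOnWith K v I

/-- `u` admits a `C^{1,1}` representative on `I`. -/
def HasC11Rep (u : ℝ → ℝ) (I : Set ℝ) : Prop :=
  ∃ v v' : ℝ → ℝ, (∀ᵐ s ∂(volume.restrict I), u s = v s) ∧
    (∀ s ∈ I, HasDerivAt v (v' s) s) ∧ ∃ K : ℝ≥0, LipschitzOnWith K v' I

section

open CompactlySupported CompactlySupportedContinuousMap

section Riesz

variable {X : Type*} [TopologicalSpace X]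

/-- The positive variation of a linear functional on `C_c(X, ℝ)`. -/
def posVariation (l : C_c(X, ℝ) →ₗ[ℝ] ℝ) (f : C_c(X, ℝ≥0)) : ℝ :=
  sSup {r | ∃ k : C_c(X, ℝ≥0), k ≤ f ∧ r = l k.toReal}

lemma toReal_abs_le_of_le {k f : C_c(X, ℝ≥0)} (h : k ≤ f) {M : ℝ} (hM : ∀ x, (f x : ℝ) ≤ M)
    (x : X) : |k.toReal x| ≤ M := by
  have h1 : k x ≤ f x := h x
  have h2 : (k x : ℝ) ≤ f x := by exact_mod_cast h1
  rw [toReal_apply, abs_of_nonneg (by positivity)]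
  exact h2.trans (hM x)

lemma exists_bound_nnreal (f : C_c(X, ℝ≥0)) : ∃ M : ℝ, ∀ x, (f x : ℝ) ≤ M := by
  obtain ⟨M, hM⟩ := f.toReal.continuous.bounded_above_of_compact_support f.toReal.hasCompactSupport
  refine ⟨M, fun x => ?_⟩
  have h1 : ‖f.toReal x‖ ≤ M := hM x
  rw [toReal_apply] at h1
  exact (le_abs_self _).trans h1

variable {l : C_c(X, ℝ) →ₗ[ℝ] ℝ} {C : ℝ}

lemma posVariation_bddAbove (hl : ∀ h M, (∀ x, |h x| ≤ M) → |l h| ≤ C * M)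
    (f : C_c(X, ℝ≥0)) :
    BddAbove {r | ∃ k : C_c(X, ℝ≥0), k ≤ f ∧ r = l k.toReal} := by
  obtain ⟨M, hM⟩ := exists_bound_nnreal f
  refine ⟨C * M, ?_⟩
  rintro r ⟨k, hk, rfl⟩
  exact (le_abs_self _).trans (hl _ _ (toReal_abs_le_of_le hk hM))

lemma le_posVariation (hl : ∀ h M, (∀ x, |h x| ≤ M) → |l h| ≤ C * M)
    {f k : C_c(X, ℝ≥0)} (h : k ≤ f) : l k.toReal ≤ posVariation l f :=
  le_csSup (posVariation_bddAbove hl f) ⟨k, h, rfl⟩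

lemma posVariation_le {f : C_c(X, ℝ≥0)} {B : ℝ}
    (h : ∀ k : C_c(X, ℝ≥0), k ≤ f → l k.toReal ≤ B) : posVariation l f ≤ B := by
  refine csSup_le ⟨l f.toReal, f, le_rfl, rfl⟩ ?_
  rintro r ⟨k, hk, rfl⟩
  exact h k hk

lemma posVariation_nonneg (hl : ∀ h M, (∀ x, |h x| ≤ M) → |l h| ≤ C * M)
    (f : C_c(X, ℝ≥0)) : 0 ≤ posVariation l f := by
  have h0 : (0 : C_c(X, ℝ≥0)) ≤ f := fun x => by simp
  have := le_posVariation hl h0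
  have h2 : (0 : C_c(X, ℝ≥0)).toReal = 0 := by ext; simp
  rwa [h2, map_zero] at this

lemma posVariation_add (hl : ∀ h M, (∀ x, |h x| ≤ M) → |l h| ≤ C * M)
    (f g : C_c(X, ℝ≥0)) : posVariation l (f + g) = posVariation l f + posVariation l g := by
  apply le_antisymm
  · apply posVariation_le
    intro k hk
    have h1 : k ⊓ f ≤ k := inf_le_left
    obtain ⟨k2, hk2⟩ := CompactlySupportedContinuousMap.exists_add_of_le h1
    have h3 : k2 ≤ g := by
      intro x
      have e1 : (k x ⊓ f x) + k2 x = k x := by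
        have := DFunLike.congr_fun hk2 x
        simpa using this
      have e2 : k x ≤ f x + g x := by simpa using hk x
      show k2 x ≤ g x
      rcases le_total (k x) (f x) with h | h
      · rw [inf_eq_left.mpr h] at e1
        have : k2 x = 0 := by simpa using e1
        simp [this]
      · rw [inf_eq_right.mpr h] at e1
        rw [← e1] at e2
        exact le_of_add_le_add_left e2
    rw [← hk2, toReal_add, map_add]
    exact add_le_add (le_posVariation hl inf_le_right) (le_posVariation hl h3)
  · rw [← le_sub_iff_add_le]
    apply posVariation_le
    intro k hk
    rw [le_sub_comm]
    apply posVariation_le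
    intro k' hk'
    rw [le_sub_iff_add_le', ← map_add, ← toReal_add]
    exact le_posVariation hl (add_le_add hk hk')

lemma posVariation_smul (hl : ∀ h M, (∀ x, |h x| ≤ M) → |l h| ≤ C * M)
    (c : ℝ≥0) (f : C_c(X, ℝ≥0)) : posVariation l (c • f) = c * posVariation l f := by
  have hmap : ∀ (d : ℝ≥0) (k : C_c(X, ℝ≥0)), l (d • k).toReal = d * l k.toReal := by
    intro d k
    rw [toReal_smul]
    have : d • k.toReal = (d : ℝ) • k.toReal := rfl
    rw [this, map_smul, smul_eq_mul]
  rcases eq_or_ne c 0 with rfl | hc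
  · apply le_antisymm
    · apply posVariation_le
      intro k hk
      have : k = (0 : ℝ≥0) • k := by
        ext x
        have h1 : k x ≤ ((0 : ℝ≥0) • f) x := hk x
        simpa using h1
      rw [this, hmap]; simp
    · simpa using posVariation_nonneg hl _
  · have hc' : (0 : ℝ) < c := by positivity
    apply le_antisymm
    · apply posVariation_le
      intro k hk
      have h1 : c⁻¹ • k ≤ f := by
        intro x
        have h1 : k x ≤ c * f x := hk x
        show c⁻¹ * k x ≤ f x
        rwa [inv_mul_le_iff₀ (by positivity)]
      have h2 := le_posVariation hl h1
      rw [hmap, NNReal.coe_inv, inv_mul_le_iff₀ hc'] at h2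
      exact h2
    · rw [← le_div_iff₀' hc']
      apply posVariation_le
      intro k hk
      rw [le_div_iff₀' hc', ← hmap]
      apply le_posVariation hl
      intro x
      show c * k x ≤ c * f x
      gcongr
      exact hk x

variable [T2Space X] [LocallyCompactSpace X] [MeasurableSpace X] [BorelSpace X]

/-- A bounded positive functional on `C_c(X, ℝ≥0)` is represented by a finite measure. -/
lemma isFiniteMeasure_rieszMeasure (Λ : C_c(X, ℝ≥0) →ₗ[ℝ≥0] ℝ≥0) (B : ℝ≥0)
    (hΛ : ∀ f : C_c(X, ℝ≥0), (∀ x, f x ≤ 1) → Λ f ≤ B) :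
    IsFiniteMeasure (NNRealRMK.rieszMeasure Λ) := by
  constructor
  refine lt_of_le_of_lt ?_ (ENNReal.coe_lt_top (r := B))
  rw [(isOpen_univ : IsOpen (univ : Set X)).measure_eq_iSup_isCompact]
  refine iSup_le fun K => iSup_le fun _ => iSup_le fun hK => ?_
  obtain ⟨f, hf1, -, hf2, hf3⟩ := exists_continuous_one_zero_of_isCompact hK isClosed_empty
    (disjoint_empty K)
  let F : C_c(X, ℝ) := ⟨f, hf2⟩
  have hle : ∀ x, F.nnrealPart x ≤ 1 := fun x => by
    rw [nnrealPart_apply, Real.toNNReal_le_one]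
    exact (hf3 x).2
  calc NNRealRMK.rieszMeasure Λ K = ∫⁻ x in K, 1 ∂(NNRealRMK.rieszMeasure Λ) := by simp
    _ ≤ ∫⁻ x in K, F.nnrealPart x ∂(NNRealRMK.rieszMeasure Λ) := by
        apply setLIntegral_mono' hK.measurableSet
        intro x hx
        have : F x = 1 := hf1 hx
        simp [nnrealPart_apply, this]
    _ ≤ ∫⁻ x, F.nnrealPart x ∂(NNRealRMK.rieszMeasure Λ) := setLIntegral_le_lintegral _ _
    _ = Λ F.nnrealPart := NNRealRMK.lintegral_rieszMeasure _ _
    _ ≤ B := by exact_mod_cast hΛ _ hle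

/-- Riesz representation: a bounded functional on `C_c(X, ℝ)` is a difference of two
finite measures. -/
theorem exists_finite_measures_of_bounded_functional
    (hC : 0 ≤ C) (hl : ∀ h M, (∀ x, |h x| ≤ M) → |l h| ≤ C * M) :
    ∃ μ ν : Measure X, IsFiniteMeasure μ ∧ IsFiniteMeasure ν ∧
      ∀ h : C_c(X, ℝ), l h = ∫ x, h x ∂μ - ∫ x, h x ∂ν := by
  have hmap : ∀ (d : ℝ≥0) (k : C_c(X, ℝ≥0)), l (d • k).toReal = d * l k.toReal := by
    intro d k
    rw [toReal_smul]
    have : d • k.toReal = (d : ℝ) • k.toReal := rfl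
    rw [this, map_smul, smul_eq_mul]
  let P : C_c(X, ℝ≥0) →ₗ[ℝ≥0] ℝ≥0 :=
    { toFun := fun f => ⟨posVariation l f, posVariation_nonneg hl f⟩
      map_add' := fun f g => by
        apply NNReal.eq; exact posVariation_add hl f g
      map_smul' := fun c f => by
        apply NNReal.eq; exact posVariation_smul hl c f }
  let N : C_c(X, ℝ≥0) →ₗ[ℝ≥0] ℝ≥0 :=
    { toFun := fun f => ⟨posVariation l f - l f.toReal,
        sub_nonneg.mpr (le_posVariation hl le_rfl)⟩
      map_add' := fun f g => by
        apply NNReal.eq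
        show posVariation l (f + g) - l (f + g).toReal =
          (posVariation l f - l f.toReal) + (posVariation l g - l g.toReal)
        rw [posVariation_add hl, toReal_add, map_add]; ring
      map_smul' := fun c f => by
        apply NNReal.eq
        show posVariation l (c • f) - l (c • f).toReal = c * (posVariation l f - l f.toReal)
        rw [posVariation_smul hl, hmap]; ring }
  have hPf : ∀ f : C_c(X, ℝ≥0), (∀ x, f x ≤ 1) → posVariation l f ≤ C := by
    intro f hf
    apply posVariation_le
    intro k hk
    have := (le_abs_self _).trans (hl k.toReal 1 (toReal_abs_le_of_le hk
      (fun x => by exact_mod_cast hf x)))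
    simpa using this
  have hNf : ∀ f : C_c(X, ℝ≥0), (∀ x, f x ≤ 1) → posVariation l f - l f.toReal ≤ 2 * C := by
    intro f hf
    have h1 := hPf f hf
    have h2 := (neg_abs_le _).trans' (neg_le_neg (hl f.toReal 1 (toReal_abs_le_of_le le_rfl
      (fun x => by exact_mod_cast hf x))))
    linarith
  refine ⟨NNRealRMK.rieszMeasure P, NNRealRMK.rieszMeasure N,
    isFiniteMeasure_rieszMeasure P ⟨C, hC⟩ hPf,
    isFiniteMeasure_rieszMeasure N ⟨2 * C, by positivity⟩ hNf, fun h => ?_⟩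
  have hfin1 := isFiniteMeasure_rieszMeasure P ⟨C, hC⟩ hPf
  have hfin2 := isFiniteMeasure_rieszMeasure N ⟨2 * C, by positivity⟩ hNf
  have key : ∀ k : C_c(X, ℝ≥0), l k.toReal =
      ∫ x, (k x : ℝ) ∂(NNRealRMK.rieszMeasure P) - ∫ x, (k x : ℝ) ∂(NNRealRMK.rieszMeasure N) := by
    intro k
    rw [NNRealRMK.integral_rieszMeasure, NNRealRMK.integral_rieszMeasure]
    show _ = posVariation l k - (posVariation l k - l k.toReal)
    ring
  have hint : ∀ (k : C_c(X, ℝ≥0)) (μ : Measure X) [IsFiniteMeasure μ],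
      Integrable (fun x => (k x : ℝ)) μ := by
    intro k μ _
    have := k.toReal.continuous.integrable_of_hasCompactSupport (μ := μ) k.toReal.hasCompactSupport
    exact this.congr (Eventually.of_forall fun x => toReal_apply k x)
  have hdec : h = h.nnrealPart.toReal - (-h).nnrealPart.toReal :=
    (nnrealPart_sub_nnrealPart_neg h).symm
  have hx : ∀ x, h x = (h.nnrealPart x : ℝ) - ((-h).nnrealPart x : ℝ) := fun x => by
    conv_lhs => rw [hdec]
    simp only [coe_sub, Pi.sub_apply, toReal_apply]
  have hi : ∀ (μ : Measure X) [IsFiniteMeasure μ], ∫ x, h x ∂μ =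
      ∫ x, (h.nnrealPart x : ℝ) ∂μ - ∫ x, ((-h).nnrealPart x : ℝ) ∂μ := by
    intro μ _
    rw [← integral_sub (hint _ _) (hint _ _)]
    exact integral_congr_ae (Eventually.of_forall hx)
  rw [hi, hi]
  conv_lhs => rw [hdec, map_sub, key, key]
  ring

end Riesz

end

/-- `ζ` is a `C¹` function with compact support in `Ω`. -/
structure TestFun (Ω : Set E2) (ζ : E2 → ℝ) : Prop where
  contDiff : ContDiff ℝ 1 ζ
  compact : HasCompactSupport ζ
  subset : tsupport ζ ⊆ Ω

namespace TestFun

variable {Ω : Set E2} {ζ ξ : E2 → ℝ}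

lemma eq_zero (h : TestFun Ω ζ) {x : E2} (hx : x ∉ Ω) : ζ x = 0 :=
  image_eq_zero_of_notMem_tsupport fun h' => hx (h.subset h')

lemma mono {Ω' : Set E2} (h : TestFun Ω ζ) (hΩ : Ω ⊆ Ω') : TestFun Ω' ζ :=
  ⟨h.contDiff, h.compact, h.subset.trans hΩ⟩

lemma continuous (h : TestFun Ω ζ) : Continuous ζ := h.contDiff.continuous

lemma differentiable (h : TestFun Ω ζ) : Differentiable ℝ ζ :=
  h.contDiff.differentiable (by norm_num)

lemma continuous_fderiv (h : TestFun Ω ζ) (e : E2) : Continuous fun y => fderiv ℝ ζ y e :=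
  (h.contDiff.continuous_fderiv (by norm_num)).clm_apply continuous_const

lemma compact_fderiv (h : TestFun Ω ζ) (e : E2) :
    HasCompactSupport fun y => fderiv ℝ ζ y e :=
  HasCompactSupport.fderiv_apply (𝕜 := ℝ) h.compact e

lemma integrable_fderiv (h : TestFun Ω ζ) (e : E2) : Integrable fun y => fderiv ℝ ζ y e :=
  (h.continuous_fderiv e).integrable_of_hasCompactSupport (h.compact_fderiv e)

lemma integrable (h : TestFun Ω ζ) (μ : Measure E2) [IsFiniteMeasure μ] : Integrable ζ μ :=
  h.continuous.integrable_of_hasCompactSupport h.compact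

lemma bounded (h : TestFun Ω ζ) : ∃ C, 0 ≤ C ∧ ∀ x, |ζ x| ≤ C := by
  obtain ⟨C, hC⟩ := h.continuous.bounded_above_of_compact_support h.compact
  exact ⟨C, (norm_nonneg _).trans (hC 0), hC⟩

lemma mul_left (h : TestFun Ω ζ) (hξ : ContDiff ℝ 1 ξ) : TestFun Ω (fun x => ξ x * ζ x) :=
  ⟨hξ.mul h.contDiff, h.compact.mul_left, (tsupport_mul_subset_right).trans h.subset⟩

lemma mul_right (h : TestFun Ω ζ) (hξ : ContDiff ℝ 1 ξ) : TestFun Ω (fun x => ζ x * ξ x) :=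
  ⟨h.contDiff.mul hξ, h.compact.mul_right, (tsupport_mul_subset_left).trans h.subset⟩

lemma add (h : TestFun Ω ζ) (h' : TestFun Ω ξ) : TestFun Ω (fun x => ζ x + ξ x) :=
  ⟨h.contDiff.add h'.contDiff, h.compact.add h'.compact,
    (tsupport_add ζ ξ).trans (union_subset h.subset h'.subset)⟩

lemma const_mul (h : TestFun Ω ζ) (c : ℝ) : TestFun Ω (fun x => c * ζ x) :=
  h.mul_left contDiff_const

end TestFun

/-- A vector field whose divergence theorem on `F` is given by a measure `μ` and a unit field `ν`:
the polar decomposition of the distributional gradient of `χ_F` in `Ω`. -/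
structure GGPair (F : Set E2) (μ : Measure E2) (ν : E2 → E2) (Ω : Set E2) : Prop where
  meas : MeasurableSet F
  isOpen : IsOpen Ω
  fin : IsFiniteMeasure μ
  supp : μ Ωᶜ = 0
  nu_meas : Measurable ν
  nu_norm : ∀ x, ‖ν x‖ = 1
  gg : ∀ ζ : E2 → ℝ, TestFun Ω ζ → ∀ e : E2,
    ∫ y in F, fderiv ℝ ζ y e = ∫ y, ζ y * ⟪e, ν y⟫ ∂μ

lemma sum_coord_single (x : E2) : ∑ i : Fin 2, x i • (EuclideanSpace.single i (1 : ℝ) : E2) = x := by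
  have := (EuclideanSpace.basisFun (Fin 2) ℝ).sum_repr x
  simpa using this

lemma fderiv_apply_eq_sum (L : E2 →L[ℝ] ℝ) (e : E2) :
    L e = ∑ i : Fin 2, L (EuclideanSpace.single i 1) * e i := by
  conv_lhs => rw [← sum_coord_single e]
  simp [mul_comm]

lemma div2_smul_const {ζ : E2 → ℝ} {x : E2} (h : DifferentiableAt ℝ ζ x) (e : E2) :
    div2 (fun y => ζ y • e) x = fderiv ℝ ζ x e := by
  rw [div2, fderiv_smul_const h, fderiv_apply_eq_sum (fderiv ℝ ζ x) e]
  simp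

lemma tsupport_smul_const_subset (ζ : E2 → ℝ) (e : E2) :
    tsupport (fun y => ζ y • e) ⊆ tsupport ζ :=
  closure_mono fun x hx h => hx (by simp [h])

lemma abs_integral_fderiv_le {F Ω : Set E2} (hfin : perVar F Ω < ⊤)
    {ζ : E2 → ℝ} (h : TestFun Ω ζ) {e : E2} (he : ‖e‖ = 1) {M : ℝ} (hM : ∀ x, |ζ x| ≤ M) :
    |∫ y in F, fderiv ℝ ζ y e| ≤ (perVar F Ω).toReal * M := by
  have key : ∀ ξ : E2 → ℝ, TestFun Ω ξ → (∀ x, |ξ x| ≤ 1) →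
      ∫ y in F, fderiv ℝ ξ y e ≤ (perVar F Ω).toReal := by
    intro ξ hξ hξ1
    have h1 : ENNReal.ofReal (∫ y in F, div2 (fun y => ξ y • e) y) ≤ perVar F Ω := by
      unfold perVar
      refine le_iSup_of_le (fun y => ξ y • e) ?_
      refine le_iSup_of_le (hξ.contDiff.smul contDiff_const) ?_
      refine le_iSup_of_le (hξ.compact.smul_right) ?_
      refine le_iSup_of_le ((tsupport_smul_const_subset ξ e).trans hξ.subset) ?_
      exact le_iSup_of_le (fun x => by rw [norm_smul, he, mul_one]; exact hξ1 x) le_rfl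
    have h2 : ∀ y, div2 (fun y => ξ y • e) y = fderiv ℝ ξ y e := fun y =>
      div2_smul_const (hξ.differentiable y) e
    simp only [h2] at h1
    exact (ENNReal.ofReal_le_iff_le_toReal hfin.ne).mp h1
  have key2 : ∀ ξ : E2 → ℝ, TestFun Ω ξ → (∀ x, |ξ x| ≤ 1) →
      |∫ y in F, fderiv ℝ ξ y e| ≤ (perVar F Ω).toReal := by
    intro ξ hξ hξ1
    rw [abs_le']
    refine ⟨key ξ hξ hξ1, ?_⟩
    have h3 := key (fun x => -1 * ξ x) (hξ.const_mul (-1)) (fun x => by simpa using hξ1 x)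
    have h4 : ∀ y, fderiv ℝ (fun x => -1 * ξ x) y e = - fderiv ℝ ξ y e := fun y => by
      rw [fderiv_const_mul (hξ.differentiable y)]; simp
    simp only [h4, integral_neg] at h3
    exact h3
  have hM0 : 0 ≤ M := (abs_nonneg _).trans (hM 0)
  rcases hM0.eq_or_lt with rfl | hpos
  · have : ζ = fun _ => 0 := by
      ext x; simpa using hM x
    simp [this]
  · have h3 := key2 (fun x => M⁻¹ * ζ x) (h.const_mul _) (fun x => by
      rw [abs_mul, abs_inv, abs_of_pos hpos, inv_mul_le_iff₀ hpos]; simpa using hM x)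
    have h4 : ∀ y, fderiv ℝ (fun x => M⁻¹ * ζ x) y e = M⁻¹ * fderiv ℝ ζ y e := fun y => by
      rw [fderiv_const_mul (h.differentiable y)]; simp
    simp only [h4, integral_const_mul] at h3
    rw [abs_mul, abs_inv, abs_of_pos hpos, inv_mul_le_iff₀ hpos] at h3
    linarith

open CompactlySupported in
lemma exists_measures_directional {F Ω : Set E2} (hfin : perVar F Ω < ⊤) {e : E2}
    (he : ‖e‖ = 1) :
    ∃ μ ν : Measure E2, IsFiniteMeasure μ ∧ IsFiniteMeasure ν ∧
      ∀ ζ, TestFun Ω ζ → ∫ y in F, fderiv ℝ ζ y e = ∫ x, ζ x ∂μ - ∫ x, ζ x ∂ν := by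
  let V : Submodule ℝ (BoundedContinuousFunction E2 ℝ) :=
    { carrier := {f | TestFun Ω f}
      add_mem' := fun {f g} hf hg => TestFun.add hf hg
      zero_mem' := ⟨contDiff_const, HasCompactSupport.zero, by
        show tsupport (0 : E2 → ℝ) ⊆ Ω; simp [tsupport]⟩
      smul_mem' := fun c f hf => TestFun.const_mul hf c }
  have hV : ∀ f : V, TestFun Ω (f : BoundedContinuousFunction E2 ℝ) := fun f => f.2
  let l0 : V →ₗ[ℝ] ℝ :=
    { toFun := fun f => ∫ y in F, fderiv ℝ (f : BoundedContinuousFunction E2 ℝ) y e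
      map_add' := fun f g => by
        rw [← integral_add ((hV f).integrable_fderiv e).integrableOn
          ((hV g).integrable_fderiv e).integrableOn]
        congr 1; ext y
        have := fderiv_fun_add ((hV f).differentiable y) ((hV g).differentiable y)
        exact DFunLike.congr_fun this e
      map_smul' := fun c f => by
        rw [RingHom.id_apply, smul_eq_mul, ← integral_const_mul]
        congr 1; ext y
        have := fderiv_const_mul ((hV f).differentiable y) c
        exact DFunLike.congr_fun this e }
  have hl0 : ∀ f : V, ‖l0 f‖ ≤ (perVar F Ω).toReal * ‖f‖ := fun f => by
    exact abs_integral_fderiv_le hfin (hV f) he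
      (fun x => BoundedContinuousFunction.norm_coe_le_norm (f : BoundedContinuousFunction E2 ℝ) x)
  let l1 : StrongDual ℝ V := LinearMap.mkContinuous (E := V) (F := ℝ) l0 (perVar F Ω).toReal hl0
  obtain ⟨L, hL, -⟩ := exists_extension_norm_eq (𝕜 := ℝ) V l1
  let l : C_c(E2, ℝ) →ₗ[ℝ] ℝ :=
    { toFun := fun f => L f.toBoundedContinuousFunction
      map_add' := fun f g => by rw [← map_add]; rfl
      map_smul' := fun c f => by
        rw [RingHom.id_apply, ← map_smul]; rfl }
  obtain ⟨μ, ν, hμ, hν, h⟩ := exists_finite_measures_of_bounded_functional (l := l)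
    (norm_nonneg L) (fun h M hM => by
      refine (L.le_opNorm _).trans ?_
      gcongr
      exact (BoundedContinuousFunction.norm_le ((abs_nonneg _).trans (hM 0))).mpr hM)
  refine ⟨μ, ν, hμ, hν, fun ζ hζ => ?_⟩
  let f : C_c(E2, ℝ) := ⟨⟨ζ, hζ.continuous⟩, hζ.compact⟩
  have h1 := hL ⟨f.toBoundedContinuousFunction, hζ⟩
  have h2 := h f
  exact h1.symm.trans h2

/-- Sets of finite perimeter admit a Gauss–Green pair. -/
theorem exists_GGPair {F Ω : Set E2} (hF : MeasurableSet F) (hΩ : IsOpen Ω)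
    (hfin : perVar F Ω < ⊤) :
    ∃ μ ν, GGPair F μ ν Ω := by
  have hs : ∀ i : Fin 2, ‖(EuclideanSpace.single i (1 : ℝ) : E2)‖ = 1 := fun i => by simp
  choose μ ν hμ hν h using fun i => exists_measures_directional (Ω := Ω) hfin (hs i)
  let M : Measure E2 := (μ 0 + ν 0) + (μ 1 + ν 1)
  have hMfin : IsFiniteMeasure M := by
    have := hμ 0; have := hμ 1; have := hν 0; have := hν 1
    infer_instance
  have hμM : ∀ i, μ i ≪ M := by
    intro i; fin_cases i
    · exact ((Measure.le_add_right le_rfl).trans (Measure.le_add_right le_rfl)).absolutelyContinuous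
    · exact ((Measure.le_add_right le_rfl).trans (Measure.le_add_left le_rfl)).absolutelyContinuous
  have hνM : ∀ i, ν i ≪ M := by
    intro i; fin_cases i
    · exact ((Measure.le_add_left le_rfl).trans (Measure.le_add_right le_rfl)).absolutelyContinuous
    · exact ((Measure.le_add_left le_rfl).trans (Measure.le_add_left le_rfl)).absolutelyContinuous
  let f : Fin 2 → E2 → ℝ := fun i y => ((μ i).rnDeriv M y).toReal - ((ν i).rnDeriv M y).toReal
  have hfm : ∀ i, Measurable (f i) := fun i =>
    ((Measure.measurable_rnDeriv _ _).ennreal_toReal).sub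
      ((Measure.measurable_rnDeriv _ _).ennreal_toReal)
  have hfi : ∀ i, Integrable (f i) M := fun i =>
    Measure.integrable_toReal_rnDeriv.sub Measure.integrable_toReal_rnDeriv
  have hfz : ∀ i ζ, TestFun Ω ζ →
      ∫ y in F, fderiv ℝ ζ y (EuclideanSpace.single i 1) = ∫ y, ζ y * f i y ∂M := by
    intro i ζ hζ
    have := hμ i
    have := hν i
    have : SigmaFinite M := inferInstance
    have : SFinite (μ i) := inferInstance
    have : (μ i).HaveLebesgueDecomposition M := inferInstance
    rw [h i ζ hζ, ← integral_rnDeriv_smul (hμM i), ← integral_rnDeriv_smul (hνM i)]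
    obtain ⟨C, -, hC⟩ := hζ.bounded
    have hi : ∀ (κ : Measure E2) [IsFiniteMeasure κ],
        Integrable (fun x => (κ.rnDeriv M x).toReal • ζ x) M := by
      intro κ _
      exact Measure.integrable_toReal_rnDeriv.mul_bdd (c := C)
        hζ.continuous.aestronglyMeasurable (Eventually.of_forall hC)
    rw [← integral_sub (hi _) (hi _)]
    congr 1; ext y
    simp only [f, smul_eq_mul]; ring
  let W : E2 → E2 := fun y => ∑ i, f i y • (EuclideanSpace.single i (1 : ℝ) : E2)
  have hWm : Measurable W := by
    apply Finset.measurable_sum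
    intro i _
    exact (hfm i).smul_const _
  have hWi : Integrable W (M.restrict Ω) := by
    apply integrable_finsetSum
    intro i _
    exact ((hfi i).restrict).smul_const _
  have hWe : ∀ e y, ⟪e, W y⟫ = ∑ i, f i y * e i := by
    intro e y
    simp only [W, inner_sum, inner_smul_right, EuclideanSpace.inner_single_right]
    simp
  let e0 : E2 := EuclideanSpace.single 0 (1 : ℝ)
  let n : E2 → E2 := fun y => if W y = 0 then e0 else ‖W y‖⁻¹ • W y
  have hset : MeasurableSet {y | W y = 0} := hWm (measurableSet_singleton 0)
  refine ⟨(M.restrict Ω).withDensity (fun y => (‖W y‖₊ : ℝ≥0∞)), n, hF, hΩ, ?_, ?_, ?_, ?_, ?_⟩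
  · exact isFiniteMeasure_withDensity hWi.2.ne
  · apply withDensity_absolutelyContinuous
    rw [Measure.restrict_apply hΩ.measurableSet.compl]; simp
  · exact Measurable.ite hset measurable_const (hWm.norm.inv.smul hWm)
  · intro x
    simp only [n]
    split_ifs with hx
    · exact hs 0
    · rw [norm_smul, norm_inv, norm_norm, inv_mul_cancel₀ (norm_ne_zero_iff.mpr hx)]
  · intro ζ hζ e
    rw [integral_withDensity_eq_integral_smul hWm.nnnorm]
    have e1 : ∀ y, ‖W y‖₊ • (ζ y * ⟪e, n y⟫) = ζ y * ⟪e, W y⟫ := by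
      intro y
      simp only [n]
      split_ifs with hy
      · simp [hy]
      · rw [inner_smul_right]
        have : ‖W y‖ ≠ 0 := norm_ne_zero_iff.mpr hy
        show ‖W y‖ * _ = _
        field_simp
    simp only [e1]
    have e2 : ∫ y in Ω, ζ y * ⟪e, W y⟫ ∂M = ∫ y, ζ y * ⟪e, W y⟫ ∂M :=
      setIntegral_eq_integral_of_forall_compl_eq_zero fun y hy => by rw [hζ.eq_zero hy, zero_mul]
    rw [e2]
    simp only [hWe, fderiv_apply_eq_sum _ e, Finset.mul_sum]
    obtain ⟨C, -, hC⟩ := hζ.bounded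
    rw [integral_finsetSum, integral_finsetSum]
    · congr 1; ext i
      rw [integral_mul_const, hfz i ζ hζ, ← integral_mul_const]
      congr 1; ext y; ring
    · intro i _
      have := (((hfi i).mul_const (e i)).bdd_mul (c := C) hζ.continuous.aestronglyMeasurable
        (Eventually.of_forall hC))
      exact this
    · intro i _
      exact ((hζ.integrable_fderiv _).mul_const _).integrableOn

namespace TestFun

variable {Ω : Set E2} {ζ : E2 → ℝ}

lemma hasDerivAt_integral_translate (h : TestFun Ω ζ) (z : E2) (S : Set E2) (t : ℝ) :
    HasDerivAt (fun t : ℝ => ∫ y in S, ζ (y - t • z))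
      (∫ y in S, -fderiv ℝ ζ (y - t • z) z) t := by
  obtain ⟨C, hC⟩ := (h.continuous_fderiv z).bounded_above_of_compact_support (h.compact_fderiv z)
  obtain ⟨R, hR⟩ := (h.compact_fderiv z).isCompact.isBounded.subset_closedBall (0 : E2)
  let B := Metric.closedBall (0 : E2) (R + (|t| + 1) * ‖z‖)
  have hd : ∀ y : E2, ∀ x : ℝ,
      HasDerivAt (fun t : ℝ => ζ (y - t • z)) (-fderiv ℝ ζ (y - x • z) z) x := by
    intro y x
    have h1 : HasDerivAt (fun t : ℝ => y - t • z) (-z) x := by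
      have := ((hasDerivAt_id x).smul_const z).const_sub y
      simpa using this
    have h2 := (h.differentiable (y - x • z)).hasFDerivAt.comp_hasDerivAt x h1
    rw [map_neg] at h2
    exact h2
  have hcont : ∀ x : ℝ, Continuous fun y : E2 => ζ (y - x • z) := fun x =>
    h.continuous.comp (continuous_id.sub continuous_const)
  refine (hasDerivAt_integral_of_dominated_loc_of_deriv_le (μ := volume.restrict S)
    (F := fun t y => ζ (y - t • z)) (F' := fun t y => -fderiv ℝ ζ (y - t • z) z)
    (bound := B.indicator fun _ => C)
    (Metric.ball_mem_nhds t one_pos) ?_ ?_ ?_ ?_ ?_ ?_).2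
  · exact Eventually.of_forall fun x => (hcont x).aestronglyMeasurable
  · refine Integrable.integrableOn ?_
    exact (h.continuous.integrable_of_hasCompactSupport h.compact).comp_sub_right (t • z)
  · exact (((h.continuous_fderiv z).comp
      (continuous_id.sub continuous_const)).neg).aestronglyMeasurable
  · refine Eventually.of_forall fun y x hx => ?_
    rw [norm_neg]
    by_cases hy : y ∈ B
    · rw [indicator_of_mem hy]; exact hC _
    · rw [indicator_of_notMem hy]
      have : y - x • z ∉ tsupport fun y => fderiv ℝ ζ y z := by
        intro h'
        apply hy
        have h3 := hR h'
        rw [mem_closedBall_zero_iff] at h3 ⊢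
        have h4 : |x| ≤ |t| + 1 := by
          rw [Metric.mem_ball, Real.dist_eq] at hx
          have := abs_sub_abs_le_abs_sub x t
          linarith
        calc ‖y‖ = ‖(y - x • z) + x • z‖ := by simp
          _ ≤ ‖y - x • z‖ + ‖x • z‖ := norm_add_le _ _
          _ ≤ R + (|t| + 1) * ‖z‖ := by
            rw [norm_smul, Real.norm_eq_abs]; gcongr
      have h5 := image_eq_zero_of_notMem_tsupport this
      rw [h5]; simp
  · refine Integrable.integrableOn ?_
    exact (integrable_indicator_iff measurableSet_closedBall).mpr
      (integrableOn_const (measure_closedBall_lt_top.ne))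
  · exact Eventually.of_forall fun y x _ => hd y x

lemma integral_fderiv_eq_zero (h : TestFun Ω ζ) (z : E2) : ∫ y, fderiv ℝ ζ y z = 0 := by
  have h1 := h.hasDerivAt_integral_translate z univ 0
  have h2 : (fun t : ℝ => ∫ y in univ, ζ (y - t • z)) = fun _ => ∫ y, ζ y := by
    ext t
    rw [setIntegral_univ]
    exact integral_sub_right_eq_self ζ (t • z)
  rw [h2] at h1
  have h3 := h1.unique (hasDerivAt_const _ _)
  simpa [integral_neg] using h3

end TestFun

lemma exists_testFun {K U : Set E2} (hK : IsCompact K) (hU : IsOpen U) (hKU : K ⊆ U) :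
    ∃ ζ : E2 → ℝ, TestFun U ζ ∧ (∀ x ∈ K, ζ x = 1) ∧ ∀ x, 0 ≤ ζ x ∧ ζ x ≤ 1 := by
  obtain ⟨V, hVo, hKV, hVU, hVc⟩ := exists_open_between_and_isCompact_closure hK hU hKU
  have hd : Disjoint Vᶜ K := by
    rw [disjoint_compl_left_iff_subset]; exact hKV
  obtain ⟨f, hf', hfr, hf0, hf1⟩ := exists_contMDiff_zero_iff_one_iff_of_isClosed
    (n := 1) (modelWithCornersSelf ℝ E2) hVo.isClosed_compl hK.isClosed hd
  have hf : ContDiff ℝ 1 f := hf'.contDiff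
  have hsupp : tsupport f ⊆ closure V := closure_mono fun x hx => by
    by_contra hxV
    exact hx ((hf0 x).mp hxV)
  refine ⟨f, ⟨hf, hVc.of_isClosed_subset (isClosed_tsupport f) hsupp,
    hsupp.trans hVU⟩, fun x hx => (hf1 x).mp hx, fun x => ?_⟩
  exact hfr (mem_range_self x)

namespace GGPair

variable {F Ω : Set E2} {μ : Measure E2} {ν : E2 → E2}

lemma compl (h : GGPair F μ ν Ω) : GGPair Fᶜ μ (fun x => -ν x) Ω where
  meas := h.meas.compl
  isOpen := h.isOpen
  fin := h.fin
  supp := h.supp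
  nu_meas := h.nu_meas.neg
  nu_norm := fun x => by rw [norm_neg, h.nu_norm]
  gg := fun ζ hζ e => by
    have h1 := integral_add_compl h.meas (hζ.integrable_fderiv e)
    rw [hζ.integral_fderiv_eq_zero, h.gg ζ hζ e] at h1
    simp only [inner_neg_right, mul_neg, integral_neg]
    linarith

lemma abs_inner_le (h : GGPair F μ ν Ω) (z x : E2) : |⟪z, ν x⟫| ≤ ‖z‖ := by
  have := abs_real_inner_le_norm z (ν x)
  rwa [h.nu_norm, mul_one] at this

lemma measurable_inner (h : GGPair F μ ν Ω) (z : E2) : Measurable fun x => ⟪z, ν x⟫ :=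
  h.nu_meas.const_inner

lemma integrable_mul_inner (h : GGPair F μ ν Ω) {ζ : E2 → ℝ} (hζ : TestFun Ω ζ) (z : E2) :
    Integrable (fun y => ζ y * ⟪z, ν y⟫) μ := by
  have := h.fin
  exact (hζ.integrable μ).mul_bdd (c := ‖z‖) (h.measurable_inner z).aestronglyMeasurable
    (Eventually.of_forall fun x => h.abs_inner_le z x)

end GGPair

lemma component_contDiff {T : E2 → E2} (hT : ContDiff ℝ 1 T) (i : Fin 2) :
    ContDiff ℝ 1 fun x => T x i :=
  ((EuclideanSpace.proj (𝕜 := ℝ) i).contDiff).comp hT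

lemma testFun_component {Ω : Set E2} {T : E2 → E2} (hT : ContDiff ℝ 1 T)
    (hc : HasCompactSupport T) (hs : tsupport T ⊆ Ω) (i : Fin 2) : TestFun Ω fun x => T x i := by
  have hsub : tsupport (fun x => T x i) ⊆ tsupport T :=
    closure_mono fun x hx h' => hx (by simp [h'])
  exact ⟨component_contDiff hT i, hc.of_isClosed_subset (isClosed_tsupport _) hsub, hsub.trans hs⟩

lemma div2_eq_sum {T : E2 → E2} (hT : ContDiff ℝ 1 T) (x : E2) :
    div2 T x = ∑ i : Fin 2, fderiv ℝ (fun x => T x i) x (EuclideanSpace.single i 1) := by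
  unfold div2
  congr 1; ext i
  have h1 : HasFDerivAt (fun x => T x i)
      ((EuclideanSpace.proj (𝕜 := ℝ) i).comp (fderiv ℝ T x)) x :=
    (EuclideanSpace.proj (𝕜 := ℝ) i).hasFDerivAt.comp x
      ((hT.differentiable (by norm_num)) x).hasFDerivAt
  rw [h1.fderiv]; simp

lemma GGPair.integral_div2 {F Ω : Set E2} {μ : Measure E2} {ν : E2 → E2} (h : GGPair F μ ν Ω)
    {T : E2 → E2} (hT : ContDiff ℝ 1 T)
    (hc : HasCompactSupport T) (hs : tsupport T ⊆ Ω) :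
    ∫ x in F, div2 T x = ∫ x, ⟪T x, ν x⟫ ∂μ := by
  have hi := testFun_component hT hc hs
  simp only [div2_eq_sum hT]
  rw [integral_finsetSum _ fun i _ => ((hi i).integrable_fderiv _).integrableOn]
  have : ∀ x, ⟪T x, ν x⟫ = ∑ i : Fin 2, T x i * ⟪(EuclideanSpace.single i (1 : ℝ) : E2), ν x⟫ := by
    intro x
    rw [PiLp.inner_apply]
    simp [EuclideanSpace.inner_single_left, mul_comm]
  simp only [this]
  rw [integral_finsetSum _ fun i _ => h.integrable_mul_inner (hi i) _]
  congr 1; ext i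
  exact h.gg _ (hi i) _

lemma TestFun.translate {Ω Ω' : Set E2} {ζ : E2 → ℝ} (h : TestFun Ω ζ) (w : E2)
    (hΩ : ∀ y ∈ Ω, y + w ∈ Ω') : TestFun Ω' fun y => ζ (y - w) := by
  have hc : tsupport (fun y => ζ (y - w)) = (fun y => y - w) ⁻¹' tsupport ζ :=
    tsupport_comp_eq_preimage ζ (Homeomorph.subRight w)
  refine ⟨h.contDiff.comp (contDiff_id.sub contDiff_const), ?_, ?_⟩
  · exact h.compact.comp_homeomorph (Homeomorph.subRight w)
  · rw [hc]
    intro y hy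
    have := hΩ _ (h.subset hy)
    simpa using this

namespace GGPair

variable {F Ω : Set E2} {μ : Measure E2} {ν : E2 → E2}

lemma integrable_negPart (h : GGPair F μ ν Ω) (z : E2) :
    Integrable (fun y => max (-⟪z, ν y⟫) 0) μ := by
  have := h.fin
  refine Integrable.of_bound (C := ‖z‖)
    ((h.measurable_inner z).neg.max measurable_const).aestronglyMeasurable
    (Eventually.of_forall fun y => ?_)
  rw [Real.norm_of_nonneg (le_max_right _ _)]
  exact max_le ((neg_le_abs _).trans (h.abs_inner_le z y)) (norm_nonneg _)

lemma translate_compact (h : GGPair F μ ν Ω) {x z : E2} {s : ℝ} {K : Set E2} (hK : IsCompact K)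
    (hKs : K ⊆ Metric.ball x s) (hKF : K ⊆ Fᶜ) (hKz : ∀ a ∈ K, a + z ∈ F)
    (hΩ : Metric.closedBall x (s + ‖z‖) ⊆ Ω) :
    volume.real K ≤ ∫ y in Metric.closedBall x (s + ‖z‖), max (-⟪z, ν y⟫) 0 ∂μ := by
  have hfin := h.fin
  set B := ∫ y in Metric.closedBall x (s + ‖z‖), max (-⟪z, ν y⟫) 0 ∂μ with hB
  refine le_of_forall_pos_le_add fun ε hε => ?_
  obtain ⟨U', hKU', hU'o, hU'⟩ := K.exists_isOpen_lt_add (μ := volume) hK.measure_lt_top.ne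
    (ENNReal.ofReal_pos.mpr hε).ne'
  let U := U' ∩ Metric.ball x s
  have hUo : IsOpen U := hU'o.inter Metric.isOpen_ball
  have hKU : K ⊆ U := subset_inter hKU' hKs
  have hUK : volume.real (U \ K) ≤ ε := by
    have h1 : volume U ≤ volume K + ENNReal.ofReal ε := (measure_mono inter_subset_left).trans hU'.le
    rw [measureReal_def, measure_sdiff hKU hK.measurableSet.nullMeasurableSet hK.measure_lt_top.ne]
    apply ENNReal.toReal_le_of_le_ofReal hε.le
    rwa [tsub_le_iff_left]
  obtain ⟨ζ, hζ, hζ1, hζ01⟩ := exists_testFun hK hUo hKU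
  have hζt : ∀ t ∈ Icc (0:ℝ) 1, TestFun Ω fun y => ζ (y - t • z) := by
    intro t ht
    apply hζ.translate
    intro y hy
    apply hΩ
    have h1 : dist y x < s := hy.2
    rw [Metric.mem_closedBall, dist_eq_norm]
    rw [dist_eq_norm] at h1
    calc ‖y + t • z - x‖ = ‖(y - x) + t • z‖ := by congr 1; abel
      _ ≤ ‖y - x‖ + ‖t • z‖ := norm_add_le _ _
      _ ≤ s + ‖z‖ := by
        rw [norm_smul, Real.norm_of_nonneg ht.1]
        have : t * ‖z‖ ≤ 1 * ‖z‖ := by gcongr; exact ht.2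
        linarith
  have hζout : ∀ t ∈ Icc (0:ℝ) 1, ∀ y ∉ Metric.closedBall x (s + ‖z‖), ζ (y - t • z) = 0 := by
    intro t ht y hy
    apply hζ.eq_zero
    intro hyU
    apply hy
    have h1 : dist (y - t • z) x < s := hyU.2
    rw [Metric.mem_closedBall, dist_eq_norm]
    rw [dist_eq_norm] at h1
    calc ‖y - x‖ = ‖(y - t • z - x) + t • z‖ := by congr 1; abel
      _ ≤ ‖y - t • z - x‖ + ‖t • z‖ := norm_add_le _ _
      _ ≤ s + ‖z‖ := by
        rw [norm_smul, Real.norm_of_nonneg ht.1]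
        have : t * ‖z‖ ≤ 1 * ‖z‖ := by gcongr; exact ht.2
        linarith
  let Φ : ℝ → ℝ := fun t => ∫ y in F, ζ (y - t • z)
  have hΦ : ∀ t, HasDerivAt Φ (∫ y in F, -fderiv ℝ ζ (y - t • z) z) t := fun t =>
    hζ.hasDerivAt_integral_translate z F t
  have hΦB : ∀ t ∈ Icc (0:ℝ) 1, ∫ y in F, -fderiv ℝ ζ (y - t • z) z ≤ B := by
    intro t ht
    have h1 := h.gg _ (hζt t ht) z
    have h2 : ∀ y, fderiv ℝ (fun y => ζ (y - t • z)) y z = fderiv ℝ ζ (y - t • z) z := fun y => by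
      rw [fderiv_comp_sub]
    simp only [h2] at h1
    rw [integral_neg, h1, ← integral_neg, hB,
      ← setIntegral_eq_integral_of_forall_compl_eq_zero
        (s := Metric.closedBall x (s + ‖z‖)) (fun y hy => by rw [hζout t ht y hy]; simp)]
    refine setIntegral_mono ((h.integrable_mul_inner (hζt t ht) z).neg.integrableOn)
      (h.integrable_negPart z).integrableOn fun y => ?_
    have h3 := hζ01 (y - t • z)
    have h4 := le_max_left (-⟪z, ν y⟫) 0
    have h5 := le_max_right (-⟪z, ν y⟫) 0
    show -(ζ (y - t • z) * ⟪z, ν y⟫) ≤ max (-⟪z, ν y⟫) 0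
    nlinarith [mul_le_mul_of_nonneg_left h4 h3.1]
  have hmv : Φ 1 - Φ 0 ≤ B := by
    obtain ⟨c, hc, hc'⟩ := exists_hasDerivAt_eq_slope Φ _ one_pos
      (fun t _ => (hΦ t).continuousAt.continuousWithinAt) (fun t _ => hΦ t)
    have := hΦB c (Ioo_subset_Icc_self hc)
    rw [hc'] at this
    simpa using this
  have hζint : Integrable ζ := hζ.continuous.integrable_of_hasCompactSupport hζ.compact
  have h1 : volume.real K ≤ Φ 1 := by
    have e1 : Φ 1 = ∫ a, F.indicator (fun y => ζ (y - z)) (a + z) := by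
      simp only [Φ, one_smul]
      rw [← integral_indicator h.meas]
      exact (integral_add_right_eq_self _ z).symm
    have e2 : volume.real K = ∫ a, K.indicator (fun _ => (1:ℝ)) a := by
      rw [integral_indicator hK.measurableSet]; simp
    rw [e1, e2]
    refine integral_mono ((integrable_indicator_iff hK.measurableSet).mpr
      (integrableOn_const hK.measure_lt_top.ne)) ?_ fun a => ?_
    · exact ((hζint.comp_sub_right z).indicator h.meas).comp_add_right z
    · by_cases ha : a ∈ K
      · rw [indicator_of_mem ha, indicator_of_mem (hKz a ha), add_sub_cancel_right, hζ1 a ha]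
      · rw [indicator_of_notMem ha]
        exact indicator_nonneg (fun y _ => (hζ01 _).1) _
  have h0 : Φ 0 ≤ ε := by
    refine le_trans ?_ hUK
    have e2 : volume.real (U \ K) = ∫ a, (U \ K).indicator (fun _ => (1:ℝ)) a := by
      rw [integral_indicator (hUo.measurableSet.diff hK.measurableSet)]; simp
    simp only [Φ, zero_smul, sub_zero]
    rw [← integral_indicator h.meas, e2]
    refine integral_mono (hζint.indicator h.meas)
      ((integrable_indicator_iff (hUo.measurableSet.diff hK.measurableSet)).mpr
      (integrableOn_const ?_)) fun a => ?_
    · exact ((measure_mono (sdiff_subset.trans inter_subset_right)).trans_lt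
        (measure_ball_lt_top (x := x) (r := s))).ne
    · show F.indicator ζ a ≤ _
      by_cases haU : a ∈ U
      · by_cases haK : a ∈ K
        · rw [indicator_of_notMem (hKF haK)]
          exact indicator_nonneg (fun _ _ => zero_le_one) _
        · rw [indicator_of_mem (show a ∈ U \ K from ⟨haU, haK⟩)]
          exact (indicator_le_self' (fun _ _ => (hζ01 a).1) a).trans (hζ01 a).2
      · have : ζ a = 0 := hζ.eq_zero haU
        have h3 : F.indicator ζ a = 0 := by
          by_cases haF : a ∈ F <;> simp [haF, this]
        rw [h3]
        exact indicator_nonneg (fun _ _ => zero_le_one) _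
  linarith

/-- Translation estimate: how much of the complement of `F` is moved into `F` by `z`. -/
lemma translate_le (h : GGPair F μ ν Ω) {x z : E2} {s : ℝ} {A : Set E2} (hA : MeasurableSet A)
    (hAs : A ⊆ Metric.ball x s) (hAF : A ⊆ Fᶜ)
    (hΩ : Metric.closedBall x (s + ‖z‖) ⊆ Ω) :
    volume (A ∩ {a | a + z ∈ F}) ≤
      ENNReal.ofReal (∫ y in Metric.closedBall x (s + ‖z‖), max (-⟪z, ν y⟫) 0 ∂μ) := by
  have hm : MeasurableSet (A ∩ {a | a + z ∈ F}) :=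
    hA.inter ((measurable_add_const z) h.meas)
  rw [hm.measure_eq_iSup_isCompact]
  refine iSup_le fun K => iSup_le fun hKA => iSup_le fun hK => ?_
  have := h.translate_compact hK (hKA.trans (inter_subset_left.trans hAs))
    (hKA.trans (inter_subset_left.trans hAF)) (fun a ha => (hKA ha).2) hΩ
  rw [← ofReal_measureReal hK.measure_lt_top.ne]
  exact ENNReal.ofReal_le_ofReal this

lemma translate_le_norm (h : GGPair F μ ν Ω) {x z : E2} {s : ℝ} {A : Set E2}
    (hA : MeasurableSet A) (hAs : A ⊆ Metric.ball x s) (hAF : A ⊆ Fᶜ)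
    (hΩ : Metric.closedBall x (s + ‖z‖) ⊆ Ω) :
    volume (A ∩ {a | a + z ∈ F}) ≤
      ENNReal.ofReal (‖z‖ * μ.real (Metric.closedBall x (s + ‖z‖))) := by
  have := h.fin
  refine (h.translate_le hA hAs hAF hΩ).trans (ENNReal.ofReal_le_ofReal ?_)
  calc ∫ y in Metric.closedBall x (s + ‖z‖), max (-⟪z, ν y⟫) 0 ∂μ
      ≤ ∫ y in Metric.closedBall x (s + ‖z‖), ‖z‖ ∂μ :=
        setIntegral_mono (h.integrable_negPart z).integrableOn
          (integrable_const _).integrableOn fun y =>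
            max_le ((neg_le_abs _).trans (h.abs_inner_le z y)) (norm_nonneg _)
    _ = _ := by simp [mul_comm]

lemma integrable_norm_sub (h : GGPair F μ ν Ω) (n : E2) : Integrable (fun y => ‖ν y - n‖) μ := by
  have := h.fin
  refine Integrable.of_bound (C := 1 + ‖n‖) (h.nu_meas.sub_const n).norm.aestronglyMeasurable
    (Eventually.of_forall fun y => ?_)
  rw [norm_norm]
  exact (norm_sub_le _ _).trans (by rw [h.nu_norm])

lemma translate_le_excess (h : GGPair F μ ν Ω) {x z n : E2} {s : ℝ} {A : Set E2}
    (hA : MeasurableSet A) (hAs : A ⊆ Metric.ball x s) (hAF : A ⊆ Fᶜ)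
    (hΩ : Metric.closedBall x (s + ‖z‖) ⊆ Ω) (hz : 0 ≤ ⟪z, n⟫) :
    volume (A ∩ {a | a + z ∈ F}) ≤
      ENNReal.ofReal (‖z‖ * ∫ y in Metric.closedBall x (s + ‖z‖), ‖ν y - n‖ ∂μ) := by
  have := h.fin
  refine (h.translate_le hA hAs hAF hΩ).trans (ENNReal.ofReal_le_ofReal ?_)
  rw [← integral_const_mul]
  refine setIntegral_mono (h.integrable_negPart z).integrableOn
          ((h.integrable_norm_sub n).const_mul _).integrableOn fun y => ?_
  refine max_le ?_ (by positivity)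
  have h1 : ⟪z, ν y⟫ = ⟪z, n⟫ + ⟪z, ν y - n⟫ := by rw [inner_sub_right]; ring
  have h2 := abs_real_inner_le_norm z (ν y - n)
  have h3 := neg_abs_le ⟪z, ν y - n⟫
  linarith

end GGPair

lemma lintegral_measure_inter_translate {A B : Set E2} (hA : MeasurableSet A)
    (hB : MeasurableSet B) :
    ∫⁻ z, volume (A ∩ {a | a + z ∈ B}) = volume A * volume B := by
  have h1 : ∀ z, volume (A ∩ {a | a + z ∈ B}) = ∫⁻ a in A, B.indicator (fun _ => 1) (a + z) := by
    intro z
    have hm : MeasurableSet (A ∩ {a | a + z ∈ B}) := hA.inter ((measurable_add_const z) hB)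
    rw [← setLIntegral_one, ← lintegral_indicator hm, ← lintegral_indicator hA]
    congr 1; ext a
    by_cases ha : a ∈ A <;> by_cases hb : a + z ∈ B <;> simp [ha, hb]
  simp only [h1]
  rw [lintegral_lintegral_swap]
  · have h2 : ∀ a : E2, ∫⁻ z, B.indicator (fun _ => (1 : ℝ≥0∞)) (a + z) = volume B := by
      intro a
      rw [lintegral_add_left_eq_self (fun z => B.indicator (fun _ => (1 : ℝ≥0∞)) z) a]
      rw [lintegral_indicator hB]; simp
    simp only [h2]
    simp [mul_comm]
  · exact ((measurable_const.indicator hB).comp (measurable_snd.add measurable_fst)).aemeasurable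

lemma exists_bound_deriv_smoothTransition :
    ∃ C : ℝ, 0 < C ∧ ∀ x, |deriv Real.smoothTransition x| ≤ C := by
  have hc : HasCompactSupport (deriv Real.smoothTransition) := by
    refine HasCompactSupport.intro (isCompact_Icc (a := (0:ℝ)) (b := 1)) fun x hx => ?_
    rw [mem_Icc, not_and_or, not_le, not_le] at hx
    rcases hx with hx | hx
    · have : Real.smoothTransition =ᶠ[𝓝 x] fun _ => 0 := by
        filter_upwards [Iio_mem_nhds hx] with y hy
        exact Real.smoothTransition.zero_of_nonpos (le_of_lt hy)
      rw [this.deriv_eq]; simp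
    · have : Real.smoothTransition =ᶠ[𝓝 x] fun _ => 1 := by
        filter_upwards [Ioi_mem_nhds hx] with y hy
        exact Real.smoothTransition.one_of_one_le (le_of_lt hy)
      rw [this.deriv_eq]; simp
  have hcd : ContDiff ℝ 1 Real.smoothTransition := Real.smoothTransition.contDiff
  obtain ⟨C, hC⟩ := (hcd.continuous_deriv le_rfl).bounded_above_of_compact_support hc
  exact ⟨max C 1, by positivity, fun x => (hC x).trans (le_max_left _ _)⟩

/-- A bound for the derivative of `Real.smoothTransition`. -/
def stBound : ℝ := exists_bound_deriv_smoothTransition.choose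

lemma stBound_pos : 0 < stBound := exists_bound_deriv_smoothTransition.choose_spec.1

lemma abs_deriv_smoothTransition_le (x : ℝ) : |deriv Real.smoothTransition x| ≤ stBound :=
  exists_bound_deriv_smoothTransition.choose_spec.2 x

/-- A radial cutoff between the balls of radius `r` and `R`. -/
def radialCutoff (x : E2) (r R : ℝ) (y : E2) : ℝ :=
  Real.smoothTransition ((R ^ 2 - ‖y - x‖ ^ 2) / (R ^ 2 - r ^ 2))

section radial

variable {x : E2} {r R : ℝ}

lemma radialCutoff_eq_one (hr : 0 < r) (hR : r < R) {y : E2} (hy : ‖y - x‖ ≤ r) :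
    radialCutoff x r R y = 1 := by
  apply Real.smoothTransition.one_of_one_le
  rw [one_le_div (by nlinarith)]
  have : ‖y - x‖ ^ 2 ≤ r ^ 2 := by gcongr
  linarith

lemma radialCutoff_eq_zero (hr : 0 < r) (hR : r < R) {y : E2} (hy : R ≤ ‖y - x‖) :
    radialCutoff x r R y = 0 := by
  apply Real.smoothTransition.zero_of_nonpos
  have hR0 : 0 ≤ R := by linarith
  apply div_nonpos_of_nonpos_of_nonneg
  · have : R ^ 2 ≤ ‖y - x‖ ^ 2 := by gcongr
    linarith
  · nlinarith

lemma radialCutoff_nonneg (y : E2) : 0 ≤ radialCutoff x r R y := Real.smoothTransition.nonneg _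

lemma radialCutoff_le_one (y : E2) : radialCutoff x r R y ≤ 1 := Real.smoothTransition.le_one _

lemma radialCutoff_contDiff : ContDiff ℝ 1 (radialCutoff x r R) := by
  refine Real.smoothTransition.contDiff.comp ?_
  refine ContDiff.div_const ?_ _
  exact contDiff_const.sub ((contDiff_id.sub contDiff_const).norm_sq ℝ)

lemma tsupport_radialCutoff (hr : 0 < r) (hR : r < R) :
    tsupport (radialCutoff x r R) ⊆ Metric.closedBall x R := by
  refine closure_minimal (fun y hy => ?_) Metric.isClosed_closedBall
  by_contra h
  rw [Metric.mem_closedBall, dist_eq_norm, not_le] at h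
  exact hy (radialCutoff_eq_zero hr hR h.le)

lemma testFun_radialCutoff (hr : 0 < r) (hR : r < R) {Ω : Set E2}
    (hΩ : Metric.closedBall x R ⊆ Ω) : TestFun Ω (radialCutoff x r R) :=
  ⟨radialCutoff_contDiff, (isCompact_closedBall x R).of_isClosed_subset (isClosed_tsupport _)
    (tsupport_radialCutoff hr hR), (tsupport_radialCutoff hr hR).trans hΩ⟩

lemma abs_fderiv_radialCutoff_le (hr : 0 < r) (hR : r < R) (y : E2) {n : E2} (hn : ‖n‖ = 1) :
    |fderiv ℝ (radialCutoff x r R) y n| ≤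
      (Metric.closedBall x R).indicator (fun _ => 2 * stBound / (R - r)) y := by
  by_cases hy : y ∈ Metric.closedBall x R
  · rw [indicator_of_mem hy]
    rw [Metric.mem_closedBall, dist_eq_norm] at hy
    have h1 : HasFDerivAt (fun y : E2 => ‖y - x‖ ^ 2) ((2 : ℕ) • (innerSL ℝ (y - x) : E2 →L[ℝ] ℝ)) y := by
      have := ((hasFDerivAt_id y).sub_const x).norm_sq
      simpa using this
    have h2 : HasFDerivAt (fun y : E2 => (R ^ 2 - ‖y - x‖ ^ 2) / (R ^ 2 - r ^ 2))
        ((R ^ 2 - r ^ 2)⁻¹ • -((2 : ℕ) • (innerSL ℝ (y - x) : E2 →L[ℝ] ℝ))) y := by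
      simp only [div_eq_mul_inv]
      exact (h1.const_sub (R ^ 2)).mul_const (R ^ 2 - r ^ 2)⁻¹
    have h3 := (Real.smoothTransition.contDiff (n := 1)).differentiable (by norm_num)
      ((R ^ 2 - ‖y - x‖ ^ 2) / (R ^ 2 - r ^ 2))
    have h4 := h3.hasDerivAt.comp_hasFDerivAt y h2
    have h5 : HasFDerivAt (radialCutoff x r R) _ y := h4
    rw [h5.fderiv]
    have hpos : 0 < R ^ 2 - r ^ 2 := by nlinarith
    have h6 := abs_deriv_smoothTransition_le ((R ^ 2 - ‖y - x‖ ^ 2) / (R ^ 2 - r ^ 2))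
    have h7 : |⟪y - x, n⟫| ≤ R := by
      refine (abs_real_inner_le_norm _ _).trans ?_
      rwa [hn, mul_one]
    set D := deriv Real.smoothTransition ((R ^ 2 - ‖y - x‖ ^ 2) / (R ^ 2 - r ^ 2))
    have e : (D • ((R ^ 2 - r ^ 2)⁻¹ • -((2 : ℕ) • (innerSL ℝ (y - x) : E2 →L[ℝ] ℝ)))) n =
      -(D * ((R ^ 2 - r ^ 2)⁻¹ * (2 * ⟪y - x, n⟫))) := by
      simp [inner_sub_left]
    rw [e, abs_neg, abs_mul, abs_mul, abs_mul, abs_inv, abs_of_pos hpos, abs_two]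
    have hs := stBound_pos
    calc |D| * ((R ^ 2 - r ^ 2)⁻¹ * (2 * |⟪y - x, n⟫|)) ≤
        stBound * ((R ^ 2 - r ^ 2)⁻¹ * (2 * R)) := by gcongr
      _ ≤ 2 * stBound / (R - r) := by
        have : R ^ 2 - r ^ 2 = (R - r) * (R + r) := by ring
        rw [this, mul_inv, div_eq_mul_inv]
        have h8 : (R + r)⁻¹ * R ≤ 1 := by
          rw [inv_mul_le_iff₀ (by linarith)]; linarith
        have h9 : 0 < (R - r)⁻¹ := inv_pos.mpr (by linarith)
        calc stBound * ((R - r)⁻¹ * (R + r)⁻¹ * (2 * R)) =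
            2 * stBound * (R - r)⁻¹ * ((R + r)⁻¹ * R) := by ring
          _ ≤ 2 * stBound * (R - r)⁻¹ * 1 := by gcongr
          _ = _ := by ring
  · rw [indicator_of_notMem hy]
    have : y ∉ tsupport (radialCutoff x r R) := fun h => hy (tsupport_radialCutoff hr hR h)
    rw [fderiv_of_notMem_tsupport (𝕜 := ℝ) this]; simp

lemma radialCutoff_superlevel (hr : 0 < r) (hR : r < R) {t : ℝ} (ht : 0 < t) :
    {y | t ≤ radialCutoff x r R y} = ∅ ∨
      ∃ ρ, r ≤ ρ ∧ ρ < R ∧ {y | t ≤ radialCutoff x r R y} = Metric.closedBall x ρ := by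
  rcases lt_or_ge 1 t with h1 | h1
  · left
    ext y
    simp only [mem_ofPred_eq, mem_empty_iff_false, iff_false, not_le]
    exact (radialCutoff_le_one y).trans_lt h1
  right
  let H : ℝ → ℝ := fun s => Real.smoothTransition ((R ^ 2 - s ^ 2) / (R ^ 2 - r ^ 2))
  have hH : Continuous H := Real.smoothTransition.continuous.comp (by fun_prop)
  have hHψ : ∀ y, radialCutoff x r R y = H ‖y - x‖ := fun y => rfl
  have hpos : 0 < R ^ 2 - r ^ 2 := by nlinarith
  have hc : IsCompact (Icc r R ∩ {s | t ≤ H s}) :=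
    isCompact_Icc.inter_right (isClosed_le continuous_const hH)
  have hHr : H r = 1 := by simp [H, div_self hpos.ne']
  have hHR : H R = 0 := by simp [H]
  obtain ⟨ρ, hρ, hmax⟩ := hc.exists_isMaxOn ⟨r, ⟨le_rfl, hR.le⟩, by simpa [hHr] using h1⟩
    continuousOn_id
  have hρt : t ≤ H ρ := hρ.2
  refine ⟨ρ, hρ.1.1, lt_of_le_of_ne hρ.1.2 ?_, ?_⟩
  · rintro rfl
    rw [hHR] at hρt; linarith
  · ext y
    rw [Metric.mem_closedBall, dist_eq_norm, mem_ofPred_eq]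
    constructor
    · intro hy
      by_contra hlt
      rw [not_le] at hlt
      have h2 : ‖y - x‖ ≤ R := by
        by_contra h3
        rw [radialCutoff_eq_zero hr hR (not_le.mp h3).le] at hy
        linarith
      have : ‖y - x‖ ≤ ρ := hmax (show ‖y - x‖ ∈ _ from ⟨⟨hρ.1.1.trans hlt.le, h2⟩, hy⟩)
      linarith
    · intro hy
      refine hρt.trans ?_
      rw [hHψ]
      apply Real.smoothTransition.monotone
      have : ‖y - x‖ ^ 2 ≤ ρ ^ 2 := by gcongr
      gcongr

end radial

namespace GGPair

variable {F Ω : Set E2} {μ : Measure E2} {ν : E2 → E2}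

lemma integral_radialCutoff_mul_le (h : GGPair F μ ν Ω) {x n : E2} {r R ε : ℝ} (hr : 0 < r)
    (hR : r < R) (hε : 0 ≤ ε)
    (hexc : ∀ ρ, r ≤ ρ → ρ < R → ∫ y in Metric.closedBall x ρ, ‖ν y - n‖ ∂μ ≤
      ε * μ.real (Metric.closedBall x ρ)) :
    ∫ y, radialCutoff x r R y * ‖ν y - n‖ ∂μ ≤ ε * ∫ y, radialCutoff x r R y ∂μ := by
  have := h.fin
  have hψc : Continuous (radialCutoff x r R) := radialCutoff_contDiff.continuous
  have hψi : Integrable (radialCutoff x r R) μ :=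
    (testFun_radialCutoff hr hR (subset_univ _)).integrable μ
  have hm : Measurable fun y => ENNReal.ofReal ‖ν y - n‖ :=
    (h.nu_meas.sub_const n).norm.ennreal_ofReal
  let κ := μ.withDensity fun y => ENNReal.ofReal ‖ν y - n‖
  have hκ : ∀ ρ, r ≤ ρ → ρ < R → κ (Metric.closedBall x ρ) ≤
      ENNReal.ofReal ε * μ (Metric.closedBall x ρ) := by
    intro ρ h1 h2
    rw [withDensity_apply _ measurableSet_closedBall,
      ← ofReal_integral_eq_lintegral_ofReal (h.integrable_norm_sub n).integrableOn
        (Eventually.of_forall fun y => norm_nonneg _),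
      ← ofReal_measureReal (measure_ne_top μ _), ← ENNReal.ofReal_mul hε]
    exact ENNReal.ofReal_le_ofReal (hexc ρ h1 h2)
  have key : ∫⁻ y, ENNReal.ofReal (radialCutoff x r R y) ∂κ ≤
      ENNReal.ofReal ε * ∫⁻ y, ENNReal.ofReal (radialCutoff x r R y) ∂μ := by
    rw [lintegral_eq_lintegral_meas_le κ (Eventually.of_forall radialCutoff_nonneg)
      hψc.measurable.aemeasurable,
      lintegral_eq_lintegral_meas_le μ (Eventually.of_forall radialCutoff_nonneg)
      hψc.measurable.aemeasurable, ← lintegral_const_mul' _ _ ENNReal.ofReal_ne_top]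
    refine setLIntegral_mono' measurableSet_Ioi fun t ht => ?_
    rcases radialCutoff_superlevel (x := x) hr hR ht with h0 | ⟨ρ, h1, h2, h3⟩
    · rw [h0]; simp
    · rw [h3]; exact hκ ρ h1 h2
  rw [lintegral_withDensity_eq_lintegral_mul _ hm hψc.measurable.ennreal_ofReal,
    ← ofReal_integral_eq_lintegral_ofReal hψi (Eventually.of_forall radialCutoff_nonneg),
    ← ENNReal.ofReal_mul hε] at key
  have hi2 : Integrable (fun y => radialCutoff x r R y * ‖ν y - n‖) μ :=
    (h.integrable_norm_sub n).bdd_mul (c := 1) hψc.aestronglyMeasurable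
      (Eventually.of_forall fun y => by
        rw [Real.norm_of_nonneg (radialCutoff_nonneg y)]; exact radialCutoff_le_one y)
  have h0 : 0 ≤ ∫ y, radialCutoff x r R y ∂μ := integral_nonneg radialCutoff_nonneg
  have e : ∫⁻ y, ((fun y => ENNReal.ofReal ‖ν y - n‖) *
      fun y => ENNReal.ofReal (radialCutoff x r R y)) y ∂μ =
      ENNReal.ofReal (∫ y, radialCutoff x r R y * ‖ν y - n‖ ∂μ) := by
    rw [ofReal_integral_eq_lintegral_ofReal hi2 (Eventually.of_forall fun y =>
      mul_nonneg (radialCutoff_nonneg y) (norm_nonneg _))]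
    congr 1; ext y
    rw [Pi.mul_apply, ← ENNReal.ofReal_mul (norm_nonneg _), mul_comm]
  rw [e] at key
  exact (ENNReal.ofReal_le_ofReal_iff (mul_nonneg hε h0)).mp key

lemma mass_le (h : GGPair F μ ν Ω) {x n : E2} (hn : ‖n‖ = 1) {r R : ℝ} (hr : 0 < r) (hR : r < R)
    (hΩ : Metric.closedBall x R ⊆ Ω)
    (hexc : ∀ ρ, r ≤ ρ → ρ < R → ∫ y in Metric.closedBall x ρ, ‖ν y - n‖ ∂μ ≤
      1 / 2 * μ.real (Metric.closedBall x ρ)) :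
    μ.real (Metric.closedBall x r) ≤
      4 * stBound / (R - r) * volume.real (F ∩ Metric.closedBall x R) := by
  have := h.fin
  have hψ := testFun_radialCutoff (x := x) hr hR hΩ
  have h1 := h.integral_radialCutoff_mul_le hr hR (by norm_num) hexc
  have hψi : Integrable (radialCutoff x r R) μ := hψ.integrable μ
  have hi2 : Integrable (fun y => radialCutoff x r R y * ‖ν y - n‖) μ :=
    (h.integrable_norm_sub n).bdd_mul (c := 1) hψ.continuous.aestronglyMeasurable
      (Eventually.of_forall fun y => by
        rw [Real.norm_of_nonneg (radialCutoff_nonneg y)]; exact radialCutoff_le_one y)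
  have h2 : ∫ y, radialCutoff x r R y ∂μ - ∫ y, radialCutoff x r R y * ‖ν y - n‖ ∂μ ≤
      ∫ y, radialCutoff x r R y * ⟪n, ν y⟫ ∂μ := by
    rw [← integral_sub hψi hi2]
    refine integral_mono (hψi.sub hi2) (h.integrable_mul_inner hψ n) fun y => ?_
    have e1 : ⟪n, ν y⟫ = 1 + ⟪n, ν y - n⟫ := by
      rw [inner_sub_right, real_inner_self_eq_norm_sq, hn]; ring
    have e2 := abs_real_inner_le_norm n (ν y - n)
    rw [hn, one_mul] at e2
    have e3 := neg_abs_le ⟪n, ν y - n⟫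
    have e4 := radialCutoff_nonneg (x := x) (r := r) (R := R) y
    show radialCutoff x r R y - radialCutoff x r R y * ‖ν y - n‖ ≤ radialCutoff x r R y * ⟪n, ν y⟫
    rw [e1]
    nlinarith
  have hball : volume (F ∩ Metric.closedBall x R) ≠ ⊤ :=
    ((measure_mono inter_subset_right).trans_lt (measure_closedBall_lt_top (x := x) (r := R))).ne
  have h3 : ∫ y, radialCutoff x r R y * ⟪n, ν y⟫ ∂μ ≤
      2 * stBound / (R - r) * volume.real (F ∩ Metric.closedBall x R) := by
    rw [← h.gg _ hψ n]
    have hind : Integrable (fun y => (Metric.closedBall x R).indicator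
        (fun _ => 2 * stBound / (R - r)) y) (volume.restrict F) :=
      (integrable_indicator_iff measurableSet_closedBall).mpr (integrableOn_const (by
        rw [Measure.restrict_apply measurableSet_closedBall, inter_comm]; exact hball))
    calc ∫ y in F, fderiv ℝ (radialCutoff x r R) y n
        ≤ ∫ y in F, (Metric.closedBall x R).indicator (fun _ => 2 * stBound / (R - r)) y :=
          integral_mono (hψ.integrable_fderiv n).integrableOn hind fun y =>
            (le_abs_self _).trans (abs_fderiv_radialCutoff_le hr hR y hn)
      _ = _ := by
          rw [integral_indicator measurableSet_closedBall, Measure.restrict_restrict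
            measurableSet_closedBall, integral_const, inter_comm]
          simp [mul_comm]
  have h4 : μ.real (Metric.closedBall x r) ≤ ∫ y, radialCutoff x r R y ∂μ := by
    have : μ.real (Metric.closedBall x r) =
        ∫ y, (Metric.closedBall x r).indicator (fun _ => (1:ℝ)) y ∂μ := by
      rw [integral_indicator measurableSet_closedBall]; simp
    rw [this]
    refine integral_mono ((integrable_const _).indicator measurableSet_closedBall) hψi fun y => ?_
    by_cases hy : y ∈ Metric.closedBall x r
    · rw [indicator_of_mem hy, radialCutoff_eq_one hr hR (by
        rwa [Metric.mem_closedBall, dist_eq_norm] at hy)]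
    · rw [indicator_of_notMem hy]; exact radialCutoff_nonneg y
  have e : 4 * stBound / (R - r) * volume.real (F ∩ Metric.closedBall x R) =
    2 * (2 * stBound / (R - r) * volume.real (F ∩ Metric.closedBall x R)) := by ring
  rw [e]
  linarith

end GGPair

/-- `x` is a point of the support of `μ` and a Lebesgue point of `ν` with respect to `μ`. -/
structure IsLebesguePt (μ : Measure E2) (ν : E2 → E2) (x : E2) : Prop where
  pos : ∀ᶠ r in 𝓝[>] (0 : ℝ), 0 < μ.real (Metric.closedBall x r)
  excess : ∀ ε > 0, ∀ᶠ r in 𝓝[>] (0 : ℝ),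
    ∫ y in Metric.closedBall x r, ‖ν y - ν x‖ ∂μ ≤ ε * μ.real (Metric.closedBall x r)

lemma IsLebesguePt.compl {μ : Measure E2} {ν : E2 → E2} {x : E2} (h : IsLebesguePt μ ν x) :
    IsLebesguePt μ (fun y => -ν y) x := by
  refine ⟨h.pos, fun ε hε => ?_⟩
  have e : ∀ y, ‖-ν y - -ν x‖ = ‖ν y - ν x‖ := fun y => by
    rw [← norm_neg]; congr 1; abel
  simpa only [e] using h.excess ε hε

lemma exists_forall_of_eventually_nhdsGT {P : ℝ → Prop} (h : ∀ᶠ r in 𝓝[>] (0 : ℝ), P r) :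
    ∃ r₀ > 0, ∀ r, 0 < r → r < r₀ → P r := by
  obtain ⟨u, hu, hs⟩ := mem_nhdsGT_iff_exists_Ioo_subset.mp h
  exact ⟨u, hu, fun r h1 h2 => hs ⟨h1, h2⟩⟩

lemma eventually_nhdsGT_of_forall {P : ℝ → Prop} {r₀ : ℝ} (h0 : 0 < r₀)
    (h : ∀ r, 0 < r → r < r₀ → P r) : ∀ᶠ r in 𝓝[>] (0 : ℝ), P r :=
  mem_nhdsGT_iff_exists_Ioo_subset.mpr ⟨r₀, h0, fun r hr => h r hr.1 hr.2⟩

namespace GGPair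

variable {F Ω : Set E2} {μ : Measure E2} {ν : E2 → E2}

lemma ae_isLebesguePt (h : GGPair F μ ν Ω) : ∀ᵐ x ∂μ, IsLebesguePt μ ν x := by
  have := h.fin
  have hint : Integrable ν μ := Integrable.of_bound (C := 1) h.nu_meas.aestronglyMeasurable
    (Eventually.of_forall fun y => (h.nu_norm y).le)
  filter_upwards [(Besicovitch.vitaliFamily μ).ae_tendsto_average_norm_sub hint.locallyIntegrable,
    (Besicovitch.vitaliFamily μ).ae_eventually_measure_pos] with x h1 h2
  have h3 := (Besicovitch.tendsto_filterAt μ x).eventually h2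
  have h4 := h1.comp (Besicovitch.tendsto_filterAt μ x)
  have hpos : ∀ᶠ r in 𝓝[>] (0 : ℝ), 0 < μ.real (Metric.closedBall x r) := by
    filter_upwards [h3] with r hr
    exact ENNReal.toReal_pos hr.ne' (measure_ne_top _ _)
  refine ⟨hpos, fun ε hε => ?_⟩
  filter_upwards [hpos, h4.eventually (gt_mem_nhds hε)] with r h5 h6
  rw [Function.comp_apply, setAverage_eq, smul_eq_mul, inv_mul_lt_iff₀ h5] at h6
  linarith

lemma exists_mass_le (h : GGPair F μ ν Ω) {x : E2} (hx : x ∈ Ω) (hL : IsLebesguePt μ ν x) :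
    ∃ r₀ > 0, Metric.closedBall x r₀ ⊆ Ω ∧ ∀ r R, 0 < r → r < R → R < r₀ →
      μ.real (Metric.closedBall x r) ≤
        4 * stBound / (R - r) * volume.real (F ∩ Metric.closedBall x R) := by
  obtain ⟨r₁, h1, h1'⟩ := exists_forall_of_eventually_nhdsGT (hL.excess (1 / 2) (by norm_num))
  obtain ⟨r₂, h2, h2'⟩ := Metric.nhds_basis_closedBall.mem_iff.mp (h.isOpen.mem_nhds hx)
  refine ⟨min r₁ r₂, lt_min h1 h2,
    (Metric.closedBall_subset_closedBall (min_le_right _ _)).trans h2', fun r R hr hR hR0 => ?_⟩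
  refine h.mass_le (h.nu_norm x) hr hR
    ((Metric.closedBall_subset_closedBall (hR0.le.trans (min_le_right _ _))).trans h2')
    fun ρ hρ hρR => h1' ρ (hr.trans_le hρ) (hρR.trans (hR0.trans_le (min_le_left _ _)))

lemma decay_step (h : GGPair F μ ν Ω) {x : E2} {s R κ : ℝ} (hs : 0 < s) (hsR : s < R)
    (hΩ : Metric.closedBall x R ⊆ Ω) (hκ0 : 0 < κ) (hκ : κ ≤ 1 / 4) (hκ' : 128 * stBound * κ ≤ 1)
    (hmass : ∀ r ρ, 0 < r → r < ρ → ρ < R → μ.real (Metric.closedBall x r) ≤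
        4 * stBound / (ρ - r) * volume.real (F ∩ Metric.closedBall x ρ))
    (hm : volume.real (F ∩ Metric.ball x R) ≤ Real.pi * κ ^ 2 * (R - s) ^ 2 / 2) :
    volume.real (F ∩ Metric.ball x s) ≤ volume.real (F ∩ Metric.ball x R) / 4 := by
  have hfin : ∀ ρ, volume (F ∩ Metric.ball x ρ) ≠ ⊤ := fun ρ =>
    ((measure_mono inter_subset_right).trans_lt measure_ball_lt_top).ne
  set ℓ := κ * (R - s) with hℓ
  have hd : 0 < R - s := by linarith
  have hℓ0 : 0 < ℓ := by positivity
  have hℓ1 : ℓ ≤ (R - s) / 4 := by rw [hℓ]; nlinarith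
  set A := F ∩ Metric.ball x s with hA
  have hAm : MeasurableSet A := h.meas.inter measurableSet_ball
  set m := volume.real (F ∩ Metric.ball x R) with hmdef
  have hm0 : 0 ≤ m := measureReal_nonneg
  set q := μ.real (Metric.closedBall x (s + ℓ)) with hq
  have hq0 : 0 ≤ q := measureReal_nonneg
  have hqm : ℓ * q ≤ m / 16 := by
    have h1 := hmass (s + ℓ) (R - (R - s) / 4) (by linarith) (by linarith) (by linarith)
    have h2 : volume.real (F ∩ Metric.closedBall x (R - (R - s) / 4)) ≤ m :=
      measureReal_mono (inter_subset_inter_right _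
        (Metric.closedBall_subset_ball (by linarith))) (hfin R)
    have hst := stBound_pos
    have h3 : 4 * stBound / (R - (R - s) / 4 - (s + ℓ)) ≤ 4 * stBound / ((R - s) / 2) := by
      gcongr; linarith
    have h4 : q ≤ 4 * stBound / ((R - s) / 2) * m :=
      h1.trans (mul_le_mul h3 h2 measureReal_nonneg (by positivity))
    calc ℓ * q ≤ ℓ * (4 * stBound / ((R - s) / 2) * m) := by gcongr
      _ = (128 * stBound * κ) * (m / 16) := by rw [hℓ]; field_simp; ring
      _ ≤ 1 * (m / 16) := by gcongr
      _ = m / 16 := one_mul _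
  have hV : volume (Metric.ball (0 : E2) ℓ) = ENNReal.ofReal (Real.pi * ℓ ^ 2) := by
    rw [EuclideanSpace.volume_ball_fin_two, ENNReal.ofReal_mul Real.pi_pos.le,
      ENNReal.ofReal_pow hℓ0.le, mul_comm]
  have key : ENNReal.ofReal (Real.pi * ℓ ^ 2) * volume A ≤
      ENNReal.ofReal (Real.pi * ℓ ^ 2) * ENNReal.ofReal (ℓ * q) +
        volume A * volume (F ∩ Metric.ball x R) := by
    calc ENNReal.ofReal (Real.pi * ℓ ^ 2) * volume A
        = ∫⁻ z in Metric.ball (0 : E2) ℓ, volume A := by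
          rw [setLIntegral_const, hV, mul_comm]
      _ ≤ ∫⁻ z in Metric.ball (0 : E2) ℓ, (ENNReal.ofReal (ℓ * q) +
            volume (A ∩ {a | a + z ∈ F ∩ Metric.ball x R})) := by
          refine setLIntegral_mono' measurableSet_ball fun z hz => ?_
          rw [mem_ball_zero_iff] at hz
          have hsub : Metric.closedBall x (s + ‖z‖) ⊆ Metric.closedBall x (s + ℓ) :=
            Metric.closedBall_subset_closedBall (by linarith)
          have h1 := h.compl.translate_le_norm (x := x) (z := z) (s := s) hAm inter_subset_right
            (by rw [compl_compl]; exact inter_subset_left)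
            (hsub.trans ((Metric.closedBall_subset_closedBall (by linarith)).trans hΩ))
          have hfinμ := h.fin
          have h2 : ENNReal.ofReal (‖z‖ * μ.real (Metric.closedBall x (s + ‖z‖))) ≤
              ENNReal.ofReal (ℓ * q) :=
            ENNReal.ofReal_le_ofReal (mul_le_mul hz.le (measureReal_mono hsub)
              measureReal_nonneg hℓ0.le)
          refine le_trans (measure_mono ?_) ((measure_union_le _ _).trans
            (add_le_add_left (h1.trans h2) _))
          intro a ha
          by_cases haz : a + z ∈ F
          · right
            refine ⟨ha, haz, ?_⟩
            have h3 : dist a x < s := ha.2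
            rw [Metric.mem_ball]
            calc dist (a + z) x ≤ dist (a + z) a + dist a x := dist_triangle _ _ _
              _ = ‖z‖ + dist a x := by rw [dist_eq_norm]; simp
              _ < R := by linarith
          · exact Or.inl ⟨ha, haz⟩
      _ ≤ _ := by
          rw [lintegral_add_left measurable_const, setLIntegral_const, hV, mul_comm]
          gcongr
          refine (setLIntegral_le_lintegral _ _).trans (le_of_eq ?_)
          exact lintegral_measure_inter_translate hAm (h.meas.inter measurableSet_ball)
  have hAe : volume A = ENNReal.ofReal (volume.real A) := (ofReal_measureReal (hfin s)).symm
  have hRe : volume (F ∩ Metric.ball x R) = ENNReal.ofReal m := (ofReal_measureReal (hfin R)).symm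
  have hp : 0 < Real.pi * ℓ ^ 2 := by positivity
  have hA0 : 0 ≤ volume.real A := measureReal_nonneg
  rw [hAe, hRe, ← ENNReal.ofReal_mul hp.le, ← ENNReal.ofReal_mul hp.le, ← ENNReal.ofReal_mul hA0,
    ← ENNReal.ofReal_add (by positivity) (by positivity),
    ENNReal.ofReal_le_ofReal_iff (by positivity)] at key
  have h5 : m ≤ Real.pi * ℓ ^ 2 / 2 := by rw [hℓ]; convert hm using 1; ring
  have h6 : volume.real A * m ≤ volume.real A * (Real.pi * ℓ ^ 2 / 2) := by gcongr
  have h7 : Real.pi * ℓ ^ 2 * (volume.real A) ≤ Real.pi * ℓ ^ 2 * (2 * (ℓ * q)) := by nlinarith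
  have h8 := le_of_mul_le_mul_left h7 hp
  linarith

lemma exists_density_le (h : GGPair F μ ν Ω) {x : E2} (hx : x ∈ Ω) (hL : IsLebesguePt μ ν x) :
    ∃ η > 0, ∀ᶠ r in 𝓝[>] (0 : ℝ), η * r ^ 2 ≤ volume.real (F ∩ Metric.ball x r) := by
  obtain ⟨r₀, hr₀, hΩ, hmass⟩ := h.exists_mass_le hx hL
  obtain ⟨r₁, hr₁, hpos⟩ := exists_forall_of_eventually_nhdsGT hL.pos
  have hst := stBound_pos
  obtain ⟨κ, hκ0, hκ, hκ'⟩ : ∃ κ : ℝ, 0 < κ ∧ κ ≤ 1 / 4 ∧ 128 * stBound * κ ≤ 1 := by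
    refine ⟨min (1 / 4) (1 / (128 * stBound)), by positivity, min_le_left _ _, ?_⟩
    calc 128 * stBound * min (1 / 4) (1 / (128 * stBound)) ≤
        128 * stBound * (1 / (128 * stBound)) := by gcongr; exact min_le_right _ _
      _ = 1 := by field_simp
  have hfin : ∀ ρ, volume (F ∩ Metric.ball x ρ) ≠ ⊤ := fun ρ =>
    ((measure_mono inter_subset_right).trans_lt measure_ball_lt_top).ne
  refine ⟨Real.pi * κ ^ 2 / 32, by positivity, ?_⟩
  refine eventually_nhdsGT_of_forall (lt_min hr₀ hr₁) fun R hR hR0 => ?_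
  by_contra hlt
  rw [not_le] at hlt
  have hRr₀ := hR0.trans_le (min_le_left _ _)
  have hRr₁ := hR0.trans_le (min_le_right _ _)
  set r := R / 2 with hr
  have hRk : ∀ k : ℕ, 0 < (1 / 2 : ℝ) ^ k ∧ (1 / 2 : ℝ) ^ k ≤ 1 := fun k =>
    ⟨by positivity, pow_le_one₀ (by norm_num) (by norm_num)⟩
  have hdec : ∀ k : ℕ, volume.real (F ∩ Metric.ball x (r * (1 + (1 / 2) ^ k))) ≤
      (1 / 4) ^ k * (Real.pi * κ ^ 2 * r ^ 2 / 8) := by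
    intro k
    induction k with
    | zero =>
      have e : r * (1 + (1 / 2) ^ 0) = R := by rw [hr]; ring
      rw [e]
      refine hlt.le.trans (le_of_eq ?_)
      rw [hr]; ring
    | succ k ih =>
      have h1 := hRk k
      have h2 := hRk (k + 1)
      have hr0 : 0 < r := by positivity
      have hle : r * (1 + (1 / 2) ^ k) ≤ R := by
        rw [hr]; nlinarith
      have e : (1 / 2 : ℝ) ^ (k + 1) = (1 / 2) ^ k / 2 := by rw [pow_succ]; ring
      have e4 : (1 / 4 : ℝ) ^ k = (1 / 2) ^ k * (1 / 2) ^ k := by rw [← mul_pow]; norm_num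
      have := h.decay_step (x := x) (s := r * (1 + (1 / 2) ^ (k + 1)))
        (R := r * (1 + (1 / 2) ^ k)) (κ := κ) (by positivity) (by rw [e]; nlinarith)
        ((Metric.closedBall_subset_closedBall (hle.trans hRr₀.le)).trans hΩ) hκ0 hκ hκ'
        (fun a b ha hab hb => hmass a b ha hab (by linarith))
        (ih.trans (le_of_eq (by rw [e, e4]; ring)))
      refine this.trans ?_
      rw [pow_succ]
      linarith
  have hlim : volume.real (F ∩ Metric.ball x r) ≤ 0 := by
    have ht : Tendsto (fun k : ℕ => (1 / 4 : ℝ) ^ k * (Real.pi * κ ^ 2 * r ^ 2 / 8)) atTop (𝓝 0) := by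
      have := (tendsto_pow_atTop_nhds_zero_of_lt_one (r := (1 / 4 : ℝ)) (by norm_num)
        (by norm_num)).mul_const (Real.pi * κ ^ 2 * r ^ 2 / 8)
      simpa using this
    refine ge_of_tendsto' ht fun k => le_trans ?_ (hdec k)
    refine measureReal_mono (inter_subset_inter_right _ (Metric.ball_subset_ball ?_)) (hfin _)
    have := (hRk k).1
    have hr0 : 0 < r := by positivity
    nlinarith
  have h9 := hmass (r / 4) (r / 2) (by positivity) (by linarith) (by linarith)
  have h10 : volume.real (F ∩ Metric.closedBall x (r / 2)) ≤ 0 :=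
    (measureReal_mono (inter_subset_inter_right _
      (Metric.closedBall_subset_ball (by linarith))) (hfin _)).trans hlim
  have h11 : volume.real (F ∩ Metric.closedBall x (r / 2)) = 0 :=
    le_antisymm h10 measureReal_nonneg
  rw [h11, mul_zero] at h9
  exact absurd (hpos (r / 4) (by positivity) (by linarith)) (not_lt.mpr h9)

lemma exists_mass_le_linear (h : GGPair F μ ν Ω) {x : E2} (hx : x ∈ Ω)
    (hL : IsLebesguePt μ ν x) :
    ∃ C > 0, ∀ᶠ r in 𝓝[>] (0 : ℝ), μ.real (Metric.closedBall x r) ≤ C * r := by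
  obtain ⟨r₀, hr₀, hΩ, hmass⟩ := h.exists_mass_le hx hL
  have hst := stBound_pos
  refine ⟨4 * stBound * Real.pi * 4, by positivity, ?_⟩
  refine eventually_nhdsGT_of_forall (half_pos hr₀) fun r hr hr0 => ?_
  refine (hmass r (2 * r) hr (by linarith) (by linarith)).trans ?_
  have h1 : volume.real (F ∩ Metric.closedBall x (2 * r)) ≤ Real.pi * (2 * r) ^ 2 := by
    refine (measureReal_mono inter_subset_right measure_closedBall_lt_top.ne).trans (le_of_eq ?_)
    rw [measureReal_def, EuclideanSpace.volume_closedBall_fin_two]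
    simp [hr.le, mul_comm, Real.pi_pos.le]
  have e : 2 * r - r = r := by ring
  rw [e]
  calc 4 * stBound / r * volume.real (F ∩ Metric.closedBall x (2 * r)) ≤
      4 * stBound / r * (Real.pi * (2 * r) ^ 2) := by gcongr
    _ = _ := by field_simp; ring

end GGPair

/-- The closed half-plane through `x` with outer normal `n`. -/
def halfPlane (x n : E2) : Set E2 := {y | ⟪y - x, n⟫ ≤ 0}

lemma measurableSet_halfPlane (x n : E2) : MeasurableSet (halfPlane x n) :=
  (isClosed_le (by fun_prop) continuous_const).measurableSet

lemma volume_eq_scale (S : Set E2) (x : E2) {r : ℝ} (hr : 0 < r) :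
    volume S = ENNReal.ofReal (r ^ 2) * volume {y : E2 | x + r • y ∈ S} := by
  have h1 : {y : E2 | x + r • y ∈ S} = (r • ·) ⁻¹' ((x + ·) ⁻¹' S) := rfl
  rw [h1, Measure.addHaar_preimage_smul _ hr.ne', measure_preimage_add, ← mul_assoc,
    ← ENNReal.ofReal_mul (by positivity)]
  have : r ^ 2 * |(r ^ Module.finrank ℝ E2)⁻¹| = 1 := by
    have : Module.finrank ℝ E2 = 2 := by simp [E2]
    rw [this, abs_of_pos (by positivity)]
    field_simp
  rw [this]; simp

lemma volume_blowup_scale (E : Set E2) (x n : E2) {r : ℝ} (hr : 0 < r) :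
    volume ((E ∆ halfPlane x n) ∩ Metric.ball x r) = ENNReal.ofReal (r ^ 2) *
      volume (({y : E2 | x + r • y ∈ E} ∆ {y : E2 | ⟪y, n⟫ ≤ 0}) ∩ Metric.ball (0:E2) 1) := by
  rw [volume_eq_scale _ x hr]
  congr 2
  ext y
  have h1 : x + r • y ∈ halfPlane x n ↔ ⟪y, n⟫ ≤ 0 := by
    rw [halfPlane, mem_ofPred_eq, add_sub_cancel_left, real_inner_smul_left]
    exact ⟨fun h => by by_contra h'; nlinarith [mul_pos hr (not_le.mp h')],
      fun h => mul_nonpos_of_nonneg_of_nonpos hr.le h⟩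
  have h2 : x + r • y ∈ Metric.ball x r ↔ y ∈ Metric.ball (0 : E2) 1 := by
    rw [Metric.mem_ball, dist_eq_norm, add_sub_cancel_left, norm_smul, mem_ball_zero_iff,
      Real.norm_of_nonneg hr.le]
    exact ⟨fun h => by by_contra h'; nlinarith [not_lt.mp h'], fun h => by nlinarith⟩
  simp only [mem_ofPred_eq, mem_inter_iff, h2, mem_symmDiff, h1]

lemma isOuterNormalAt_iff {E : Set E2} {x n : E2} :
    IsOuterNormalAt E x n ↔ ‖n‖ = 1 ∧ ∀ ε > 0, ∀ᶠ r in 𝓝[>] (0 : ℝ),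
      volume ((E ∆ halfPlane x n) ∩ Metric.ball x r) ≤ ENNReal.ofReal (ε * r ^ 2) := by
  refine and_congr_right fun _ => ?_
  rw [ENNReal.tendsto_nhds_zero]
  constructor
  · intro h ε hε
    filter_upwards [h _ (ENNReal.ofReal_pos.mpr hε), self_mem_nhdsWithin] with r h1 hr
    rw [volume_blowup_scale E x n hr, mul_comm ε, ENNReal.ofReal_mul (by positivity)]
    gcongr
  · intro h ε hε
    obtain ⟨ε', h1, h2⟩ : ∃ ε' : ℝ, 0 < ε' ∧ ENNReal.ofReal ε' ≤ ε := by
      rcases eq_or_ne ε ⊤ with rfl | ht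
      · exact ⟨1, one_pos, le_top⟩
      · exact ⟨ε.toReal, ENNReal.toReal_pos hε.ne' ht, ENNReal.ofReal_toReal_le⟩
    filter_upwards [h _ h1, self_mem_nhdsWithin] with r h3 hr
    rw [volume_blowup_scale E x n hr, mul_comm ε', ENNReal.ofReal_mul (by positivity)] at h3
    refine le_trans ?_ h2
    have hr' : 0 < r := hr
    exact (ENNReal.mul_le_mul_iff_right (ENNReal.ofReal_pos.mpr (by positivity)).ne'
      ENNReal.ofReal_ne_top).mp h3

lemma IsOuterNormalAt.unique {E : Set E2} {x n n' : E2} (h : IsOuterNormalAt E x n)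
    (h' : IsOuterNormalAt E x n') : n = n' := by
  by_contra hne
  have hc : ⟪n, n'⟫ < 1 := (inner_lt_one_iff_real_of_norm_eq_one h.1 h'.1).mpr hne
  let U : Set E2 := {y | ⟪y, n⟫ < 0} ∩ {y | 0 < ⟪y, n'⟫} ∩ Metric.ball 0 1
  have hU : IsOpen U := ((isOpen_lt (by fun_prop) continuous_const).inter
    (isOpen_lt continuous_const (by fun_prop))).inter Metric.isOpen_ball
  have hUne : U.Nonempty := by
    refine ⟨(1 / 4 : ℝ) • (n' - n), ⟨?_, ?_⟩, ?_⟩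
    · rw [mem_ofPred_eq, real_inner_smul_left, inner_sub_left, real_inner_self_eq_norm_sq, h.1,
        real_inner_comm]
      linarith
    · rw [mem_ofPred_eq, real_inner_smul_left, inner_sub_left, real_inner_self_eq_norm_sq, h'.1]
      linarith
    · rw [mem_ball_zero_iff, norm_smul]
      have := norm_sub_le n' n
      rw [h.1, h'.1] at this
      norm_num at this ⊢
      linarith
  have hpos := hU.measure_pos volume hUne
  have h1 := h.2.add h'.2
  rw [add_zero] at h1
  refine absurd (ge_of_tendsto' h1 fun r => ?_) (not_le.mpr hpos)
  refine le_trans (measure_mono ?_) (measure_union_le _ _)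
  intro y hy
  have h2 : ⟪y, n⟫ ≤ 0 := (show ⟪y, n⟫ < 0 from hy.1.1).le
  have h3 : ¬ ⟪y, n'⟫ ≤ 0 := not_le.mpr hy.1.2
  by_cases hE : x + r • y ∈ E
  · exact Or.inr ⟨Or.inl ⟨hE, h3⟩, hy.2⟩
  · exact Or.inl ⟨Or.inr ⟨h2, hE⟩, hy.2⟩

lemma IsOuterNormalAt.genNormal_eq {E : Set E2} {x n : E2} (h : IsOuterNormalAt E x n) :
    genNormal E x = n := by
  have hex : ∃ ν, IsOuterNormalAt E x ν := ⟨n, h⟩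
  rw [genNormal, dif_pos hex]
  exact hex.choose_spec.unique h

lemma isOuterNormalAt_genNormal {E : Set E2} {x : E2} (h : x ∈ redBoundary E) :
    IsOuterNormalAt E x (genNormal E x) := by
  obtain ⟨n, hn⟩ := h
  rwa [hn.genNormal_eq]

lemma exists_volume_slab_le {n : E2} (hn : ‖n‖ = 1) {ε : ℝ} (hε : 0 < ε) :
    ∃ δ > 0, δ ≤ 1 ∧ volume ({y : E2 | |⟪y, n⟫| ≤ δ} ∩ Metric.ball 0 1) ≤ ENNReal.ofReal ε := by
  let S : ℕ → Set E2 := fun k => {y : E2 | |⟪y, n⟫| ≤ 1 / ((k : ℝ) + 1)} ∩ Metric.ball 0 1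
  have hS : ∀ k, MeasurableSet (S k) := fun k =>
    ((isClosed_le (by fun_prop) continuous_const).measurableSet).inter measurableSet_ball
  have hanti : Antitone S := fun i j hij y hy =>
    ⟨(show |⟪y, n⟫| ≤ _ from hy.1).trans (Nat.one_div_le_one_div hij), hy.2⟩
  have hlim := tendsto_measure_iInter_atTop (μ := volume) (fun k => (hS k).nullMeasurableSet) hanti
    ⟨0, ((measure_mono inter_subset_right).trans_lt measure_ball_lt_top).ne⟩
  have hzero : volume (⋂ k, S k) = 0 := by
    let W : Submodule ℝ E2 := LinearMap.ker (innerSL ℝ n : E2 →L[ℝ] ℝ).toLinearMap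
    have hW : W ≠ ⊤ := by
      intro h
      have : n ∈ W := by rw [h]; trivial
      have h2 : ⟪n, n⟫ = 0 := this
      rw [real_inner_self_eq_norm_sq, hn] at h2
      norm_num at h2
    refine measure_mono_null ?_ (Measure.addHaar_submodule volume W hW)
    intro y hy
    show ⟪n, y⟫ = 0
    rw [mem_iInter] at hy
    have : |⟪y, n⟫| ≤ 0 := ge_of_tendsto' tendsto_one_div_add_atTop_nhds_zero_nat fun k => (hy k).1
    rw [real_inner_comm]
    exact abs_eq_zero.mp (le_antisymm this (abs_nonneg _))
  rw [hzero] at hlim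
  obtain ⟨k, hk⟩ := ((ENNReal.tendsto_nhds_zero.mp hlim) _ (ENNReal.ofReal_pos.mpr hε)).exists
  refine ⟨1 / ((k : ℝ) + 1), by positivity, ?_, hk⟩
  rw [div_le_one (by positivity)]
  have : (0 : ℝ) ≤ k := by positivity
  linarith

namespace GGPair

variable {F Ω : Set E2} {μ : Measure E2} {ν : E2 → E2}

lemma volume_upper_le (h : GGPair F μ ν Ω) {x : E2} (hx : x ∈ Ω) (hL : IsLebesguePt μ ν x)
    {δ ε : ℝ} (hδ : 0 < δ) (hδ1 : δ ≤ 1) (hε : 0 < ε) :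
    ∀ᶠ r in 𝓝[>] (0 : ℝ), volume (F ∩ Metric.ball x r ∩ {y | δ * r < ⟪y - x, ν x⟫}) ≤
      ENNReal.ofReal (ε * r ^ 2) := by
  have hfin := h.fin
  obtain ⟨c, hc, hdens⟩ := h.compl.exists_density_le hx hL.compl
  obtain ⟨C, hC, hlin⟩ := h.exists_mass_le_linear hx hL
  obtain ⟨r₁, hr₁, hdens⟩ := exists_forall_of_eventually_nhdsGT hdens
  obtain ⟨r₂, hr₂, hlin⟩ := exists_forall_of_eventually_nhdsGT hlin
  let ε' := ε * (c * δ ^ 2 / 4) / (24 * Real.pi * C)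
  have hε' : 0 < ε' := by positivity
  obtain ⟨r₃, hr₃, hexc⟩ := exists_forall_of_eventually_nhdsGT (hL.excess ε' hε')
  obtain ⟨r₄, hr₄, hball⟩ := Metric.nhds_basis_closedBall.mem_iff.mp (h.isOpen.mem_nhds hx)
  refine eventually_nhdsGT_of_forall (r₀ := min (min r₁ r₂) (min r₃ r₄) / 3) (by positivity)
    fun r hr hr0 => ?_
  have hr1 : 3 * r < r₁ := by
    have := (min_le_left _ _ : min (min r₁ r₂) (min r₃ r₄) ≤ _).trans (min_le_left _ _); linarith
  have hr2 : 3 * r < r₂ := by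
    have := (min_le_left _ _ : min (min r₁ r₂) (min r₃ r₄) ≤ _).trans (min_le_right _ _); linarith
  have hr3 : 3 * r < r₃ := by
    have := (min_le_right _ _ : min (min r₁ r₂) (min r₃ r₄) ≤ _).trans (min_le_left _ _); linarith
  have hr4 : 3 * r < r₄ := by
    have := (min_le_right _ _ : min (min r₁ r₂) (min r₃ r₄) ≤ _).trans (min_le_right _ _); linarith
  set n := ν x with hn
  set A : Set E2 := Fᶜ ∩ Metric.ball x (δ * r / 2) with hA
  set A' : Set E2 := F ∩ Metric.ball x r ∩ {y | δ * r < ⟪y - x, n⟫} with hA'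
  have hAm : MeasurableSet A := h.meas.compl.inter measurableSet_ball
  have hA'm : MeasurableSet A' := (h.meas.inter measurableSet_ball).inter
    (isOpen_lt continuous_const (by fun_prop)).measurableSet
  have hAr : A ⊆ Metric.ball x r :=
    inter_subset_right.trans (Metric.ball_subset_ball (by nlinarith))
  set M := 6 * C * ε' * r ^ 2 with hM
  have hpt : ∀ z, volume (A ∩ {a | a + z ∈ A'}) ≤
      (Metric.closedBall (0 : E2) (2 * r)).indicator (fun _ => ENNReal.ofReal M) z := by
    intro z
    rcases eq_empty_or_nonempty (A ∩ {a | a + z ∈ A'}) with he | ⟨a, ha, haz⟩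
    · rw [he]; simp
    have h1 : dist a x < δ * r / 2 := ha.2
    have h1' : dist a x < r := hAr ha
    have h2 : dist (a + z) x < r := haz.1.2
    have hz : ‖z‖ ≤ 2 * r := by
      have : ‖z‖ = dist (a + z) a := by rw [dist_eq_norm]; simp
      rw [this]
      have := dist_triangle_right (a + z) a x
      linarith
    have hzn : 0 ≤ ⟪z, n⟫ := by
      have h3 : δ * r < ⟪a + z - x, n⟫ := haz.2
      have h4 := real_inner_le_norm (a - x) n
      rw [hn, h.nu_norm, mul_one, ← hn, ← dist_eq_norm] at h4
      have : a + z - x = (a - x) + z := by abel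
      rw [this, inner_add_left] at h3
      nlinarith
    rw [indicator_of_mem (by simpa using hz)]
    have hsub : Metric.closedBall x (r + ‖z‖) ⊆ Metric.closedBall x (3 * r) :=
      Metric.closedBall_subset_closedBall (by linarith)
    have h5 := h.translate_le_excess (z := z) (n := n) hAm hAr inter_subset_left
      (hsub.trans ((Metric.closedBall_subset_closedBall hr4.le).trans hball)) hzn
    refine (measure_mono ?_).trans (h5.trans (ENNReal.ofReal_le_ofReal ?_))
    · exact fun b hb => ⟨hb.1, hb.2.1.1⟩
    · have h6 : ∫ y in Metric.closedBall x (r + ‖z‖), ‖ν y - n‖ ∂μ ≤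
          ∫ y in Metric.closedBall x (3 * r), ‖ν y - n‖ ∂μ :=
        setIntegral_mono_set (h.integrable_norm_sub n).integrableOn
          (Eventually.of_forall fun y => norm_nonneg _) hsub.eventuallyLE
      have h7 := hexc (3 * r) (by positivity) hr3
      have h8 := hlin (3 * r) (by positivity) hr2
      calc ‖z‖ * ∫ y in Metric.closedBall x (r + ‖z‖), ‖ν y - n‖ ∂μ
          ≤ (2 * r) * (ε' * (C * (3 * r))) := by
            refine mul_le_mul hz (h6.trans (h7.trans ?_))
              (integral_nonneg fun y => norm_nonneg _) (by positivity)
            gcongr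
        _ = M := by rw [hM]; ring
  have hprod : volume A * volume A' ≤ ENNReal.ofReal (M * (Real.pi * (2 * r) ^ 2)) := by
    rw [← lintegral_measure_inter_translate hAm hA'm]
    refine (lintegral_mono hpt).trans (le_of_eq ?_)
    rw [lintegral_indicator measurableSet_closedBall, setLIntegral_const,
      EuclideanSpace.volume_closedBall_fin_two,
      ENNReal.ofReal_mul (p := M) (q := Real.pi * (2 * r) ^ 2) (by positivity),
      ENNReal.ofReal_mul Real.pi_pos.le, ENNReal.ofReal_pow (by positivity)]
    ring
  have hAlow : ENNReal.ofReal (c * (δ * r / 2) ^ 2) ≤ volume A := by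
    refine ENNReal.ofReal_le_of_le_toReal ?_
    exact hdens (δ * r / 2) (by positivity) (by nlinarith)
  have hpos : 0 < c * (δ * r / 2) ^ 2 := by positivity
  have := (mul_le_mul_left hAlow _).trans hprod
  have e : M * (Real.pi * (2 * r) ^ 2) = c * (δ * r / 2) ^ 2 * (ε * r ^ 2) := by
    rw [hM]; simp only [ε']; field_simp; ring
  rw [e, ENNReal.ofReal_mul hpos.le] at this
  exact (ENNReal.mul_le_mul_iff_right (ENNReal.ofReal_pos.mpr hpos).ne'
    ENNReal.ofReal_ne_top).mp this

theorem isOuterNormalAt (h : GGPair F μ ν Ω) {x : E2} (hx : x ∈ Ω) (hL : IsLebesguePt μ ν x) :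
    IsOuterNormalAt F x (ν x) := by
  refine isOuterNormalAt_iff.mpr ⟨h.nu_norm x, fun ε hε => ?_⟩
  obtain ⟨δ, hδ, hδ1, hslab⟩ := exists_volume_slab_le (h.nu_norm x) (ε := ε / 3) (by positivity)
  have hε3 : 0 < ε / 3 := by positivity
  filter_upwards [h.volume_upper_le hx hL hδ hδ1 hε3,
    h.compl.volume_upper_le hx hL.compl hδ hδ1 hε3, self_mem_nhdsWithin] with r h1 h2 hr
  have hr' : 0 < r := hr
  set n := ν x
  let S : Set E2 := {y | |⟪y - x, n⟫| ≤ δ * r} ∩ Metric.ball x r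
  have hS : volume S ≤ ENNReal.ofReal (ε / 3 * r ^ 2) := by
    rw [volume_eq_scale S x hr', mul_comm (ε / 3), ENNReal.ofReal_mul (by positivity)]
    refine mul_le_mul_right (le_trans (measure_mono ?_) hslab) _
    intro y hy
    have h3 : |⟪x + r • y - x, n⟫| ≤ δ * r := hy.1
    have h4 : dist (x + r • y) x < r := hy.2
    rw [add_sub_cancel_left, real_inner_smul_left, abs_mul, abs_of_pos hr'] at h3
    rw [dist_eq_norm, add_sub_cancel_left, norm_smul, Real.norm_of_nonneg hr'.le] at h4
    refine ⟨?_, ?_⟩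
    · show |⟪y, n⟫| ≤ δ
      by_contra h'; nlinarith [not_le.mp h']
    · rw [mem_ball_zero_iff]
      by_contra h'; nlinarith [not_lt.mp h']
  have hsub : (F ∆ halfPlane x n) ∩ Metric.ball x r ⊆
      ((F ∩ Metric.ball x r ∩ {y | δ * r < ⟪y - x, n⟫}) ∪
        (Fᶜ ∩ Metric.ball x r ∩ {y | δ * r < ⟪y - x, -n⟫})) ∪ S := by
    rintro y ⟨hy, hyr⟩
    by_cases hs : |⟪y - x, n⟫| ≤ δ * r
    · exact Or.inr ⟨hs, hyr⟩
    left
    rw [not_le, lt_abs] at hs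
    have hδr : 0 < δ * r := by positivity
    rcases hy with ⟨hF, hH⟩ | ⟨hH, hF⟩
    · left
      refine ⟨⟨hF, hyr⟩, ?_⟩
      have : ¬ ⟪y - x, n⟫ ≤ 0 := hH
      rcases hs with hs | hs
      · exact hs
      · linarith
    · right
      refine ⟨⟨hF, hyr⟩, ?_⟩
      have : ⟪y - x, n⟫ ≤ 0 := hH
      rcases hs with hs | hs
      · linarith
      · show δ * r < ⟪y - x, -n⟫
        rwa [inner_neg_right]
  calc volume ((F ∆ halfPlane x n) ∩ Metric.ball x r)
      ≤ ENNReal.ofReal (ε / 3 * r ^ 2) + ENNReal.ofReal (ε / 3 * r ^ 2) +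
          ENNReal.ofReal (ε / 3 * r ^ 2) :=
        (measure_mono hsub).trans ((measure_union_le _ _).trans
          (add_le_add ((measure_union_le _ _).trans (add_le_add h1 h2)) hS))
    _ = ENNReal.ofReal (ε * r ^ 2) := by
        rw [← ENNReal.ofReal_add (by positivity) (by positivity),
          ← ENNReal.ofReal_add (by positivity) (by positivity)]
        congr 1; ring

end GGPair

lemma exists_orthonormalBasis_snd {n : E2} (hn : ‖n‖ = 1) :
    ∃ b : OrthonormalBasis (Fin 2) ℝ E2, b 1 = n := by
  have hcard : Module.finrank ℝ E2 = Fintype.card (Fin 2) := by simp [E2]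
  obtain ⟨b, hb⟩ := Orthonormal.exists_orthonormalBasis_extension_of_card_eq (𝕜 := ℝ) hcard
    (v := fun _ => n) (s := {1}) ⟨fun _ => hn, fun i j hij => absurd (Subsingleton.elim i j) hij⟩
  exact ⟨b, hb 1 rfl⟩

/-- The cartesian coordinates of a point of the plane. -/
def planeCoord : E2 ≃ᵐ ℝ × ℝ :=
  (MeasurableEquiv.toLp 2 (Fin 2 → ℝ)).symm.trans MeasurableEquiv.finTwoArrow

lemma planeCoord_apply (y : E2) : planeCoord y = (y 0, y 1) := rfl

lemma measurePreserving_planeCoord : MeasurePreserving planeCoord :=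
  (EuclideanSpace.volume_preserving_symm_measurableEquiv_toLp (Fin 2)).trans
    (volume_preserving_finTwoArrow ℝ)

/-- The coordinates centred at `x` with respect to an orthonormal basis. -/
def frameCoord (b : OrthonormalBasis (Fin 2) ℝ E2) (x : E2) : E2 ≃ᵐ ℝ × ℝ :=
  (MeasurableEquiv.subRight x).trans (b.measurableEquiv.trans planeCoord)

lemma frameCoord_apply (b : OrthonormalBasis (Fin 2) ℝ E2) (x y : E2) :
    frameCoord b x y = (⟪y - x, b 0⟫, ⟪y - x, b 1⟫) := by
  have : frameCoord b x y = (b.repr (y - x) 0, b.repr (y - x) 1) := rfl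
  rw [this, b.repr_apply_apply, b.repr_apply_apply, real_inner_comm, real_inner_comm (b 1)]

lemma measurePreserving_frameCoord (b : OrthonormalBasis (Fin 2) ℝ E2) (x : E2) :
    MeasurePreserving (frameCoord b x) :=
  (measurePreserving_sub_right volume x).trans
    (b.measurePreserving_measurableEquiv.trans measurePreserving_planeCoord)

/-- A smooth plateau function, equal to `1` on `[p, q]` and vanishing outside `[p - m, q + m]`. -/
def plateau (p q m s : ℝ) : ℝ :=
  Real.smoothTransition ((s - p + m) / m) * Real.smoothTransition ((q + m - s) / m)

section plateau

variable {p q m : ℝ}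

lemma plateau_nonneg (s : ℝ) : 0 ≤ plateau p q m s :=
  mul_nonneg (Real.smoothTransition.nonneg _) (Real.smoothTransition.nonneg _)

lemma plateau_le_one (s : ℝ) : plateau p q m s ≤ 1 :=
  mul_le_one₀ (Real.smoothTransition.le_one _) (Real.smoothTransition.nonneg _)
    (Real.smoothTransition.le_one _)

lemma plateau_eq_one (hm : 0 < m) {s : ℝ} (h1 : p ≤ s) (h2 : s ≤ q) : plateau p q m s = 1 := by
  rw [plateau, Real.smoothTransition.one_of_one_le, Real.smoothTransition.one_of_one_le, one_mul]
  · rw [one_le_div hm]; linarith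
  · rw [one_le_div hm]; linarith

lemma plateau_eq_zero (hm : 0 < m) {s : ℝ} (h : s ∉ Icc (p - m) (q + m)) :
    plateau p q m s = 0 := by
  rw [mem_Icc, not_and_or, not_le, not_le] at h
  rcases h with h | h
  · rw [plateau, Real.smoothTransition.zero_of_nonpos, zero_mul]
    exact div_nonpos_of_nonpos_of_nonneg (by linarith) hm.le
  · rw [plateau, Real.smoothTransition.zero_of_nonpos (x := (q + m - s) / m), mul_zero]
    exact div_nonpos_of_nonpos_of_nonneg (by linarith) hm.le

lemma plateau_contDiff : ContDiff ℝ 1 (plateau p q m) := by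
  refine ContDiff.mul (Real.smoothTransition.contDiff.comp ?_)
    (Real.smoothTransition.contDiff.comp ?_)
  · exact ((contDiff_id.sub contDiff_const).add contDiff_const).div_const _
  · exact (contDiff_const.sub contDiff_id).div_const _

lemma plateau_compact (hm : 0 < m) : HasCompactSupport (plateau p q m) :=
  HasCompactSupport.intro isCompact_Icc fun _ hs => plateau_eq_zero hm hs

lemma plateau_hasDerivAt (s : ℝ) : HasDerivAt (plateau p q m) (deriv (plateau p q m) s) s :=
  (plateau_contDiff.differentiable (by norm_num) s).hasDerivAt

lemma abs_deriv_plateau_le (hm : 0 < m) (s : ℝ) :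
    |deriv (plateau p q m) s| ≤ 2 * stBound / m := by
  have hd : ∀ t, HasDerivAt Real.smoothTransition (deriv Real.smoothTransition t) t := fun t =>
    ((Real.smoothTransition.contDiff (n := 1)).differentiable (by norm_num) t).hasDerivAt
  have h1 : HasDerivAt (fun s => (s - p + m) / m) (1 / m) s :=
    (((hasDerivAt_id s).sub_const p).add_const m).div_const m
  have h2 : HasDerivAt (fun s => (q + m - s) / m) (-1 / m) s :=
    ((hasDerivAt_id s).const_sub (q + m)).div_const m
  have h3 := ((hd _).comp s h1).mul ((hd _).comp s h2)
  have h4 : HasDerivAt (plateau p q m) _ s := h3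
  rw [h4.deriv]
  simp only [Function.comp_apply]
  set a := (s - p + m) / m
  set c := (q + m - s) / m
  have ha := abs_deriv_smoothTransition_le a
  have hc := abs_deriv_smoothTransition_le c
  have ha1 : |Real.smoothTransition a| ≤ 1 := by
    rw [abs_of_nonneg (Real.smoothTransition.nonneg _)]; exact Real.smoothTransition.le_one _
  have hc1 : |Real.smoothTransition c| ≤ 1 := by
    rw [abs_of_nonneg (Real.smoothTransition.nonneg _)]; exact Real.smoothTransition.le_one _
  have hst := stBound_pos
  refine (abs_add_le _ _).trans ?_
  rw [abs_mul, abs_mul, abs_mul, abs_mul, abs_div, abs_div, abs_neg, abs_one, abs_of_pos hm]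
  calc |deriv Real.smoothTransition a| * (1 / m) * |Real.smoothTransition c| +
      |Real.smoothTransition a| * (|deriv Real.smoothTransition c| * (1 / m))
      ≤ stBound * (1 / m) * 1 + 1 * (stBound * (1 / m)) := by gcongr
    _ = _ := by ring

lemma integrable_plateau (hm : 0 < m) : Integrable (plateau p q m) :=
  plateau_contDiff.continuous.integrable_of_hasCompactSupport (plateau_compact hm)

lemma integral_plateau_le (hm : 0 < m) (hpq : p ≤ q) :
    ∫ s, plateau p q m s ≤ q - p + 2 * m := by
  have h1 : ∫ s, plateau p q m s ≤ ∫ s, (Icc (p - m) (q + m)).indicator (fun _ => (1 : ℝ)) s := by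
    refine integral_mono (integrable_plateau hm)
      ((integrable_indicator_iff measurableSet_Icc).mpr (integrableOn_const (by simp))) fun s => ?_
    by_cases hs : s ∈ Icc (p - m) (q + m)
    · rw [indicator_of_mem hs]; exact plateau_le_one s
    · rw [indicator_of_notMem hs, plateau_eq_zero hm hs]
  refine h1.trans (le_of_eq ?_)
  rw [integral_indicator measurableSet_Icc]
  simp only [integral_const, smul_eq_mul, mul_one, MeasurableSet.univ, measureReal_restrict_apply,
    univ_inter, Real.volume_real_Icc_of_le (show p - m ≤ q + m by linarith)]
  ring

lemma le_integral_plateau (hm : 0 < m) (hpq : p ≤ q) :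
    q - p ≤ ∫ s, plateau p q m s := by
  have h1 : ∫ s, (Icc p q).indicator (fun _ => (1 : ℝ)) s ≤ ∫ s, plateau p q m s := by
    refine integral_mono ((integrable_indicator_iff measurableSet_Icc).mpr
      (integrableOn_const (by simp))) (integrable_plateau hm) fun s => ?_
    by_cases hs : s ∈ Icc p q
    · rw [indicator_of_mem hs, plateau_eq_one hm hs.1 hs.2]
    · rw [indicator_of_notMem hs]; exact plateau_nonneg s
  refine le_trans (le_of_eq ?_) h1
  rw [integral_indicator measurableSet_Icc]
  simp [Real.volume_real_Icc_of_le hpq]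

end plateau

/-- A rectangular cutoff in an orthonormal frame. -/
def rectCutoff (b : OrthonormalBasis (Fin 2) ℝ E2) (x : E2) (p q w m : ℝ) (y : E2) : ℝ :=
  plateau p q m ⟪y - x, b 0⟫ * plateau (-w) w m ⟪y - x, b 1⟫

section rect

variable {b : OrthonormalBasis (Fin 2) ℝ E2} {x : E2} {p q w m : ℝ}

lemma rectCutoff_nonneg (y : E2) : 0 ≤ rectCutoff b x p q w m y :=
  mul_nonneg (plateau_nonneg _) (plateau_nonneg _)

lemma rectCutoff_le_one (y : E2) : rectCutoff b x p q w m y ≤ 1 :=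
  mul_le_one₀ (plateau_le_one _) (plateau_nonneg _) (plateau_le_one _)

lemma rectCutoff_contDiff : ContDiff ℝ 1 (rectCutoff b x p q w m) := by
  refine ContDiff.mul (plateau_contDiff.comp ?_) (plateau_contDiff.comp ?_) <;>
  exact (contDiff_id.sub contDiff_const).inner ℝ contDiff_const

lemma norm_sub_le_abs_add_abs (b : OrthonormalBasis (Fin 2) ℝ E2) (z : E2) :
    ‖z‖ ≤ |⟪z, b 0⟫| + |⟪z, b 1⟫| := by
  have h := b.sum_repr z
  rw [Fin.sum_univ_two, b.repr_apply_apply, b.repr_apply_apply] at h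
  calc ‖z‖ = ‖⟪b 0, z⟫ • b 0 + ⟪b 1, z⟫ • b 1‖ := by rw [h]
    _ ≤ _ := norm_add_le _ _
    _ = _ := by
      rw [norm_smul, norm_smul, b.norm_eq_one, b.norm_eq_one, mul_one, mul_one,
        Real.norm_eq_abs, Real.norm_eq_abs, real_inner_comm, real_inner_comm (b 1)]

lemma tsupport_rectCutoff {ρ₀ ρ : ℝ} (hm : 0 < m) (hp : -ρ₀ ≤ p) (hq : q ≤ ρ₀)
    (hρ : ρ₀ + w + 2 * m ≤ ρ) : tsupport (rectCutoff b x p q w m) ⊆ Metric.closedBall x ρ := by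
  refine closure_minimal (fun y hy => ?_) Metric.isClosed_closedBall
  have h1 : ⟪y - x, b 0⟫ ∈ Icc (p - m) (q + m) := by
    by_contra h; exact hy (by rw [rectCutoff, plateau_eq_zero hm h, zero_mul])
  have h2 : ⟪y - x, b 1⟫ ∈ Icc (-w - m) (w + m) := by
    by_contra h; exact hy (by rw [rectCutoff, plateau_eq_zero hm h, mul_zero])
  rw [Metric.mem_closedBall, dist_eq_norm]
  refine (norm_sub_le_abs_add_abs b _).trans ?_
  have h3 : |⟪y - x, b 0⟫| ≤ ρ₀ + m := abs_le.mpr ⟨by linarith [h1.1], by linarith [h1.2]⟩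
  have h4 : |⟪y - x, b 1⟫| ≤ w + m := abs_le.mpr ⟨by linarith [h2.1], by linarith [h2.2]⟩
  linarith

lemma fderiv_rectCutoff (y η : E2) :
    fderiv ℝ (rectCutoff b x p q w m) y η =
      deriv (plateau p q m) ⟪y - x, b 0⟫ * plateau (-w) w m ⟪y - x, b 1⟫ * ⟪η, b 0⟫ +
      plateau p q m ⟪y - x, b 0⟫ * deriv (plateau (-w) w m) ⟪y - x, b 1⟫ * ⟪η, b 1⟫ := by
  have h0 : ∀ i, HasFDerivAt (fun y : E2 => ⟪y - x, b i⟫) (innerSL ℝ (b i)) y := fun i => by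
    have h : HasFDerivAt (fun y : E2 => innerSL ℝ (b i) (y - x)) (innerSL ℝ (b i)) y :=
      (innerSL ℝ (b i)).hasFDerivAt.comp y ((hasFDerivAt_id y).sub_const x)
    refine h.congr_of_eventuallyEq (Eventually.of_forall fun z => ?_)
    simp [real_inner_comm]
  have h1 := ((plateau_hasDerivAt (p := p) (q := q) (m := m) _).comp_hasFDerivAt y (h0 0)).mul
    ((plateau_hasDerivAt (p := -w) (q := w) (m := m) _).comp_hasFDerivAt y (h0 1))
  have h2 : HasFDerivAt (rectCutoff b x p q w m) _ y := h1
  rw [h2.fderiv]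
  simp only [Function.comp_apply, add_apply, smul_apply,
    innerSL_apply_apply, smul_eq_mul, real_inner_comm η]
  ring

lemma abs_fderiv_rectCutoff_le (hm : 0 < m) (y η : E2) :
    |fderiv ℝ (rectCutoff b x p q w m) y η| ≤ 4 * stBound / m * ‖η‖ := by
  rw [fderiv_rectCutoff]
  have h1 := abs_deriv_plateau_le (p := p) (q := q) hm ⟪y - x, b 0⟫
  have h2 := abs_deriv_plateau_le (p := -w) (q := w) hm ⟪y - x, b 1⟫
  have h3 : |plateau (-w) w m ⟪y - x, b 1⟫| ≤ 1 := by
    rw [abs_of_nonneg (plateau_nonneg _)]; exact plateau_le_one _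
  have h4 : |plateau p q m ⟪y - x, b 0⟫| ≤ 1 := by
    rw [abs_of_nonneg (plateau_nonneg _)]; exact plateau_le_one _
  have h5 : ∀ i, |⟪η, b i⟫| ≤ ‖η‖ := fun i => by
    have := abs_real_inner_le_norm η (b i)
    rwa [b.norm_eq_one, mul_one] at this
  have hst := stBound_pos
  refine (abs_add_le _ _).trans ?_
  rw [abs_mul, abs_mul, abs_mul, abs_mul]
  calc _ ≤ 2 * stBound / m * 1 * ‖η‖ + 1 * (2 * stBound / m) * ‖η‖ := by
        gcongr
        · exact h5 0
        · exact h5 1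
    _ = _ := by ring

lemma integral_halfPlane_fderiv_rectCutoff (hm : 0 < m) (hw : 0 < w) (η : E2) :
    ∫ y in halfPlane x (b 1), fderiv ℝ (rectCutoff b x p q w m) y η =
      ⟪η, b 1⟫ * ∫ s, plateau p q m s := by
  let k₁ := plateau p q m
  let k₂ := plateau (-w) w m
  have hc1 : HasCompactSupport k₁ := plateau_compact hm
  have hc2 : HasCompactSupport k₂ := plateau_compact hm
  have hd1 : ContDiff ℝ 1 k₁ := plateau_contDiff
  have hd2 : ContDiff ℝ 1 k₂ := plateau_contDiff
  let G : ℝ × ℝ → ℝ := fun z => deriv k₁ z.1 * k₂ z.2 * ⟪η, b 0⟫ + k₁ z.1 * deriv k₂ z.2 * ⟪η, b 1⟫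
  have hG : ∀ y, fderiv ℝ (rectCutoff b x p q w m) y η = G (frameCoord b x y) := fun y => by
    rw [fderiv_rectCutoff, frameCoord_apply]
  have hpre : halfPlane x (b 1) = frameCoord b x ⁻¹' (univ ×ˢ Iic 0) := by
    ext y; simp [halfPlane, frameCoord_apply]
  simp only [hG]
  rw [hpre, (measurePreserving_frameCoord b x).setIntegral_preimage_emb
    (frameCoord b x).measurableEmbedding]
  have hi1 : Integrable (deriv k₁) := (hd1.continuous_deriv le_rfl).integrable_of_hasCompactSupport
    hc1.deriv
  have hi2 : Integrable (deriv k₂) := (hd2.continuous_deriv le_rfl).integrable_of_hasCompactSupport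
    hc2.deriv
  have hI1 : Integrable k₁ := integrable_plateau hm
  have hI2 : Integrable k₂ := integrable_plateau hm
  have z1 : ∫ s, deriv k₁ s = 0 :=
    integral_eq_zero_of_hasDerivAt_of_integrable (f := k₁) (fun s => plateau_hasDerivAt s) hi1 hI1
  have z2 : ∫ t in Iic 0, deriv k₂ t = 1 := by
    rw [hc2.integral_Iic_deriv_eq hd2]
    exact plateau_eq_one hm (by linarith) hw.le
  show ∫ z in univ ×ˢ Iic 0, G z ∂(volume.prod volume) = _
  rw [integral_add, integral_mul_const, integral_mul_const,
    setIntegral_prod_mul (deriv k₁) k₂ univ (Iic 0), setIntegral_prod_mul k₁ (deriv k₂) univ (Iic 0),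
    setIntegral_univ, setIntegral_univ, z1, z2]
  · ring
  · exact ((hi1.mul_prod hI2).mul_const _).integrableOn
  · exact ((hI1.mul_prod hi2).mul_const _).integrableOn

end rect

lemma abs_setIntegral_sub_le {F H B : Set E2} (hF : MeasurableSet F) (hH : MeasurableSet H)
    (hB : MeasurableSet B) {g : E2 → ℝ} (hg : Integrable g) {M : ℝ}
    (hM : ∀ y, |g y| ≤ M) (hB0 : ∀ y ∉ B, g y = 0) (hfin : volume B ≠ ⊤) :
    |(∫ y in F, g y) - ∫ y in H, g y| ≤ M * volume.real ((F ∆ H) ∩ B) := by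
  have hm : MeasurableSet ((F ∆ H) ∩ B) := (hF.symmDiff hH).inter hB
  rw [← integral_indicator hF, ← integral_indicator hH,
    ← integral_sub (hg.indicator hF) (hg.indicator hH)]
  have hi : Integrable (((F ∆ H) ∩ B).indicator fun _ => M) :=
    (integrable_indicator_iff hm).mpr (integrableOn_const
      ((measure_mono inter_subset_right).trans_lt hfin.lt_top).ne)
  calc |∫ y, F.indicator g y - H.indicator g y|
      ≤ ∫ y, ((F ∆ H) ∩ B).indicator (fun _ => M) y := by
        rw [← Real.norm_eq_abs]
        refine norm_integral_le_of_norm_le hi (Eventually.of_forall fun y => ?_)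
        rw [Real.norm_eq_abs]
        have hM0 : 0 ≤ M := (abs_nonneg _).trans (hM y)
        by_cases hyB : y ∈ B
        · by_cases h1 : y ∈ F <;> by_cases h2 : y ∈ H <;>
            simp [h1, h2, hyB, indicator, mem_symmDiff, hM y]
        · simp [indicator, hB0 y hyB, hyB]
    _ = _ := by
        rw [integral_indicator hm, integral_const]
        simp [mul_comm]

namespace GGPair

variable {F Ω : Set E2} {μ : Measure E2} {ν : E2 → E2}

lemma abs_integral_rectCutoff_sub_le (h : GGPair F μ ν Ω) {b : OrthonormalBasis (Fin 2) ℝ E2}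
    {x : E2} {p q w m ρ₀ ρ R : ℝ} (hm : 0 < m) (hw : 0 < w) (hp : -ρ₀ ≤ p) (hq : q ≤ ρ₀)
    (hρ : ρ₀ + w + 2 * m ≤ ρ) (hρR : ρ < R) (hΩ : Metric.closedBall x ρ ⊆ Ω) (η : E2) :
    |(∫ y, rectCutoff b x p q w m y * ⟪η, ν y⟫ ∂μ) - ⟪η, b 1⟫ * ∫ s, plateau p q m s| ≤
      4 * stBound / m * ‖η‖ * volume.real ((F ∆ halfPlane x (b 1)) ∩ Metric.ball x R) := by
  have hsupp := tsupport_rectCutoff (b := b) (x := x) hm hp hq hρ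
  have hT : TestFun Ω (rectCutoff b x p q w m) := ⟨rectCutoff_contDiff,
    (isCompact_closedBall x ρ).of_isClosed_subset (isClosed_tsupport _) hsupp, hsupp.trans hΩ⟩
  rw [← h.gg _ hT, ← integral_halfPlane_fderiv_rectCutoff (x := x) hm hw η]
  refine abs_setIntegral_sub_le h.meas (measurableSet_halfPlane _ _) measurableSet_ball
    (hT.integrable_fderiv η) (fun y => abs_fderiv_rectCutoff_le hm y η) (fun y hy => ?_)
    measure_ball_lt_top.ne
  have : y ∉ tsupport (rectCutoff b x p q w m) := fun h' =>
    hy (Metric.closedBall_subset_ball hρR (hsupp h'))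
  rw [fderiv_of_notMem_tsupport (𝕜 := ℝ) this]; simp

end GGPair

lemma rectCutoff_eq_one {b : OrthonormalBasis (Fin 2) ℝ E2} {x y : E2} {p q w m : ℝ} (hm : 0 < m)
    (h1 : p ≤ ⟪y - x, b 0⟫) (h2 : ⟪y - x, b 0⟫ ≤ q) (h3 : |⟪y - x, b 1⟫| ≤ w) :
    rectCutoff b x p q w m y = 1 := by
  rw [rectCutoff, plateau_eq_one hm h1 h2, plateau_eq_one hm (abs_le.mp h3).1 (abs_le.mp h3).2,
    one_mul]

lemma testFun_rectCutoff {b : OrthonormalBasis (Fin 2) ℝ E2} {x : E2} {p q w m ρ₀ ρ : ℝ}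
    {Ω : Set E2} (hm : 0 < m) (hp : -ρ₀ ≤ p) (hq : q ≤ ρ₀)
    (hρ : ρ₀ + w + 2 * m ≤ ρ) (hΩ : Metric.closedBall x ρ ⊆ Ω) :
    TestFun Ω (rectCutoff b x p q w m) :=
  have hsupp := tsupport_rectCutoff (b := b) (x := x) hm hp hq hρ
  ⟨rectCutoff_contDiff,
    (isCompact_closedBall x ρ).of_isClosed_subset (isClosed_tsupport _) hsupp, hsupp.trans hΩ⟩

/-- At a unit-norm direction `n`, `‖ν‖` is estimated by the component of `ν` along `n`. -/
lemma one_sub_inner_le {n v : E2} (hn : ‖n‖ = 1) : 1 - ⟪n, v⟫ ≤ ‖v - n‖ := by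
  have h1 : 1 - ⟪n, v⟫ = ⟪n, n - v⟫ := by
    rw [inner_sub_right, real_inner_self_eq_norm_sq, hn]; norm_num
  rw [h1, norm_sub_rev]
  exact (real_inner_le_norm _ _).trans (by rw [hn, one_mul])

namespace GGPair

variable {F Ω : Set E2} {μ : Measure E2} {ν : E2 → E2}

lemma exists_upper_density (h : GGPair F μ ν Ω) {x : E2} (hx : x ∈ Ω)
    (hL : IsLebesguePt μ ν x) {ε : ℝ} (hε : 0 < ε) :
    ∃ d₀ > 0, ∀ d, 0 < d → d < d₀ → ∀ C : Set E2, x ∈ C → (∀ y ∈ C, ∀ z ∈ C, dist y z ≤ d) →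
      μ C ≤ ENNReal.ofReal ((1 + ε) * d) := by
  have := h.fin
  have hst := stBound_pos
  have hn : ‖ν x‖ = 1 := h.nu_norm x
  obtain ⟨b, hb⟩ := exists_orthonormalBasis_snd hn
  obtain ⟨C₀, hC₀, hlin⟩ := h.exists_mass_le_linear hx hL
  obtain ⟨r₁, hr₁, hlin⟩ := exists_forall_of_eventually_nhdsGT hlin
  obtain ⟨r₂, hr₂, hexc⟩ := exists_forall_of_eventually_nhdsGT
    (hL.excess (ε / (9 * C₀)) (by positivity))
  set θ := min (1 / 2) (ε / 6) with hθ
  have hθ0 : 0 < θ := by positivity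
  have hθ1 : θ ≤ 1 / 2 := min_le_left _ _
  have hθ2 : θ ≤ ε / 6 := min_le_right _ _
  obtain ⟨r₃, hr₃, hflat⟩ := exists_forall_of_eventually_nhdsGT
    ((isOuterNormalAt_iff.mp (h.isOuterNormalAt hx hL)).2 (ε * θ / (192 * stBound))
      (by positivity))
  obtain ⟨r₄, hr₄, hball⟩ := Metric.nhds_basis_closedBall.mem_iff.mp (h.isOpen.mem_nhds hx)
  refine ⟨min (min r₁ r₂) (min r₃ r₄) / 4, by positivity, fun d hd hd0 C hxC hC => ?_⟩
  have hd1 : 4 * d < r₁ := by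
    have : min (min r₁ r₂) (min r₃ r₄) ≤ r₁ := (min_le_left _ _).trans (min_le_left _ _)
    linarith
  have hd2 : 4 * d < r₂ := by
    have : min (min r₁ r₂) (min r₃ r₄) ≤ r₂ := (min_le_left _ _).trans (min_le_right _ _)
    linarith
  have hd3 : 4 * d < r₃ := by
    have : min (min r₁ r₂) (min r₃ r₄) ≤ r₃ := (min_le_right _ _).trans (min_le_left _ _)
    linarith
  have hd4 : 4 * d < r₄ := by
    have : min (min r₁ r₂) (min r₃ r₄) ≤ r₄ := (min_le_right _ _).trans (min_le_right _ _)
    linarith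
  have hbn : ∀ i, ‖b i‖ = 1 := fun i => b.norm_eq_one i
  have hcoord : ∀ i, ∀ y ∈ C, ∀ z ∈ C, ⟪y - x, b i⟫ - ⟪z - x, b i⟫ ≤ d := fun i y hy z hz => by
    rw [← inner_sub_left, sub_sub_sub_cancel_right]
    refine (real_inner_le_norm _ _).trans ?_
    rw [hbn, mul_one, ← dist_eq_norm]
    exact hC y hy z hz
  set S : Set ℝ := (fun y => ⟪y - x, b 0⟫) '' C
  have hSne : S.Nonempty := ⟨_, x, hxC, rfl⟩
  have hSb : BddBelow S := ⟨-d, by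
    rintro _ ⟨y, hy, rfl⟩
    have := hcoord 0 x hxC y hy
    simp only [sub_self, inner_zero_left] at this
    linarith⟩
  set p := sInf S with hp
  have hp1 : -d ≤ p := le_csInf hSne (by
    rintro _ ⟨y, hy, rfl⟩
    have := hcoord 0 x hxC y hy
    simp only [sub_self, inner_zero_left] at this
    linarith)
  have hp2 : p ≤ 0 := by
    have := csInf_le hSb ⟨x, hxC, rfl⟩
    simpa using this
  have hpC : ∀ y ∈ C, p ≤ ⟪y - x, b 0⟫ := fun y hy => csInf_le hSb ⟨y, hy, rfl⟩
  have hqC : ∀ y ∈ C, ⟪y - x, b 0⟫ ≤ p + d := fun y hy => by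
    have : ⟪y - x, b 0⟫ - d ≤ p := le_csInf hSne (by
      rintro _ ⟨z, hz, rfl⟩
      have := hcoord 0 y hy z hz
      simp only
      linarith)
    linarith
  have hwC : ∀ y ∈ C, |⟪y - x, b 1⟫| ≤ d := fun y hy => by
    have h1 := hcoord 1 y hy x hxC
    have h2 := hcoord 1 x hxC y hy
    simp only [sub_self, inner_zero_left] at h1 h2
    exact abs_le.mpr ⟨by linarith, by linarith⟩
  set m := θ * d with hm
  have hm0 : 0 < m := by positivity
  have hm1 : 2 * m ≤ d := by nlinarith
  set f := rectCutoff b x p (p + d) d m with hf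
  have hΩ3 : Metric.closedBall x (3 * d) ⊆ Ω :=
    (Metric.closedBall_subset_closedBall (by linarith)).trans hball
  have hT : TestFun Ω f := testFun_rectCutoff (ρ₀ := d) (ρ := 3 * d) hm0 hp1 (by linarith)
    (by linarith) hΩ3
  have hmain := h.abs_integral_rectCutoff_sub_le (b := b) (x := x) (p := p) (q := p + d) (w := d)
    (m := m) (ρ₀ := d) (ρ := 3 * d) (R := 4 * d) hm0 hd hp1 (by linarith) (by linarith)
    (by linarith) hΩ3 (ν x)
  rw [hb, real_inner_self_eq_norm_sq, hn, one_pow, one_mul, mul_one] at hmain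
  have hvol : volume.real ((F ∆ halfPlane x (ν x)) ∩ Metric.ball x (4 * d)) ≤
      ε * θ / (192 * stBound) * (4 * d) ^ 2 :=
    ENNReal.toReal_le_of_le_ofReal (by positivity) (hflat (4 * d) (by positivity) hd3)
  have hpl := integral_plateau_le (p := p) (q := p + d) hm0 (by linarith)
  have hnint : Integrable (fun y => ‖ν y - ν x‖) μ := h.integrable_norm_sub (ν x)
  have hA : ∫ y, f y * ⟪ν x, ν y⟫ ∂μ ≤ d + 2 * m + ε / 3 * d := by
    have h1 := (abs_le.mp hmain).2
    have h2 : 4 * stBound / m * volume.real ((F ∆ halfPlane x (ν x)) ∩ Metric.ball x (4 * d)) ≤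
        4 * stBound / m * (ε * θ / (192 * stBound) * (4 * d) ^ 2) := by gcongr
    have h3 : 4 * stBound / m * (ε * θ / (192 * stBound) * (4 * d) ^ 2) = ε / 3 * d := by
      rw [hm]; field_simp; ring
    rw [h3] at h2
    linarith
  have hB : ∫ y in Metric.closedBall x (3 * d), ‖ν y - ν x‖ ∂μ ≤ ε / 3 * d := by
    refine (hexc (3 * d) (by positivity) (by linarith)).trans ?_
    calc ε / (9 * C₀) * μ.real (Metric.closedBall x (3 * d))
        ≤ ε / (9 * C₀) * (C₀ * (3 * d)) := by
          gcongr; exact hlin (3 * d) (by positivity) (by linarith)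
      _ = ε / 3 * d := by field_simp; ring
  have hC' : ∫ y, f y ∂μ ≤ ∫ y, f y * ⟪ν x, ν y⟫ ∂μ +
      ∫ y in Metric.closedBall x (3 * d), ‖ν y - ν x‖ ∂μ := by
    rw [← integral_indicator Metric.isClosed_closedBall.measurableSet, ← integral_add
      (h.integrable_mul_inner hT _) (hnint.indicator Metric.isClosed_closedBall.measurableSet)]
    refine integral_mono (hT.integrable μ) ((h.integrable_mul_inner hT _).add
      (hnint.indicator Metric.isClosed_closedBall.measurableSet)) fun y => ?_
    by_cases hy : y ∈ Metric.closedBall x (3 * d)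
    · simp only [indicator_of_mem hy]
      have h1 := one_sub_inner_le (v := ν y) hn
      have h2 : 0 ≤ f y := rectCutoff_nonneg y
      have h3 : f y ≤ 1 := rectCutoff_le_one y
      have h4 : 0 ≤ ‖ν y - ν x‖ := norm_nonneg _
      nlinarith
    · have : f y = 0 := image_eq_zero_of_notMem_tsupport fun h' => hy
        (tsupport_rectCutoff (b := b) (x := x) hm0 hp1 (by linarith) (by linarith) h')
      simp [indicator_of_notMem hy, this]
  set Q : Set E2 := {y | p ≤ ⟪y - x, b 0⟫ ∧ ⟪y - x, b 0⟫ ≤ p + d ∧ |⟪y - x, b 1⟫| ≤ d} with hQ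
  have hQm : MeasurableSet Q := by
    have hc : ∀ i, Continuous fun y : E2 => ⟪y - x, b i⟫ := fun i => by fun_prop
    exact ((isClosed_le continuous_const (hc 0)).inter
      ((isClosed_le (hc 0) continuous_const).inter
      (isClosed_le (hc 1).abs continuous_const))).measurableSet
  have hCQ : C ⊆ Q := fun y hy => ⟨hpC y hy, hqC y hy, hwC y hy⟩
  have hD : μ.real Q ≤ ∫ y, f y ∂μ := by
    have : μ.real Q = ∫ y, Q.indicator (fun _ => (1 : ℝ)) y ∂μ := by
      rw [integral_indicator hQm]; simp
    rw [this]
    refine integral_mono ((integrable_const _).indicator hQm) (hT.integrable μ) fun y => ?_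
    by_cases hy : y ∈ Q
    · rw [indicator_of_mem hy]
      exact (rectCutoff_eq_one hm0 hy.1 hy.2.1 hy.2.2).ge
    · rw [indicator_of_notMem hy]; exact rectCutoff_nonneg y
  refine (measure_mono hCQ).trans ?_
  rw [← ofReal_measureReal]
  refine ENNReal.ofReal_le_ofReal ?_
  have : 2 * m ≤ ε / 3 * d := by rw [hm]; nlinarith
  linarith

end GGPair

namespace IsAnisotropy

variable {φ : E2 → ℝ}

lemma map_zero (hφ : IsAnisotropy φ) : φ 0 = 0 := (hφ.eq_zero_iff 0).mpr rfl

lemma exists_bounds (hφ : IsAnisotropy φ) :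
    ∃ c > 0, ∀ x : E2, c * ‖x‖ ≤ φ x ∧ φ x ≤ c⁻¹ * ‖x‖ := by
  obtain ⟨c, hc, h⟩ := hφ.bounds
  refine ⟨c, hc.1, fun x => ?_⟩
  rcases eq_or_ne x 0 with rfl | hx
  · simp [hφ.map_zero]
  have hn : 0 < ‖x‖ := norm_pos_iff.mpr hx
  have h1 := h (‖x‖⁻¹ • x) (by rw [norm_smul, norm_inv, norm_norm, inv_mul_cancel₀ hn.ne'])
  rw [hφ.smul_eq, abs_of_pos (inv_pos.mpr hn), one_div] at h1
  constructor
  · have := mul_le_mul_of_nonneg_right h1.1 hn.le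
    rwa [mul_right_comm, inv_mul_cancel₀ hn.ne', one_mul] at this
  · have := mul_le_mul_of_nonneg_right h1.2 hn.le
    rwa [mul_right_comm, inv_mul_cancel₀ hn.ne', one_mul] at this

lemma continuous (hφ : IsAnisotropy φ) : Continuous φ := by
  obtain ⟨c, hc, h⟩ := hφ.exists_bounds
  have hl : ∀ x y, φ x ≤ φ y + c⁻¹ * dist x y := fun x y => by
    have h1 := hφ.add_le y (x - y)
    rw [add_sub_cancel] at h1
    rw [dist_eq_norm]
    linarith [(h (x - y)).2]
  exact (LipschitzWith.of_le_add_mul' c⁻¹ hl).continuous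

lemma convex_combo (hφ : IsAnisotropy φ) {x y : E2} {s t : ℝ} (hs : 0 ≤ s) (ht : 0 ≤ t)
    (hst : s + t ≤ 1) (hx : φ x ≤ 1) (hy : φ y ≤ 1) : φ (s • x + t • y) ≤ 1 := by
  refine (hφ.add_le _ _).trans ?_
  rw [hφ.smul_eq, hφ.smul_eq, abs_of_nonneg hs, abs_of_nonneg ht]
  nlinarith

lemma bddAbove_dual (hφ : IsAnisotropy φ) (ξ : E2) :
    BddAbove {r : ℝ | ∃ η : E2, φ η = 1 ∧ r = ⟪ξ, η⟫} := by
  obtain ⟨c, hc, h⟩ := hφ.exists_bounds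
  refine ⟨‖ξ‖ * c⁻¹, ?_⟩
  rintro _ ⟨η, hη, rfl⟩
  refine (real_inner_le_norm _ _).trans ?_
  gcongr
  have := (h η).1
  rw [hη] at this
  rw [← one_div, le_div_iff₀ hc]; linarith

lemma exists_eq_one (hφ : IsAnisotropy φ) {η : E2} (hη : η ≠ 0) : φ ((φ η)⁻¹ • η) = 1 := by
  have h1 : φ η ≠ 0 := fun h => hη ((hφ.eq_zero_iff η).mp h)
  rw [hφ.smul_eq, abs_of_nonneg (inv_nonneg.mpr (hφ.nonneg _)), inv_mul_cancel₀ h1]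

lemma nonempty_dual (hφ : IsAnisotropy φ) (ξ : E2) :
    {r : ℝ | ∃ η : E2, φ η = 1 ∧ r = ⟪ξ, η⟫}.Nonempty := by
  obtain ⟨η, hη⟩ := exists_ne (0 : E2)
  exact ⟨_, _, hφ.exists_eq_one hη, rfl⟩

lemma inner_le_dualA_of_eq (hφ : IsAnisotropy φ) (ξ : E2) {η : E2} (hη : φ η = 1) :
    ⟪ξ, η⟫ ≤ dualA φ ξ := le_csSup (hφ.bddAbove_dual ξ) ⟨η, hη, rfl⟩

lemma dualA_nonneg (hφ : IsAnisotropy φ) (ξ : E2) : 0 ≤ dualA φ ξ := by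
  obtain ⟨_, η, hη, -⟩ := hφ.nonempty_dual ξ
  have h1 := hφ.inner_le_dualA_of_eq ξ hη
  have h2 := hφ.inner_le_dualA_of_eq ξ (η := -η) (by
    rw [← neg_one_smul ℝ η, hφ.smul_eq]; simp [hη])
  rw [inner_neg_right] at h2
  linarith

lemma inner_le_dualA (hφ : IsAnisotropy φ) (ξ : E2) {η : E2} (hη : φ η ≤ 1) :
    ⟪ξ, η⟫ ≤ dualA φ ξ := by
  rcases eq_or_ne η 0 with rfl | h0
  · simpa using hφ.dualA_nonneg ξ
  have hpos : 0 < φ η := (hφ.nonneg η).lt_of_ne' fun h => h0 ((hφ.eq_zero_iff η).mp h)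
  have h1 := hφ.inner_le_dualA_of_eq ξ (hφ.exists_eq_one h0)
  rw [inner_smul_right, inv_mul_le_iff₀ hpos] at h1
  nlinarith [hφ.dualA_nonneg ξ]

lemma exists_lt_inner (hφ : IsAnisotropy φ) {ξ : E2} {c : ℝ} (hc : c < dualA φ ξ) :
    ∃ η, φ η = 1 ∧ c < ⟪ξ, η⟫ := by
  obtain ⟨_, ⟨η, hη, rfl⟩, h⟩ := exists_lt_of_lt_csSup (hφ.nonempty_dual ξ) hc
  exact ⟨η, hη, h⟩

lemma continuous_dualA (hφ : IsAnisotropy φ) : Continuous (dualA φ) := by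
  obtain ⟨c, hc, h⟩ := hφ.exists_bounds
  have hl : ∀ x y, dualA φ x ≤ dualA φ y + c⁻¹ * dist x y := fun x y => by
    refine csSup_le (hφ.nonempty_dual x) ?_
    rintro _ ⟨η, hη, rfl⟩
    have h1 : ⟪x, η⟫ = ⟪y, η⟫ + ⟪x - y, η⟫ := by rw [inner_sub_left]; ring
    have h2 : ‖η‖ ≤ c⁻¹ := by
      have := (h η).1
      rw [hη] at this
      rw [← one_div, le_div_iff₀ hc]; linarith
    have h3 := real_inner_le_norm (x - y) η
    have h4 := hφ.inner_le_dualA_of_eq y hη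
    have h5 : ‖x - y‖ * ‖η‖ ≤ c⁻¹ * dist x y := by
      rw [dist_eq_norm, mul_comm]; gcongr
    linarith
  exact (LipschitzWith.of_le_add_mul' c⁻¹ hl).continuous

lemma exists_dualA_le (hφ : IsAnisotropy φ) : ∃ C ≥ 0, ∀ ξ, dualA φ ξ ≤ C * ‖ξ‖ := by
  obtain ⟨c, hc, h⟩ := hφ.exists_bounds
  refine ⟨c⁻¹, by positivity, fun ξ => csSup_le (hφ.nonempty_dual ξ) ?_⟩
  rintro _ ⟨η, hη, rfl⟩
  refine (real_inner_le_norm _ _).trans ?_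
  rw [mul_comm]
  gcongr
  have := (h η).1
  rw [hη] at this
  rw [← one_div, le_div_iff₀ hc]; linarith

end IsAnisotropy

/-- An outer measure bounded by the diameter on small sets meeting `A` is bounded on `A` by the
one-dimensional Hausdorff measure. -/
lemma measure_le_mul_hausdorffMeasure {μ : Measure E2} {A : Set E2} {K : ℝ} {d₀ : ℝ}
    (hK : 0 < K) (hd₀ : 0 < d₀) (h : ∀ x ∈ A, ∀ d, 0 < d → d < d₀ → ∀ C : Set E2, x ∈ C →
      (∀ y ∈ C, ∀ z ∈ C, dist y z ≤ d) → μ C ≤ ENNReal.ofReal (K * d)) :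
    μ A ≤ ENNReal.ofReal K * μH[1] A := by
  have key : ∀ C : Set E2, (A ∩ C).Nonempty → Metric.ediam C ≤ ENNReal.ofReal (d₀ / 2) →
      μ C ≤ ENNReal.ofReal K * Metric.ediam C := by
    rintro C ⟨x, hxA, hxC⟩ hC
    have hfin : Metric.ediam C ≠ ⊤ := (hC.trans_lt ENNReal.ofReal_lt_top).ne
    set D := (Metric.ediam C).toReal with hD
    have hD2 : D ≤ d₀ / 2 := ENNReal.toReal_le_of_le_ofReal (by positivity) hC
    have hD0 : 0 ≤ D := ENNReal.toReal_nonneg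
    have hdist : ∀ y ∈ C, ∀ z ∈ C, dist y z ≤ D := fun y hy z hz => by
      rw [dist_edist]
      exact ENNReal.toReal_mono hfin (Metric.edist_le_ediam_of_mem hy hz)
    have hlim : Tendsto (fun d => ENNReal.ofReal (K * d)) (𝓝[>] D) (𝓝 (ENNReal.ofReal (K * D))) :=
      (ENNReal.continuous_ofReal.comp (continuous_const.mul continuous_id)).continuousWithinAt
    have h1 : μ C ≤ ENNReal.ofReal (K * D) := by
      refine ge_of_tendsto hlim ?_
      filter_upwards [Ioo_mem_nhdsGT (show D < d₀ by linarith)] with d hd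
      exact h x hxA d (hD0.trans_lt hd.1) hd.2 C hxC
        fun y hy z hz => (hdist y hy z hz).trans hd.1.le
    refine h1.trans ?_
    rw [mul_comm K, ENNReal.ofReal_mul hD0, mul_comm, hD, ENNReal.ofReal_toReal hfin]
  rw [Measure.hausdorffMeasure_apply, ENNReal.mul_iSup]
  refine le_iSup_of_le (ENNReal.ofReal (d₀ / 2)) ?_
  rw [ENNReal.mul_iSup]
  refine le_iSup_of_le (by simpa using hd₀) ?_
  refine (ENNReal.div_le_iff' (by simpa using hK) ENNReal.ofReal_ne_top).mp ?_
  refine le_iInf fun t => le_iInf fun hA => le_iInf fun ht => ?_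
  refine ENNReal.div_le_of_le_mul' ?_
  have h1 : A ⊆ ⋃ n, A ∩ t n := by rw [← inter_iUnion]; exact subset_inter subset_rfl hA
  refine (measure_mono h1).trans ((measure_iUnion_le _).trans ?_)
  rw [← ENNReal.tsum_mul_left]
  refine ENNReal.tsum_le_tsum fun n => ?_
  rcases (A ∩ t n).eq_empty_or_nonempty with hn | hn
  · simp [hn]
  · have := hn.mono inter_subset_right
    simp only [this, iSup_pos, ENNReal.rpow_one]
    exact (measure_mono inter_subset_right).trans (key _ hn (ht n))

namespace GGPair

variable {F Ω : Set E2} {μ : Measure E2} {ν : E2 → E2}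

lemma measure_le_hausdorffMeasure (h : GGPair F μ ν Ω) {A : Set E2}
    (hA : ∀ x ∈ A, x ∈ Ω ∧ IsLebesguePt μ ν x) : μ A ≤ μH[1] A := by
  have key : ∀ ε : ℝ, 0 < ε → μ A ≤ ENNReal.ofReal (1 + ε) * μH[1] A := fun ε hε => by
    let S : ℕ → Set E2 := fun n => {x ∈ A | ∀ d, 0 < d → d < ((n : ℝ) + 1)⁻¹ → ∀ C : Set E2, x ∈ C →
      (∀ y ∈ C, ∀ z ∈ C, dist y z ≤ d) → μ C ≤ ENNReal.ofReal ((1 + ε) * d)}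
    have hmono : Monotone S := fun i j hij x hx => ⟨hx.1, fun d hd hd' =>
      hx.2 d hd (hd'.trans_le (by gcongr))⟩
    have hun : A ⊆ ⋃ n, S n := fun x hx => by
      obtain ⟨d₀, hd₀, h0⟩ := h.exists_upper_density (hA x hx).1 (hA x hx).2 hε
      obtain ⟨n, hn⟩ := exists_nat_one_div_lt hd₀
      rw [one_div] at hn
      exact mem_iUnion.mpr ⟨n, hx, fun d hd hd' => h0 d hd (hd'.trans hn)⟩
    refine (measure_mono hun).trans ?_
    rw [hmono.measure_iUnion]
    refine iSup_le fun n => ?_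
    refine (measure_le_mul_hausdorffMeasure (K := 1 + ε) (d₀ := ((n : ℝ) + 1)⁻¹) (by positivity)
      (by positivity) fun x hx => hx.2).trans ?_
    gcongr
    exact fun x hx => hx.1
  have hlim : Tendsto (fun ε => ENNReal.ofReal (1 + ε) * μH[1] A) (𝓝[>] 0) (𝓝 (1 * μH[1] A)) := by
    refine ENNReal.Tendsto.mul_const ?_ (Or.inl one_ne_zero)
    have : ContinuousWithinAt (fun ε : ℝ => ENNReal.ofReal (1 + ε)) (Ioi 0) 0 :=
      (ENNReal.continuous_ofReal.comp (continuous_const.add continuous_id)).continuousWithinAt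
    simpa [ContinuousWithinAt] using this
  rw [one_mul] at hlim
  exact ge_of_tendsto hlim (eventually_mem_nhdsWithin.mono fun ε hε => key ε hε)

/-- The anisotropic total variation on test fields is bounded by the perimeter integral over the
reduced boundary. -/
lemma ofReal_integral_div2_le_aniPer (h : GGPair F μ ν Ω) {φ : E2 → ℝ} (hφ : IsAnisotropy φ)
    {T : E2 → E2} (hT : ContDiff ℝ 1 T) (hc : HasCompactSupport T) (hs : tsupport T ⊆ Ω)
    (hT1 : ∀ x, φ (T x) ≤ 1) :
    ENNReal.ofReal (∫ y in F, div2 T y) ≤ aniPer φ F Ω := by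
  have := h.fin
  have hgood : ∀ᵐ x ∂μ, x ∈ Ω ∧ IsLebesguePt μ ν x := by
    have h1 : ∀ᵐ x ∂μ, x ∈ Ω := h.supp
    exact h1.and h.ae_isLebesguePt
  obtain ⟨A, hA, hAm, hA0⟩ : ∃ A : Set E2, (∀ x ∈ A, x ∈ Ω ∧ IsLebesguePt μ ν x) ∧
      MeasurableSet A ∧ μ Aᶜ = 0 := by
    refine ⟨(toMeasurable μ {x | ¬ (x ∈ Ω ∧ IsLebesguePt μ ν x)})ᶜ, fun x hx => ?_,
      (measurableSet_toMeasurable _ _).compl, ?_⟩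
    · by_contra hcon
      exact hx (subset_toMeasurable _ _ hcon)
    · rw [compl_compl, measure_toMeasurable]; exact hgood
  have hν : Measurable fun y => dualA φ (ν y) := hφ.continuous_dualA.measurable.comp h.nu_meas
  rw [h.integral_div2 hT hc hs]
  obtain ⟨C, hC, hCb⟩ := hφ.exists_dualA_le
  have hint : Integrable (fun y => dualA φ (ν y)) μ :=
    Integrable.of_bound (C := C) hν.aestronglyMeasurable (Eventually.of_forall fun y => by
      rw [Real.norm_eq_abs, abs_of_nonneg (hφ.dualA_nonneg _)]
      simpa [h.nu_norm] using hCb (ν y))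
  have hTint : Integrable (fun y => ⟪T y, ν y⟫) μ := by
    obtain ⟨M, hM⟩ := hc.exists_bound_of_continuous hT.continuous
    refine Integrable.of_bound (C := M)
      (hT.continuous.measurable.inner h.nu_meas).aestronglyMeasurable
      (Eventually.of_forall fun y => ?_)
    refine (norm_inner_le_norm _ _).trans ?_
    rw [h.nu_norm, mul_one]; exact hM y
  calc ENNReal.ofReal (∫ y, ⟪T y, ν y⟫ ∂μ) ≤ ENNReal.ofReal (∫ y, dualA φ (ν y) ∂μ) := by
        refine ENNReal.ofReal_le_ofReal (integral_mono hTint hint fun y => ?_)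
        simp only
        rw [real_inner_comm]
        exact hφ.inner_le_dualA _ (hT1 y)
    _ = ∫⁻ y, ENNReal.ofReal (dualA φ (ν y)) ∂μ :=
        ofReal_integral_eq_lintegral_ofReal hint (Eventually.of_forall fun y => hφ.dualA_nonneg _)
    _ = ∫⁻ y in A, ENNReal.ofReal (dualA φ (ν y)) ∂μ := by
        rw [Measure.restrict_eq_self_of_ae_mem]
        exact hA0
    _ ≤ ∫⁻ y in A, ENNReal.ofReal (dualA φ (ν y)) ∂μH[1] := by
        refine lintegral_mono' (Measure.le_iff.mpr fun B hB => ?_) le_rfl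
        rw [Measure.restrict_apply hB, Measure.restrict_apply hB]
        exact h.measure_le_hausdorffMeasure fun x hx => hA x hx.2
    _ = ∫⁻ y in A, ENNReal.ofReal (dualA φ (genNormal F y)) ∂μH[1] :=
        setLIntegral_congr_fun hAm fun y hy => by
          rw [(h.isOuterNormalAt (hA y hy).1 (hA y hy).2).genNormal_eq]
    _ ≤ _ := lintegral_mono_set (show A ⊆ Ω ∩ redBoundary F from fun y hy =>
        ⟨(hA y hy).1, _, h.isOuterNormalAt (hA y hy).1 (hA y hy).2⟩)

end GGPair

lemma ediam_closedBall_le_ofReal (x : E2) (r : ℝ) :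
    Metric.ediam (Metric.closedBall x r) ≤ ENNReal.ofReal (2 * r) := by
  refine Metric.ediam_le fun y hy z hz => ?_
  rw [edist_dist]
  refine ENNReal.ofReal_le_ofReal ((dist_triangle_right y z x).trans ?_)
  have h1 := Metric.mem_closedBall.mp hy
  have h2 := Metric.mem_closedBall.mp hz
  linarith

/-- A set at every point of which a measure has one-dimensional lower density at least `c` is
efficiently covered by small sets. -/
lemma exists_efficient_cover {l : Measure E2} [IsFiniteMeasure l] {A U : Set E2} (hU : IsOpen U)
    (hAU : A ⊆ U) {c : ℝ} (hc : 0 < c)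
    (h : ∀ x ∈ A, ∀ᶠ r in 𝓝[>] (0 : ℝ), ENNReal.ofReal (2 * c * r) ≤ l (Metric.closedBall x r))
    {δ : ℝ} (hδ : 0 < δ) :
    ∃ (v : Set (E2 × ℝ)) (t : v → Set E2), v.Countable ∧
      (∀ i, Metric.ediam (t i) ≤ ENNReal.ofReal (10 * δ)) ∧ A ⊆ ⋃ i, t i ∧
      ENNReal.ofReal c * ∑' i, Metric.ediam (t i) ≤ l U + ENNReal.ofReal δ := by
  classical
  let B : E2 × ℝ → Set E2 := fun z => Metric.closedBall z.1 z.2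
  let 𝒯 : Set (E2 × ℝ) := {z | 0 < z.2 ∧ z.2 ≤ δ ∧ B z ⊆ U ∧ ENNReal.ofReal (2 * c * z.2) ≤ l (B z)}
  obtain ⟨v, hv𝒯, hdisj, hcov⟩ := Vitali.exists_disjoint_subfamily_covering_enlargement B 𝒯
    (fun z => z.2) 2 (by norm_num) (fun z hz => hz.1.le) δ (fun z hz => hz.2.1)
    (fun z hz => ⟨z.1, Metric.mem_closedBall_self hz.1.le⟩)
  have hcount : v.Countable := hdisj.countable_of_nonempty_interior fun z hz =>
    (Metric.nonempty_ball.mpr (hv𝒯 hz).1).mono Metric.ball_subset_interior_closedBall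
  have : Countable v := hcount.to_subtype
  have hsum : ∑' i : v, l (B i) ≤ l U := by
    rw [← measure_biUnion hcount hdisj fun z _ => Metric.isClosed_closedBall.measurableSet]
    exact measure_mono (iUnion₂_subset fun z hz => (hv𝒯 hz).2.2.1)
  have hfin : ∑' i : v, l (B i) ≠ ⊤ := (hsum.trans_lt (measure_lt_top l U)).ne
  obtain ⟨s, hs⟩ := ((ENNReal.tendsto_tsum_compl_atTop_zero hfin).eventually
    (gt_mem_nhds (show (0 : ℝ≥0∞) < ENNReal.ofReal δ / 5 by
      exact ENNReal.div_pos (by simpa using hδ) (by norm_num)))).exists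
  let t : v → Set E2 := fun i =>
    if i ∈ s then B i else Metric.closedBall i.1.1 (5 * i.1.2)
  have hdiam : ∀ i : v, Metric.ediam (t i) ≤ ENNReal.ofReal (2 * i.1.2) +
      (if i ∈ s then 0 else 5 * ENNReal.ofReal (2 * i.1.2)) := fun i => by
    by_cases hi : i ∈ s
    · simp only [t, hi, if_true, add_zero]
      exact ediam_closedBall_le_ofReal _ _
    · simp only [t, hi, if_false]
      refine (ediam_closedBall_le_ofReal _ _).trans (le_trans (le_of_eq ?_) le_add_self)
      rw [show (5 : ℝ≥0∞) = ENNReal.ofReal 5 by simp, ← ENNReal.ofReal_mul (by norm_num)]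
      congr 1; ring
  refine ⟨v, t, hcount, fun i => ?_, fun y hy => ?_, ?_⟩
  · have h1 := (hv𝒯 i.2).1
    have h2 := (hv𝒯 i.2).2.1
    by_cases hi : i ∈ s
    · simp only [t, hi, if_true]
      exact (ediam_closedBall_le_ofReal _ _).trans (ENNReal.ofReal_le_ofReal (by linarith))
    · simp only [t, hi, if_false]
      exact (ediam_closedBall_le_ofReal _ _).trans (ENNReal.ofReal_le_ofReal (by linarith))
  · by_cases hys : ∃ i ∈ s, y ∈ B i.1
    · obtain ⟨i, hi, hyi⟩ := hys
      exact mem_iUnion.mpr ⟨i, by simpa only [t, hi, if_true] using hyi⟩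
    · push Not at hys
      have hcl : IsClosed (⋃ i ∈ s, B i.1) :=
        s.finite_toSet.isClosed_biUnion fun i _ => Metric.isClosed_closedBall
      have hopen : IsOpen (U \ ⋃ i ∈ s, B i.1) := hU.sdiff hcl
      have hymem : y ∈ U \ ⋃ i ∈ s, B i.1 := ⟨hAU hy, by simpa using hys⟩
      obtain ⟨ρ, hρ, hρs⟩ := Metric.nhds_basis_closedBall.mem_iff.mp (hopen.mem_nhds hymem)
      obtain ⟨r₀, hr₀, hr⟩ := exists_forall_of_eventually_nhdsGT (h y hy)
      set r := min (min ρ δ) (r₀ / 2) with hrdef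
      have hr0 : 0 < r := by positivity
      have hrρ : r ≤ ρ := (min_le_left _ _).trans (min_le_left _ _)
      have hrδ : r ≤ δ := (min_le_left _ _).trans (min_le_right _ _)
      have hrr : r < r₀ := (min_le_right _ _).trans_lt (half_lt_self hr₀)
      have hsub : Metric.closedBall y r ⊆ U \ ⋃ i ∈ s, B i.1 :=
        (Metric.closedBall_subset_closedBall hrρ).trans hρs
      have hmem : (y, r) ∈ 𝒯 := ⟨hr0, hrδ, hsub.trans sdiff_subset, hr r hr0 hrr⟩
      obtain ⟨z, hz, ⟨w, hw1, hw2⟩, hle⟩ := hcov _ hmem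
      have hzs : (⟨z, hz⟩ : v) ∉ s := fun hzs =>
        (hsub hw1).2 (mem_biUnion (x := (⟨z, hz⟩ : v)) hzs hw2)
      refine mem_iUnion.mpr ⟨⟨z, hz⟩, ?_⟩
      simp only [t, hzs, if_false, Metric.mem_closedBall]
      have h1 := Metric.mem_closedBall'.mp hw1
      have h2 := Metric.mem_closedBall.mp hw2
      simp only at h1 hle
      have := dist_triangle y w z.1
      linarith
  · have hw : ∀ i : v, ENNReal.ofReal c * ENNReal.ofReal (2 * i.1.2) ≤ l (B i) := fun i => by
      refine le_trans (le_of_eq ?_) (hv𝒯 i.2).2.2.2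
      rw [← ENNReal.ofReal_mul hc.le]; congr 1; ring
    rw [← ENNReal.tsum_mul_left]
    calc ∑' i, ENNReal.ofReal c * Metric.ediam (t i)
        ≤ ∑' i : v, (l (B i) + 5 * ((s : Set v)ᶜ).indicator (fun i => l (B i.1)) i) := by
          refine ENNReal.tsum_le_tsum fun i => ?_
          refine (mul_le_mul_right (hdiam i) _).trans ?_
          rw [mul_add]
          refine add_le_add (hw i) ?_
          by_cases hi : i ∈ s
          · simp [hi]
          · simp only [hi, if_false]
            rw [indicator_of_mem (by simpa using hi), mul_left_comm]
            exact mul_le_mul_right (hw i) _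
      _ = ∑' i : v, l (B i) + 5 * ∑' i : ((s : Set v)ᶜ : Set v), l (B i.1) := by
          rw [ENNReal.tsum_add, ENNReal.tsum_mul_left,
            tsum_subtype ((s : Set v)ᶜ) fun i : v => l (B i.1)]
      _ ≤ l U + 5 * (ENNReal.ofReal δ / 5) := by
          refine add_le_add hsum (mul_le_mul_right ?_ _)
          exact hs.le
      _ = _ := by
          rw [ENNReal.mul_div_cancel (by norm_num) (by norm_num)]

lemma ofReal_mul_hausdorffMeasure_le {l : Measure E2} [IsFiniteMeasure l] {A : Set E2} {c : ℝ}
    (h : ∀ x ∈ A, ∀ᶠ r in 𝓝[>] (0 : ℝ), ENNReal.ofReal (2 * c * r) ≤ l (Metric.closedBall x r)) :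
    ENNReal.ofReal c * μH[1] A ≤ l A := by
  rcases le_or_gt c 0 with hc | hc
  · simp [ENNReal.ofReal_of_nonpos hc]
  have hc0 : ENNReal.ofReal c ≠ 0 := by simpa using hc
  refine ENNReal.le_of_forall_pos_le_add fun ε hε _ => ?_
  obtain ⟨U, hAU, hU, hlU⟩ := A.exists_isOpen_le_add l (ε := ε) (by simpa using hε.ne')
  refine le_trans ?_ hlU
  have hpos : ∀ n : ℕ, 0 < ((n : ℝ) + 1)⁻¹ := fun n => by positivity
  choose v t hv hdiam hcov hsum using fun n : ℕ => exists_efficient_cover hU hAU hc h (hpos n)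
  have : ∀ n, Countable (v n) := fun n => (hv n).to_subtype
  have hlim0 : Tendsto (fun n : ℕ => ((n : ℝ) + 1)⁻¹) atTop (𝓝 0) := by
    simpa [one_div] using tendsto_one_div_add_atTop_nhds_zero_nat (𝕜 := ℝ)
  have h1 := Measure.hausdorffMeasure_le_liminf_tsum (β := ℕ) (ι := fun n => v n) 1 A (l := atTop)
    (fun n => ENNReal.ofReal (10 * ((n : ℝ) + 1)⁻¹))
    (by
      have := (ENNReal.continuous_ofReal.tendsto _).comp (hlim0.const_mul 10)
      rwa [mul_zero, ENNReal.ofReal_zero] at this) t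
    (Eventually.of_forall hdiam) (Eventually.of_forall hcov)
  simp only [ENNReal.rpow_one] at h1
  have h2 : Tendsto (fun n : ℕ => (l U + ENNReal.ofReal ((n : ℝ) + 1)⁻¹) / ENNReal.ofReal c) atTop
      (𝓝 (l U / ENNReal.ofReal c)) := by
    refine ENNReal.Tendsto.div_const ?_ (Or.inr hc0)
    have := ((ENNReal.continuous_ofReal.tendsto _).comp hlim0).const_add (l U)
    simpa using this
  have h3 : μH[1] A ≤ l U / ENNReal.ofReal c := by
    refine h1.trans ?_
    rw [← h2.liminf_eq]
    refine liminf_le_liminf (Eventually.of_forall fun n => ?_)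
    rw [ENNReal.le_div_iff_mul_le (Or.inl hc0) (Or.inl ENNReal.ofReal_ne_top), mul_comm]
    exact hsum n
  rw [ENNReal.le_div_iff_mul_le (Or.inl hc0) (Or.inl ENNReal.ofReal_ne_top), mul_comm] at h3
  exact h3

namespace GGPair

variable {E Ω : Set E2} {μ : Measure E2} {ν : E2 → E2} {φ : E2 → ℝ}

lemma integrable_dualA (h : GGPair E μ ν Ω) (hφ : IsAnisotropy φ) :
    Integrable (fun y => dualA φ (ν y)) μ := by
  have := h.fin
  obtain ⟨C, hC, hCb⟩ := hφ.exists_dualA_le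
  refine Integrable.of_bound (C := C)
    (hφ.continuous_dualA.measurable.comp h.nu_meas).aestronglyMeasurable
    (Eventually.of_forall fun y => ?_)
  rw [Real.norm_eq_abs, abs_of_nonneg (hφ.dualA_nonneg _)]
  simpa [h.nu_norm] using hCb (ν y)

/-- The anisotropic total variation measure. -/
def aniMeasure (φ : E2 → ℝ) (μ : Measure E2) (ν : E2 → E2) : Measure E2 :=
  μ.withDensity fun y => ENNReal.ofReal (dualA φ (ν y))

lemma aniMeasure_apply (h : GGPair E μ ν Ω) (hφ : IsAnisotropy φ) {B : Set E2}
    (hB : MeasurableSet B) :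
    aniMeasure φ μ ν B = ENNReal.ofReal (∫ y in B, dualA φ (ν y) ∂μ) := by
  rw [aniMeasure, withDensity_apply _ hB, ofReal_integral_eq_lintegral_ofReal
    (h.integrable_dualA hφ).integrableOn (Eventually.of_forall fun y => hφ.dualA_nonneg _)]

lemma isFiniteMeasure_aniMeasure (h : GGPair E μ ν Ω) (hφ : IsAnisotropy φ) :
    IsFiniteMeasure (aniMeasure φ μ ν) :=
  ⟨by rw [h.aniMeasure_apply hφ MeasurableSet.univ]; exact ENNReal.ofReal_lt_top⟩

/-- Lower density of the anisotropic total variation at points of the reduced boundary. -/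
lemma aniMeasure_lower_density (h : GGPair E μ ν Ω) (hφ : IsAnisotropy φ) {x n : E2} (hx : x ∈ Ω)
    (hn : IsOuterNormalAt E x n) {c : ℝ} (hc0 : 0 ≤ c) (hc : c < dualA φ n) :
    ∀ᶠ r in 𝓝[>] (0 : ℝ), ENNReal.ofReal (2 * c * r) ≤
      aniMeasure φ μ ν (Metric.closedBall x r) := by
  have := h.fin
  have hst := stBound_pos
  obtain ⟨η, hη, hcη⟩ := hφ.exists_lt_inner hc
  obtain ⟨b, hb⟩ := exists_orthonormalBasis_snd hn.1
  set c' := ⟪n, η⟫ with hc'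
  have hc'0 : 0 < c' := hc0.trans_lt hcη
  have hη0 : 0 < ‖η‖ := norm_pos_iff.mpr fun h0 => by rw [h0, inner_zero_right] at hc'; linarith
  have hgap : 0 < c' - c := by linarith
  set θ := min (1 / 8) ((c' - c) / (8 * c')) with hθ
  have hθ0 : 0 < θ := by positivity
  have hθ1 : θ ≤ 1 / 8 := min_le_left _ _
  have hθ2 : 8 * θ * c' ≤ c' - c := by
    have : θ ≤ (c' - c) / (8 * c') := min_le_right _ _
    rw [le_div_iff₀ (by positivity)] at this
    linarith
  set ε := (c' - c) * θ / (16 * stBound * ‖η‖) with hε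
  have hε0 : 0 < ε := by positivity
  obtain ⟨r₁, hr₁, hflat⟩ := exists_forall_of_eventually_nhdsGT
    ((isOuterNormalAt_iff.mp hn).2 ε hε0)
  obtain ⟨r₂, hr₂, hball⟩ := Metric.nhds_basis_closedBall.mem_iff.mp (h.isOpen.mem_nhds hx)
  refine eventually_nhdsGT_of_forall (r₀ := min (r₁ / 2) r₂) (by positivity) fun r hr hr0 => ?_
  have hrr1 : 2 * r < r₁ := by linarith [hr0.trans_le (min_le_left (r₁ / 2) r₂)]
  have hrr2 : r < r₂ := hr0.trans_le (min_le_right _ _)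
  have hΩ : Metric.closedBall x r ⊆ Ω :=
    (Metric.closedBall_subset_closedBall hrr2.le).trans hball
  have hm0 : 0 < θ * r := by positivity
  set ρ₀ := (1 - 4 * θ) * r with hρ₀
  have hρ0 : 0 ≤ ρ₀ := by have : 0 ≤ 1 - 4 * θ := by linarith
                          positivity
  have hsz : ρ₀ + θ * r + 2 * (θ * r) ≤ r := by rw [hρ₀]; nlinarith
  have hmain := h.abs_integral_rectCutoff_sub_le (b := b) (x := x) (p := -ρ₀) (q := ρ₀)
    (w := θ * r) (m := θ * r) (ρ₀ := ρ₀) (ρ := r) (R := 2 * r) hm0 hm0 le_rfl le_rfl hsz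
    (by linarith) hΩ η
  have hT : TestFun Ω (rectCutoff b x (-ρ₀) ρ₀ (θ * r) (θ * r)) :=
    testFun_rectCutoff (ρ₀ := ρ₀) (ρ := r) hm0 le_rfl le_rfl hsz hΩ
  rw [hb, real_inner_comm, ← hc'] at hmain
  have hvol : volume.real ((E ∆ halfPlane x n) ∩ Metric.ball x (2 * r)) ≤ ε * (2 * r) ^ 2 :=
    ENNReal.toReal_le_of_le_ofReal (by positivity) (hflat (2 * r) (by positivity) hrr1)
  have hpl := le_integral_plateau (p := -ρ₀) (q := ρ₀) hm0 (by linarith)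
  have h2 : 4 * stBound / (θ * r) * ‖η‖ *
      volume.real ((E ∆ halfPlane x n) ∩ Metric.ball x (2 * r)) ≤ (c' - c) * r := by
    calc _ ≤ 4 * stBound / (θ * r) * ‖η‖ * (ε * (2 * r) ^ 2) := by gcongr
      _ = (c' - c) * r := by rw [hε]; field_simp; ring
  have h3 : ∫ y, rectCutoff b x (-ρ₀) ρ₀ (θ * r) (θ * r) y * ⟪η, ν y⟫ ∂μ ≤
      ∫ y in Metric.closedBall x r, dualA φ (ν y) ∂μ := by
    rw [← integral_indicator Metric.isClosed_closedBall.measurableSet]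
    refine integral_mono (h.integrable_mul_inner hT _) ((h.integrable_dualA hφ).indicator
      Metric.isClosed_closedBall.measurableSet) fun y => ?_
    by_cases hy : y ∈ Metric.closedBall x r
    · simp only [indicator_of_mem hy]
      have h1 := hφ.inner_le_dualA (ν y) hη.le
      rw [real_inner_comm] at h1
      have h2 := rectCutoff_nonneg (b := b) (x := x) (p := -ρ₀) (q := ρ₀) (w := θ * r)
        (m := θ * r) y
      have h3 := rectCutoff_le_one (b := b) (x := x) (p := -ρ₀) (q := ρ₀) (w := θ * r)
        (m := θ * r) y
      have h4 := hφ.dualA_nonneg (ν y)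
      nlinarith
    · have : rectCutoff b x (-ρ₀) ρ₀ (θ * r) (θ * r) y = 0 :=
        image_eq_zero_of_notMem_tsupport fun h' => hy
        (tsupport_rectCutoff (b := b) (x := x) hm0 le_rfl le_rfl hsz h')
      simp [indicator_of_notMem hy, this]
  rw [h.aniMeasure_apply hφ Metric.isClosed_closedBall.measurableSet]
  refine ENNReal.ofReal_le_ofReal ?_
  have h4 := (abs_le.mp hmain).1
  have h5 : c' * (2 * ρ₀) ≤ c' * ∫ s, plateau (-ρ₀) ρ₀ (θ * r) s :=
    mul_le_mul_of_nonneg_left (by linarith) hc'0.le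
  have h6 : c' * (2 * ρ₀) = 2 * c' * r - 8 * θ * c' * r := by rw [hρ₀]; ring
  have h7 : 8 * θ * c' * r ≤ (c' - c) * r := mul_le_mul_of_nonneg_right hθ2 hr.le
  linarith

/-- The perimeter integral over the reduced boundary is bounded by the anisotropic total
variation. -/
lemma aniPer_le_aniMeasure (h : GGPair E μ ν Ω) (hφ : IsAnisotropy φ) :
    aniPer φ E Ω ≤ aniMeasure φ μ ν univ := by
  have := h.isFiniteMeasure_aniMeasure hφ
  set l := aniMeasure φ μ ν with hl
  have key : ∀ (c : ℝ≥0∞) (A : Set E2), A ⊆ Ω ∩ redBoundary E →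
      (∀ x ∈ A, c ≤ ENNReal.ofReal (dualA φ (genNormal E x))) → c * μH[1] A ≤ l A := by
    intro c A hA hcA
    rcases A.eq_empty_or_nonempty with rfl | ⟨x₀, hx₀⟩
    · simp
    rcases eq_or_ne c 0 with rfl | hc0
    · simp
    have hctop : c ≠ ⊤ := ((hcA x₀ hx₀).trans_lt ENNReal.ofReal_lt_top).ne
    have hcr : 0 < c.toReal := ENNReal.toReal_pos hc0 hctop
    have hlim : Tendsto (fun t : ℝ => ENNReal.ofReal t * μH[1] A) (𝓝[<] c.toReal)
        (𝓝 (c * μH[1] A)) := by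
      refine ENNReal.Tendsto.mul_const ?_ (Or.inl hc0)
      have : ContinuousWithinAt ENNReal.ofReal (Iio c.toReal) c.toReal :=
        ENNReal.continuous_ofReal.continuousWithinAt
      rwa [ContinuousWithinAt, ENNReal.ofReal_toReal hctop] at this
    refine le_of_tendsto hlim ?_
    filter_upwards [Ioo_mem_nhdsLT hcr] with t ht
    refine ofReal_mul_hausdorffMeasure_le fun x hx => ?_
    refine h.aniMeasure_lower_density hφ (hA hx).1 (isOuterNormalAt_genNormal (hA hx).2) ht.1.le ?_
    refine ht.2.trans_le (ENNReal.toReal_le_of_le_ofReal (hφ.dualA_nonneg _) (hcA x hx))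
  rw [aniPer, lintegral]
  refine iSup₂_le fun g hg => ?_
  rw [SimpleFunc.lintegral]
  calc ∑ c ∈ g.range, c * (μH[1].restrict (Ω ∩ redBoundary E)) (g ⁻¹' {c})
      ≤ ∑ c ∈ g.range, l (g ⁻¹' {c}) := by
        refine Finset.sum_le_sum fun c _ => ?_
        rw [Measure.restrict_apply (g.measurableSet_fiber c)]
        refine (key c _ inter_subset_right fun x hx => ?_).trans (measure_mono inter_subset_left)
        rw [← (show g x = c from hx.1)]
        exact hg x
    _ = l univ := g.sum_range_measure_preimage_singleton l

end GGPair

/-- An admissible test field for the anisotropic perimeter in `Ω`. -/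
structure TestField (φ : E2 → ℝ) (Ω : Set E2) (S : E2 → E2) : Prop where
  contDiff : ContDiff ℝ 1 S
  compact : HasCompactSupport S
  subset : tsupport S ⊆ Ω
  le_one : ∀ x, φ (S x) ≤ 1

namespace GGPair

variable {E Ω : Set E2} {μ : Measure E2} {ν : E2 → E2} {φ : E2 → ℝ}

lemma exists_testField_approx (h : GGPair E μ ν Ω) (hφ : IsAnisotropy φ) {κ : E2 → ℕ}
    (hκ : Measurable κ) {N : ℕ} (hN : ∀ x, κ x < N) {η : ℕ → E2} (hη : ∀ k, φ (η k) ≤ 1)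
    {δ : ℝ≥0∞} (hδ : δ ≠ 0) :
    ∃ S R, TestField φ Ω S ∧ MeasurableSet R ∧ μ R ≤ δ ∧ ∀ x ∉ R, S x = η (κ x) := by
  have := h.fin
  have hδN : δ / (N + 1) ≠ 0 := (ENNReal.div_pos hδ (by finiteness)).ne'
  have hB : ∀ k, MeasurableSet (κ ⁻¹' {k} ∩ Ω) := fun k =>
    (hκ (measurableSet_singleton k)).inter h.isOpen.measurableSet
  choose K hKB hK hKδ using fun k =>
    (hB k).exists_isCompact_sdiff_lt (μ := μ) (measure_ne_top _ _) hδN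
  let U : ℕ → Set E2 := fun k => Ω ∩ ⋂ j ∈ (Finset.range N).erase k, (K j)ᶜ
  have hU : ∀ k, IsOpen (U k) := fun k => h.isOpen.inter
    (isOpen_biInter_finset fun j _ => (hK j).isClosed.isOpen_compl)
  have hKU : ∀ k, K k ⊆ U k := fun k x hx => by
    refine ⟨(hKB k hx).2, mem_iInter₂.mpr fun j hj hxj => (Finset.mem_erase.mp hj).1 ?_⟩
    rw [← (show κ x = j from (hKB j hxj).1), ← (show κ x = k from (hKB k hx).1)]
  choose ζ hζ hζ1 hζ01 using fun k => exists_testFun (hK k) (hU k) (hKU k)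
  let ψ : ℕ → E2 → ℝ := fun k x => ζ k x * ∏ j ∈ Finset.range N with j < k, (1 - ζ j x)
  have hψ : ∀ k, TestFun Ω (ψ k) := fun k =>
    ((hζ k).mono inter_subset_left).mul_right
      (contDiff_prod fun j _ => contDiff_const.sub (hζ j).contDiff)
  have hψ0 : ∀ k x, 0 ≤ ψ k x := fun k x => mul_nonneg (hζ01 k x).1
    (Finset.prod_nonneg fun j _ => by linarith [(hζ01 j x).2])
  have hψsum : ∀ x, ∑ k ∈ Finset.range N, ψ k x ≤ 1 := fun x => by
    have h1 := Finset.prod_one_sub_ordered (Finset.range N) fun k => ζ k x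
    have h2 : 0 ≤ ∏ k ∈ Finset.range N, (1 - ζ k x) :=
      Finset.prod_nonneg fun j _ => by linarith [(hζ01 j x).2]
    simp only [ψ]
    linarith
  have hφsum : ∀ (s : Finset ℕ) (x : E2), φ (∑ k ∈ s, ψ k x • η k) ≤ ∑ k ∈ s, ψ k x := by
    intro s x
    induction s using Finset.cons_induction with
    | empty => simp [hφ.map_zero]
    | cons k s hk ih =>
      rw [Finset.sum_cons, Finset.sum_cons]
      refine (hφ.add_le _ _).trans (add_le_add ?_ ih)
      rw [hφ.smul_eq, abs_of_nonneg (hψ0 k x)]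
      exact mul_le_of_le_one_right (hψ0 k x) (hη k)
  have hsupp : tsupport (fun x => ∑ k ∈ Finset.range N, ψ k x • η k) ⊆
      ⋃ k ∈ Finset.range N, tsupport (ψ k) := by
    refine closure_minimal (fun x hx => ?_)
      ((Finset.range N).finite_toSet.isClosed_biUnion fun k _ => isClosed_tsupport _)
    obtain ⟨k, hk, hne⟩ := Finset.exists_ne_zero_of_sum_ne_zero hx
    refine mem_biUnion hk (subset_tsupport _ fun h0 => hne ?_)
    rw [h0, zero_smul]
  refine ⟨fun x => ∑ k ∈ Finset.range N, ψ k x • η k,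
    Ωᶜ ∪ ⋃ k ∈ Finset.range N, ((κ ⁻¹' {k} ∩ Ω) \ K k), ⟨?_, ?_, ?_, ?_⟩, ?_, ?_, ?_⟩
  · exact ContDiff.sum fun k _ => (hψ k).contDiff.smul contDiff_const
  · exact ((Finset.range N).isCompact_biUnion fun k _ => (hψ k).compact).of_isClosed_subset
      (isClosed_tsupport _) hsupp
  · exact hsupp.trans (iUnion₂_subset fun k _ => (hψ k).subset)
  · exact fun x => (hφsum _ x).trans (hψsum x)
  · exact h.isOpen.measurableSet.compl.union (Finset.measurableSet_biUnion _ fun k _ =>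
      (hB k).diff (hK k).isClosed.measurableSet)
  · refine (measure_union_le _ _).trans ?_
    rw [h.supp, zero_add]
    refine (measure_biUnion_finset_le _ _).trans ?_
    refine (Finset.sum_le_sum fun k _ => (hKδ k).le).trans ?_
    rw [Finset.sum_const, Finset.card_range, nsmul_eq_mul, ← mul_div_assoc]
    refine ENNReal.div_le_of_le_mul ?_
    rw [mul_comm]
    gcongr
    exact le_self_add
  · intro x hx
    simp only [mem_union, not_or, mem_compl_iff, not_not, mem_iUnion, not_exists] at hx
    have hxk : x ∈ K (κ x) := by
      by_contra hcon
      exact hx.2 (κ x) (Finset.mem_range.mpr (hN x)) ⟨⟨rfl, hx.1⟩, hcon⟩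
    have hz : ∀ j ∈ Finset.range N, j ≠ κ x → ζ j x = 0 := fun j hj hne =>
      (hζ j).eq_zero fun hxU => (mem_iInter₂.mp hxU.2) (κ x)
        (Finset.mem_erase.mpr ⟨hne.symm, Finset.mem_range.mpr (hN x)⟩) hxk
    simp only
    rw [Finset.sum_eq_single_of_mem (κ x) (Finset.mem_range.mpr (hN x))]
    · have : ψ (κ x) x = 1 := by
        simp only [ψ]
        rw [hζ1 _ x hxk, one_mul]
        refine Finset.prod_eq_one fun j hj => ?_
        rw [Finset.mem_filter] at hj
        rw [hz j hj.1 hj.2.ne, sub_zero]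
      rw [this, one_smul]
    · intro j hj hne
      simp only [ψ]
      rw [hz j hj hne, zero_mul, zero_smul]

/-- Finitely many vectors of the Wulff shape almost realize the dual norm on the unit circle. -/
lemma _root_.IsAnisotropy.exists_finite_net (hφ : IsAnisotropy φ) {ε : ℝ} (hε : 0 < ε) :
    ∃ (N : ℕ) (η : ℕ → E2), (∀ k, φ (η k) ≤ 1) ∧
      ∀ ξ : E2, ‖ξ‖ = 1 → ∃ k < N, dualA φ ξ - ε < ⟪ξ, η k⟫ := by
  choose w hw hw' using fun ξ : E2 => hφ.exists_lt_inner (sub_lt_self (dualA φ ξ) hε)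
  have hc := hφ.continuous_dualA
  obtain ⟨t, ht⟩ := (isCompact_sphere (0 : E2) 1).elim_finite_subcover
    (fun v : E2 => {ξ : E2 | dualA φ ξ - ε < ⟪ξ, w v⟫})
    (fun v => isOpen_lt (hc.sub continuous_const) (by fun_prop))
    (fun ξ _ => mem_iUnion.mpr ⟨ξ, hw' ξ⟩)
  refine ⟨t.toList.length, fun k => w (t.toList.getD k 0), fun k => (hw _).le, fun ξ hξ => ?_⟩
  obtain ⟨v, hv, hξv⟩ := mem_iUnion₂.mp (ht (show ξ ∈ Metric.sphere (0 : E2) 1 by simpa using hξ))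
  obtain ⟨k, hk, hkv⟩ := List.mem_iff_getElem.mp (Finset.mem_toList.mpr hv)
  refine ⟨k, hk, ?_⟩
  show dualA φ ξ - ε < ⟪ξ, w (t.toList.getD k 0)⟫
  rw [List.getD_eq_getElem _ _ hk, hkv]
  exact hξv

lemma aniMeasure_univ_le (h : GGPair E μ ν Ω) (hφ : IsAnisotropy φ) {M : ℝ}
    (hM : ∀ S, TestField φ Ω S → ∫ y in E, div2 S y ≤ M) :
    aniMeasure φ μ ν univ ≤ ENNReal.ofReal M := by
  classical
  have := h.fin
  rw [h.aniMeasure_apply hφ MeasurableSet.univ, setIntegral_univ]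
  refine ENNReal.ofReal_le_ofReal ?_
  obtain ⟨C, hC, hCb⟩ := hφ.exists_dualA_le
  have key : ∀ ε : ℝ, 0 < ε → ∫ y, dualA φ (ν y) ∂μ ≤ M + ε * (μ.real univ + 2 * C) := fun ε hε => by
    obtain ⟨N, η, hη, hnet⟩ := hφ.exists_finite_net hε
    have hex : ∀ x, ∃ k, k < N ∧ dualA φ (ν x) - ε < ⟪ν x, η k⟫ := fun x => hnet _ (h.nu_norm x)
    let κ : E2 → ℕ := fun x => Nat.find (hex x)
    have hκm : Measurable κ := measurable_find hex fun k => by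
      by_cases hk : k < N
      · simp only [hk, true_and]
        exact measurableSet_lt ((hφ.continuous_dualA.measurable.comp h.nu_meas).sub_const _)
          (h.nu_meas.inner measurable_const)
      · simp [hk]
    have hκ : ∀ x, κ x < N ∧ dualA φ (ν x) - ε < ⟪ν x, η (κ x)⟫ := fun x => Nat.find_spec (hex x)
    obtain ⟨S, R, hS, hR, hμR, hSR⟩ := h.exists_testField_approx hφ hκm (fun x => (hκ x).1) hη
      (δ := ENNReal.ofReal ε) (by simpa using hε)
    have hμR' : μ.real R ≤ ε := ENNReal.toReal_le_of_le_ofReal hε.le hμR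
    have hCν : ∀ x, dualA φ (ν x) ≤ C := fun x => by simpa [h.nu_norm] using hCb (ν x)
    have hSlow : ∀ x, -C ≤ ⟪S x, ν x⟫ := fun x => by
      have h1 : φ (-S x) ≤ 1 := by
        rw [← neg_one_smul ℝ (S x), hφ.smul_eq]; simpa using hS.le_one x
      have h2 := hφ.inner_le_dualA (ν x) h1
      rw [inner_neg_right, real_inner_comm] at h2
      linarith [hCν x]
    have hSint : Integrable (fun y => ⟪S y, ν y⟫) μ := by
      obtain ⟨B, hB⟩ := hS.compact.exists_bound_of_continuous hS.contDiff.continuous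
      refine Integrable.of_bound (C := B)
        (hS.contDiff.continuous.measurable.inner h.nu_meas).aestronglyMeasurable
        (Eventually.of_forall fun y => ?_)
      refine (norm_inner_le_norm _ _).trans ?_
      rw [h.nu_norm, mul_one]; exact hB y
    have hcR : Integrable (R.indicator fun _ => 2 * C) μ := (integrable_const _).indicator hR
    have h1 : ∫ y, dualA φ (ν y) ∂μ ≤ ∫ y, (⟪S y, ν y⟫ + (ε + R.indicator (fun _ => 2 * C) y)) ∂μ := by
      refine integral_mono (h.integrable_dualA hφ)
        (hSint.add ((integrable_const _).add hcR)) fun x => ?_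
      simp only
      by_cases hx : x ∈ R
      · rw [indicator_of_mem hx]
        linarith [hSlow x, hCν x]
      · rw [indicator_of_notMem hx, hSR x hx, real_inner_comm]
        linarith [(hκ x).2]
    have hsum : Integrable (fun y => ε + R.indicator (fun _ => 2 * C) y) μ :=
      (integrable_const _).add hcR
    rw [integral_add hSint hsum, integral_add (integrable_const _) hcR,
      integral_const, integral_indicator hR, setIntegral_const, ← h.integral_div2 hS.contDiff
      hS.compact hS.subset, smul_eq_mul, smul_eq_mul] at h1
    have h2 := hM S hS
    nlinarith
  have hlim : Tendsto (fun ε : ℝ => M + ε * (μ.real univ + 2 * C)) (𝓝[>] 0) (𝓝 M) := by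
    have : ContinuousWithinAt (fun ε : ℝ => M + ε * (μ.real univ + 2 * C)) (Ioi 0) 0 := by
      fun_prop
    simpa [ContinuousWithinAt] using this
  exact ge_of_tendsto hlim (eventually_mem_nhdsWithin.mono fun ε hε => key ε hε)

end GGPair

/-- The perimeter integral over the reduced boundary is bounded by any bound for the anisotropic
variation on test fields. -/
lemma aniPer_le_of_forall_testField {φ : E2 → ℝ} (hφ : IsAnisotropy φ) {E Ω : Set E2}
    (hE : MeasurableSet E) (hΩ : IsOpen Ω) (hfin : perVar E Ω < ⊤) {M : ℝ}
    (hM : ∀ S, TestField φ Ω S → ∫ y in E, div2 S y ≤ M) : aniPer φ E Ω ≤ ENNReal.ofReal M := by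
  obtain ⟨μ, ν, h⟩ := exists_GGPair hE hΩ hfin
  exact (h.aniPer_le_aniMeasure hφ).trans (h.aniMeasure_univ_le hφ hM)

lemma ofReal_integral_div2_le_aniPer {φ : E2 → ℝ} (hφ : IsAnisotropy φ) {F Ω : Set E2}
    (hF : MeasurableSet F) (hΩ : IsOpen Ω) (hfin : perVar F Ω < ⊤) {S : E2 → E2}
    (hS : TestField φ Ω S) : ENNReal.ofReal (∫ y in F, div2 S y) ≤ aniPer φ F Ω := by
  obtain ⟨μ, ν, h⟩ := exists_GGPair hF hΩ hfin
  exact h.ofReal_integral_div2_le_aniPer hφ hS.contDiff hS.compact hS.subset hS.le_one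

@[simp] lemma vec2_zero (a b : ℝ) : vec2 a b 0 = a := rfl

@[simp] lemma vec2_one (a b : ℝ) : vec2 a b 1 = b := rfl

lemma vec2_eta (q : E2) : vec2 (q 0) (q 1) = q := by
  ext i; fin_cases i <;> rfl

lemma vec2_eq_smul (a b : ℝ) : vec2 a b =
    a • EuclideanSpace.single (0 : Fin 2) (1 : ℝ) + b • EuclideanSpace.single (1 : Fin 2) (1 : ℝ) := by
  ext i; fin_cases i <;> simp

lemma planeCoord_vec2 (p : ℝ × ℝ) : planeCoord (vec2 p.1 p.2) = p := rfl

lemma ContDiff.vec2 {n : WithTop ℕ∞} {F : Type*} [NormedAddCommGroup F] [NormedSpace ℝ F]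
    {c d : F → ℝ} (hc : ContDiff ℝ n c) (hd : ContDiff ℝ n d) :
    ContDiff ℝ n fun x => vec2 (c x) (d x) := by
  simp only [vec2_eq_smul]
  exact (hc.smul contDiff_const).add (hd.smul contDiff_const)

lemma Continuous.vec2 {F : Type*} [TopologicalSpace F]
    {c d : F → ℝ} (hc : Continuous c) (hd : Continuous d) :
    Continuous fun x => vec2 (c x) (d x) := by
  simp only [vec2_eq_smul]
  exact (hc.smul continuous_const).add (hd.smul continuous_const)

lemma HasDerivAt.vec2 {c d : ℝ → ℝ} {c' d' s : ℝ} (hc : HasDerivAt c c' s)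
    (hd : HasDerivAt d d' s) : HasDerivAt (fun x => vec2 (c x) (d x)) (vec2 c' d') s := by
  simp only [vec2_eq_smul]
  exact (hc.smul_const _).add (hd.smul_const _)

lemma HasCompactSupport.comp_shear {f : E2 → ℝ} (hf : HasCompactSupport f) {v : ℝ → ℝ}
    (hv : Continuous v) : HasCompactSupport fun p : ℝ × ℝ => f (vec2 p.1 (v p.1 - p.2)) := by
  have hc : Continuous fun q : E2 => (q 0, v (q 0) - q 1) := by fun_prop
  refine HasCompactSupport.of_support_subset_isCompact (hf.isCompact.image hc) fun p hp => ?_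
  refine ⟨_, subset_tsupport _ hp, ?_⟩
  simp

namespace TestFun

variable {Ω : Set E2} {ζ : E2 → ℝ}

lemma hasDerivAt_comp (h : TestFun Ω ζ) {c d : ℝ → ℝ} {c' d' s : ℝ} (hc : HasDerivAt c c' s)
    (hd : HasDerivAt d d' s) : HasDerivAt (fun x => ζ (vec2 (c x) (d x)))
      (c' * fderiv ℝ ζ (vec2 (c s) (d s)) (EuclideanSpace.single 0 1) +
        d' * fderiv ℝ ζ (vec2 (c s) (d s)) (EuclideanSpace.single 1 1)) s := by
  have := (h.differentiable (vec2 (c s) (d s))).hasFDerivAt.comp_hasDerivAt s (hc.vec2 hd)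
  rw [vec2_eq_smul c' d', map_add, map_smul, map_smul] at this
  exact this

lemma hasCompactSupport_comp_vec2_left (h : TestFun Ω ζ) (s : ℝ) :
    HasCompactSupport fun t => ζ (vec2 s t) := by
  have hc : Continuous fun q : E2 => q 1 := by fun_prop
  refine HasCompactSupport.of_support_subset_isCompact (h.compact.isCompact.image hc)
    fun t ht => ⟨_, subset_tsupport _ ht, rfl⟩

lemma hasCompactSupport_comp_graph (h : TestFun Ω ζ) (v : ℝ → ℝ) :
    HasCompactSupport fun s => ζ (vec2 s (v s)) := by
  have hc : Continuous fun q : E2 => q 0 := by fun_prop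
  refine HasCompactSupport.of_support_subset_isCompact (h.compact.isCompact.image hc)
    fun t ht => ⟨_, subset_tsupport _ ht, rfl⟩

lemma contDiff_comp_vec2_left (h : TestFun Ω ζ) (s : ℝ) : ContDiff ℝ 1 fun t => ζ (vec2 s t) :=
  h.contDiff.comp (contDiff_const.vec2 contDiff_id)

lemma hasDerivAt_vertical (h : TestFun Ω ζ) (s t : ℝ) :
    HasDerivAt (fun t => ζ (vec2 s t))
      (fderiv ℝ ζ (vec2 s t) (EuclideanSpace.single 1 1)) t := by
  simpa using h.hasDerivAt_comp (hasDerivAt_const t s) (hasDerivAt_id t)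

lemma integral_Iic_vertical (h : TestFun Ω ζ) (s c : ℝ) :
    ∫ t in Iic c, fderiv ℝ ζ (vec2 s t) (EuclideanSpace.single 1 1) = ζ (vec2 s c) := by
  rw [← (h.hasCompactSupport_comp_vec2_left s).integral_Iic_deriv_eq
    (h.contDiff_comp_vec2_left s) c]
  exact integral_congr_ae (Eventually.of_forall fun t => (h.hasDerivAt_vertical s t).deriv.symm)

lemma integrable_fderiv_vertical (h : TestFun Ω ζ) (e : E2) (s : ℝ) :
    Integrable fun t => fderiv ℝ ζ (vec2 s t) e := by
  refine ((h.continuous_fderiv e).comp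
    (continuous_const.vec2 continuous_id)).integrable_of_hasCompactSupport ?_
  have hc : Continuous fun q : E2 => q 1 := by fun_prop
  refine HasCompactSupport.of_support_subset_isCompact ((h.compact_fderiv e).isCompact.image hc)
    fun t ht => ⟨_, subset_tsupport _ ht, rfl⟩

lemma _root_.integral_Ioi_zero_comp_sub_left (f : ℝ → ℝ) (c : ℝ) :
    ∫ r in Ioi 0, f (c - r) = ∫ t in Iic c, f t := by
  have h := integral_comp_neg_Ioi 0 fun x => f (c + x)
  simp only [← sub_eq_add_neg, neg_zero] at h
  rw [h, ← integral_indicator measurableSet_Iic, ← integral_indicator measurableSet_Iic,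
    ← integral_add_left_eq_self ((Iic c).indicator f) c]
  congr 1 with x
  simp [indicator, mem_Iic]

/-- The horizontal part of the Gauss-Green formula on the subgraph of a `C¹` function. -/
lemma integral_horizontal (h : TestFun Ω ζ) {v : ℝ → ℝ} (hv : ContDiff ℝ 1 v) :
    ∫ s, ∫ t in Iic (v s), fderiv ℝ ζ (vec2 s t) (EuclideanSpace.single 0 1) =
      - ∫ s, ζ (vec2 s (v s)) * deriv v s := by
  have hvd : ∀ s, HasDerivAt v (deriv v s) s := fun s =>
    (hv.differentiable (by norm_num) s).hasDerivAt
  have hvc : Continuous (deriv v) := hv.continuous_deriv (by norm_num)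
  let A : ℝ × ℝ → ℝ := fun q => fderiv ℝ ζ (vec2 q.1 (v q.1 - q.2)) (EuclideanSpace.single 0 1)
  let B : ℝ × ℝ → ℝ := fun q => fderiv ℝ ζ (vec2 q.1 (v q.1 - q.2)) (EuclideanSpace.single 1 1)
  have hsh : Continuous fun q : ℝ × ℝ => vec2 q.1 (v q.1 - q.2) :=
    continuous_fst.vec2 ((hv.continuous.comp continuous_fst).sub continuous_snd)
  have hAc : Continuous A := (h.continuous_fderiv _).comp hsh
  have hBc : Continuous B := (h.continuous_fderiv _).comp hsh
  have hAs : HasCompactSupport A := (h.compact_fderiv _).comp_shear hv.continuous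
  have hBs : HasCompactSupport B := (h.compact_fderiv _).comp_shear hv.continuous
  have hD : Integrable (fun q : ℝ × ℝ => A q + deriv v q.1 * B q) (volume.prod volume) :=
    (hAc.add ((hvc.comp continuous_fst).mul hBc)).integrable_of_hasCompactSupport
      (hAs.add hBs.mul_left)
  have hD' : Integrable (Function.uncurry fun s r => A (s, r) + deriv v s * B (s, r))
      (volume.prod (volume.restrict (Ioi 0))) := by
    rw [← Measure.restrict_univ (μ := (volume : Measure ℝ)), Measure.restrict_restrict_of_subset
      (subset_univ _), Measure.prod_restrict]
    exact hD.restrict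
  have hzero : ∫ s, ∫ r in Ioi 0, (A (s, r) + deriv v s * B (s, r)) = 0 := by
    rw [integral_integral_swap hD']
    refine integral_eq_zero_of_ae (Eventually.of_forall fun r => ?_)
    have hg : ∀ s, HasDerivAt (fun s => ζ (vec2 s (v s - r)))
        (A (s, r) + deriv v s * B (s, r)) s := fun s => by
      simpa using h.hasDerivAt_comp (hasDerivAt_id s) ((hvd s).sub_const r)
    have hcs := h.hasCompactSupport_comp_graph fun s => v s - r
    have hcd : ContDiff ℝ 1 fun s => ζ (vec2 s (v s - r)) :=
      h.contDiff.comp (contDiff_id.vec2 (hv.sub contDiff_const))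
    refine integral_eq_zero_of_hasDerivAt_of_integrable hg ?_
      (hcd.continuous.integrable_of_hasCompactSupport hcs)
    rw [← show deriv (fun s => ζ (vec2 s (v s - r))) = _ from funext fun s => (hg s).deriv]
    exact (hcd.continuous_deriv (by norm_num)).integrable_of_hasCompactSupport hcs.deriv
  have hAint : ∀ s, Integrable (fun r => A (s, r)) := fun s =>
    (h.integrable_fderiv_vertical _ s).comp_sub_left (v s)
  have hBint : ∀ s, Integrable (fun r => B (s, r)) := fun s =>
    (h.integrable_fderiv_vertical _ s).comp_sub_left (v s)
  have hinner : ∀ s, ∫ r in Ioi 0, (A (s, r) + deriv v s * B (s, r)) =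
      (∫ t in Iic (v s), fderiv ℝ ζ (vec2 s t) (EuclideanSpace.single 0 1)) +
        ζ (vec2 s (v s)) * deriv v s := fun s => by
    rw [integral_add (hAint s).restrict ((hBint s).restrict.const_mul _), integral_const_mul,
      mul_comm]
    congr 1
    · exact integral_Ioi_zero_comp_sub_left
        (fun t => fderiv ℝ ζ (vec2 s t) (EuclideanSpace.single 0 1)) (v s)
    · rw [← h.integral_Iic_vertical s (v s)]
      congr 1
      exact integral_Ioi_zero_comp_sub_left
        (fun t => fderiv ℝ ζ (vec2 s t) (EuclideanSpace.single 1 1)) (v s)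
  simp only [hinner] at hzero
  have hI2 : Integrable fun s => ζ (vec2 s (v s)) * deriv v s :=
    ((h.continuous.comp (continuous_id.vec2 hv.continuous)).mul
      hvc).integrable_of_hasCompactSupport (h.hasCompactSupport_comp_graph v).mul_right
  have hI1 : Integrable fun s =>
      ∫ t in Iic (v s), fderiv ℝ ζ (vec2 s t) (EuclideanSpace.single 0 1) := by
    have := hD'.integral_prod_left
    simp only [Function.uncurry, hinner] at this
    exact (this.sub hI2).congr (Eventually.of_forall fun s => add_sub_cancel_right _ _)
  rw [integral_add hI1 hI2] at hzero
  linarith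

end TestFun

open scoped Convolution in
/-- Mollification by a bump function. -/
def mollify (ρ : ContDiffBump (0 : ℝ)) (f : ℝ → ℝ) : ℝ → ℝ :=
  ρ.normed volume ⋆[ContinuousLinearMap.lsmul ℝ ℝ, volume] f

namespace mollify

variable (ρ : ContDiffBump (0 : ℝ)) {f : ℝ → ℝ}

lemma apply (f : ℝ → ℝ) (s : ℝ) : mollify ρ f s = ∫ t, ρ.normed volume t * f (s - t) := rfl

lemma apply_swap (f : ℝ → ℝ) (s : ℝ) : mollify ρ f s = ∫ t, ρ.normed volume (s - t) * f t :=
  convolution_lsmul_swap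

lemma contDiff (hf : LocallyIntegrable f) : ContDiff ℝ 1 (mollify ρ f) :=
  ρ.hasCompactSupport_normed.contDiff_convolution_left _ (n := 1) ρ.contDiff_normed hf

lemma hasCompactSupport (hf : HasCompactSupport f) : HasCompactSupport (mollify ρ f) :=
  ρ.hasCompactSupport_normed.convolution _ hf

lemma tsupport_subset (hf : HasCompactSupport f) :
    tsupport (mollify ρ f) ⊆ Metric.cthickening ρ.rOut (tsupport f) := by
  refine closure_minimal ?_ Metric.isClosed_cthickening
  refine (support_convolution_subset_swap _).trans ?_
  rw [ρ.support_normed_eq]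
  refine (Set.add_subset_add_right (subset_tsupport f)).trans ?_
  rw [← hf.isCompact.add_closedBall_zero ρ.rOut_pos.le]
  exact Set.add_subset_add_left Metric.ball_subset_closedBall

lemma abs_le {B : ℝ} (hf : ∀ s, |f s| ≤ B) (s : ℝ) : |mollify ρ f s| ≤ B := by
  have hi : Integrable fun t => ρ.normed volume t * B := ρ.integrable_normed.mul_const B
  rw [apply]
  refine (norm_integral_le_of_norm_le (f := fun t => ρ.normed volume t * f (s - t)) hi
    (Eventually.of_forall fun t => ?_)).trans_eq ?_
  · rw [norm_mul, Real.norm_of_nonneg (ρ.nonneg_normed t)]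
    exact mul_le_mul_of_nonneg_left (hf _) (ρ.nonneg_normed t)
  · rw [integral_mul_const, ρ.integral_normed, one_mul]

lemma integral_eq (hf : Integrable f) : ∫ s, mollify ρ f s = ∫ s, f s := by
  have := integral_convolution (ContinuousLinearMap.lsmul ℝ ℝ) (ρ.integrable_normed (μ := volume)) hf
  simpa [mollify, ρ.integral_normed] using this

lemma deriv_eq (hf : ContDiff ℝ 1 f) (hc : HasCompactSupport f) (s : ℝ) :
    deriv (mollify ρ f) s = mollify ρ (deriv f) s :=
  (hc.hasDerivAt_convolution_right _ ρ.continuous_normed.locallyIntegrable hf s).deriv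

lemma integral_mul_comm {u w : ℝ → ℝ} (hu : Integrable u) (hw : Integrable w) :
    ∫ s, u s * mollify ρ w s = ∫ s, mollify ρ u s * w s := by
  obtain ⟨C, hC⟩ := ρ.continuous_normed.bounded_above_of_compact_support
    (ρ.hasCompactSupport_normed (μ := volume))
  have hint : Integrable (Function.uncurry fun s t => u s * w t * ρ.normed volume (s - t))
      (volume.prod volume) :=
    (hu.mul_prod hw).mul_bdd (c := C)
      (ρ.continuous_normed.comp (continuous_fst.sub continuous_snd)).aestronglyMeasurable
      (Eventually.of_forall fun q => hC _)
  calc ∫ s, u s * mollify ρ w s = ∫ s, ∫ t, u s * w t * ρ.normed volume (s - t) := by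
        congr 1 with s
        rw [apply_swap, ← integral_const_mul]
        congr 1 with t
        ring
    _ = ∫ t, ∫ s, u s * w t * ρ.normed volume (s - t) := integral_integral_swap hint
    _ = _ := by
        congr 1 with t
        rw [apply_swap, ← integral_mul_const]
        congr 1 with s
        rw [← ρ.normed_neg, neg_sub]
        ring

end mollify

lemma IsAnisotropy.integral_le_one {φ : E2 → ℝ} (hφ : IsAnisotropy φ) {X : Type*}
    [MeasurableSpace X] {μ : Measure X} {r : X → ℝ} (hr : ∀ x, 0 ≤ r x) (hri : Integrable r μ)
    (hrm : Measurable r) (hr1 : ∫ x, r x ∂μ = 1) {W : X → E2} (hW : ∀ x, φ (W x) ≤ 1)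
    (hWi : Integrable (fun x => r x • W x) μ) : φ (∫ x, r x • W x ∂μ) ≤ 1 := by
  have hprob : IsProbabilityMeasure (μ.withDensity fun x => ENNReal.ofReal (r x)) := by
    constructor
    rw [withDensity_apply _ MeasurableSet.univ, Measure.restrict_univ,
      ← ofReal_integral_eq_lintegral_ofReal hri (Eventually.of_forall hr), hr1, ENNReal.ofReal_one]
  have hconv : Convex ℝ {x : E2 | φ x ≤ 1} := fun x hx y hy s t hs ht hst =>
    hφ.convex_combo hs ht hst.le hx hy
  have hcl : IsClosed {x : E2 | φ x ≤ 1} := isClosed_le hφ.continuous continuous_const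
  have hmr : Measurable fun x => ENNReal.ofReal (r x) := hrm.ennreal_ofReal
  have hlt : ∀ᵐ x ∂μ, ENNReal.ofReal (r x) < ⊤ :=
    Eventually.of_forall fun x => ENNReal.ofReal_lt_top
  have hi : Integrable W (μ.withDensity fun x => ENNReal.ofReal (r x)) := by
    rw [integrable_withDensity_iff_integrable_smul' hmr hlt]
    simpa only [ENNReal.toReal_ofReal (hr _)] using hWi
  have := hconv.integral_mem hcl (Eventually.of_forall hW) hi
  rw [integral_withDensity_eq_integral_toReal_smul hmr hlt] at this
  simp only [ENNReal.toReal_ofReal (hr _)] at this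
  exact this

lemma mollify.vec2_le_one {φ : E2 → ℝ} (hφ : IsAnisotropy φ) (ρ : ContDiffBump (0 : ℝ))
    {w₁ w₂ : ℝ → ℝ} (h₁ : Continuous w₁) (h₂ : Continuous w₂)
    (hw : ∀ s, φ (vec2 (w₁ s) (w₂ s)) ≤ 1) (s : ℝ) :
    φ (vec2 (mollify ρ w₁ s) (mollify ρ w₂ s)) ≤ 1 := by
  have hi : ∀ {w : ℝ → ℝ}, Continuous w → Integrable fun t => ρ.normed volume t * w (s - t) :=
    fun hw => (ρ.continuous_normed.mul
      (hw.comp (continuous_const.sub continuous_id))).integrable_of_hasCompactSupport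
      ρ.hasCompactSupport_normed.mul_right
  have e : vec2 (mollify ρ w₁ s) (mollify ρ w₂ s) =
      ∫ t, ρ.normed volume t • vec2 (w₁ (s - t)) (w₂ (s - t)) := by
    simp only [vec2_eq_smul, mollify.apply, smul_add, smul_smul]
    rw [integral_add ((hi h₁).smul_const _) ((hi h₂).smul_const _), integral_smul_const,
      integral_smul_const]
  rw [e]
  refine hφ.integral_le_one ρ.nonneg_normed ρ.integrable_normed ρ.continuous_normed.measurable
    ρ.integral_normed (fun t => hw _) ?_
  simp only [vec2_eq_smul, smul_add, smul_smul]
  exact ((hi h₁).smul_const _).add ((hi h₂).smul_const _)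

lemma le_aniArea {φ : E2 → ℝ} {u h₁ h₂ : ℝ → ℝ} {J : Set ℝ} (c₁ : ContDiff ℝ 1 h₁)
    (c₂ : ContDiff ℝ 1 h₂) (k₁ : HasCompactSupport h₁) (k₂ : HasCompactSupport h₂)
    (t₁ : tsupport h₁ ⊆ J) (t₂ : tsupport h₂ ⊆ J) (hle : ∀ s ∈ J, φ (vec2 (h₁ s) (h₂ s)) ≤ 1) :
    ENNReal.ofReal (∫ s in J, (u s * deriv h₁ s + h₂ s)) ≤ aniArea φ u J :=
  le_iSup_of_le h₁ <| le_iSup_of_le h₂ <| le_iSup_of_le c₁ <| le_iSup_of_le c₂ <|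
    le_iSup_of_le k₁ <| le_iSup_of_le k₂ <| le_iSup_of_le t₁ <| le_iSup_of_le t₂ <|
    le_iSup_of_le hle le_rfl

lemma ofReal_integral_mollify_le_aniArea {φ : E2 → ℝ} (hφ : IsAnisotropy φ)
    (ρ : ContDiffBump (0 : ℝ)) {I : Set ℝ} {u w₁ w₂ : ℝ → ℝ} (hu : Integrable u)
    (hu0 : ∀ s ∉ I, u s = 0) (c₁ : ContDiff ℝ 1 w₁) (c₂ : ContDiff ℝ 1 w₂)
    (k₁ : HasCompactSupport w₁) (k₂ : HasCompactSupport w₂)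
    (t₁ : Metric.cthickening ρ.rOut (tsupport w₁) ⊆ I)
    (t₂ : Metric.cthickening ρ.rOut (tsupport w₂) ⊆ I)
    (hw : ∀ s, φ (vec2 (w₁ s) (w₂ s)) ≤ 1) :
    ENNReal.ofReal (∫ s, (mollify ρ u s * deriv w₁ s + w₂ s)) ≤ aniArea φ u I := by
  refine le_of_eq_of_le ?_ (le_aniArea (u := u)
    (mollify.contDiff ρ c₁.continuous.locallyIntegrable)
    (mollify.contDiff ρ c₂.continuous.locallyIntegrable) (mollify.hasCompactSupport ρ k₁)
    (mollify.hasCompactSupport ρ k₂) ((mollify.tsupport_subset ρ k₁).trans t₁)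
    ((mollify.tsupport_subset ρ k₂).trans t₂)
    (fun s _ => mollify.vec2_le_one hφ ρ c₁.continuous c₂.continuous hw s))
  congr 1
  have hd : Continuous (deriv w₁) := c₁.continuous_deriv (by norm_num)
  have hdi : Integrable (deriv w₁) := hd.integrable_of_hasCompactSupport k₁.deriv
  have h2i : Integrable w₂ := c₂.continuous.integrable_of_hasCompactSupport k₂
  have hm2 : Integrable (mollify ρ w₂) :=
    (mollify.contDiff ρ c₂.continuous.locallyIntegrable).continuous.integrable_of_hasCompactSupport
      (mollify.hasCompactSupport ρ k₂)
  have hmd : Integrable fun s => u s * mollify ρ (deriv w₁) s := by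
    obtain ⟨C, hC⟩ := (hd.bounded_above_of_compact_support k₁.deriv)
    exact hu.mul_bdd (c := C)
      (mollify.contDiff ρ hd.locallyIntegrable).continuous.aestronglyMeasurable
      (Eventually.of_forall fun s => mollify.abs_le ρ hC s)
  have hmu : Integrable fun s => mollify ρ u s * deriv w₁ s :=
    ((mollify.contDiff ρ hu.locallyIntegrable).continuous.mul hd).integrable_of_hasCompactSupport
      k₁.deriv.mul_left
  rw [setIntegral_eq_integral_of_forall_compl_eq_zero]
  · simp only [mollify.deriv_eq ρ c₁ k₁]
    rw [integral_add hmu h2i, integral_add hmd hm2, mollify.integral_mul_comm ρ hu hdi,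
      mollify.integral_eq ρ h2i]
  · intro s hs
    rw [hu0 s hs, image_eq_zero_of_notMem_tsupport fun h =>
      hs (((mollify.tsupport_subset ρ k₂).trans t₂) h)]
    simp

/-- The integral of `m` along the vertical half-line below height `τ` over `s`. -/
def underInt (m : E2 → ℝ) (s τ : ℝ) : ℝ := ∫ t in Iic τ, m (vec2 s t)

lemma integral_eq_integral_vec2 (m : E2 → ℝ) : ∫ q, m q = ∫ z : ℝ × ℝ, m (vec2 z.1 z.2) := by
  rw [← measurePreserving_planeCoord.integral_comp' (fun z : ℝ × ℝ => m (vec2 z.1 z.2))]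
  congr 1 with q
  rw [planeCoord_apply, vec2_eta]

lemma integrable_comp_vec2 {m : E2 → ℝ} (hm : Integrable m) :
    Integrable (fun z : ℝ × ℝ => m (vec2 z.1 z.2)) (volume.prod volume) := by
  rw [← Measure.volume_eq_prod, ← measurePreserving_planeCoord.integrable_comp_emb
    planeCoord.measurableEmbedding]
  refine hm.congr (Eventually.of_forall fun q => ?_)
  simp only [Function.comp, planeCoord_apply, vec2_eta]

section underInt

variable {m : E2 → ℝ}

lemma HasCompactSupport.comp_vec2_left (h : HasCompactSupport m) (s : ℝ) :
    HasCompactSupport fun t => m (vec2 s t) := by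
  have hc : Continuous fun q : E2 => q 1 := by fun_prop
  refine HasCompactSupport.of_support_subset_isCompact (h.isCompact.image hc)
    fun t ht => ⟨_, subset_tsupport _ ht, rfl⟩

lemma integrable_comp_vec2_left (hc : Continuous m) (h : HasCompactSupport m) (s : ℝ) :
    Integrable fun t => m (vec2 s t) :=
  (hc.comp (continuous_const.vec2 continuous_id)).integrable_of_hasCompactSupport
    (h.comp_vec2_left s)

lemma abs_underInt_le (hc : Continuous m) (h : HasCompactSupport m) (s τ : ℝ) :
    |underInt m s τ| ≤ ∫ t, |m (vec2 s t)| := by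
  refine (norm_integral_le_integral_norm (fun t => m (vec2 s t))).trans ?_
  exact setIntegral_le_integral (integrable_comp_vec2_left hc h s).norm
    (Eventually.of_forall fun t => norm_nonneg _)

lemma integrable_integral_abs_vec2 (hc : Continuous m) (h : HasCompactSupport m) :
    Integrable fun s => ∫ t, |m (vec2 s t)| :=
  (integrable_comp_vec2 (hc.integrable_of_hasCompactSupport h)).norm.integral_prod_left

lemma continuous_underInt (hc : Continuous m) (h : HasCompactSupport m) (s : ℝ) :
    Continuous (underInt m s) := by
  have hi := integrable_comp_vec2_left hc h s
  have e : underInt m s = fun τ => (∫ t in Iic 0, m (vec2 s t)) + ∫ t in (0 : ℝ)..τ, m (vec2 s t) := by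
    ext τ
    rw [← intervalIntegral.integral_Iic_sub_Iic hi.integrableOn hi.integrableOn, underInt]
    ring
  rw [e]
  exact continuous_const.add (intervalIntegral.continuous_primitive
    (fun a b => hi.intervalIntegrable) 0)

lemma measurable_underInt_comp (hc : Continuous m) {v : ℝ → ℝ} (hv : Measurable v) :
    StronglyMeasurable fun s => underInt m s (v s) := by
  have hS : MeasurableSet {z : ℝ × ℝ | z.2 ≤ v z.1} :=
    measurableSet_le measurable_snd (hv.comp measurable_fst)
  have hm : Measurable fun z : ℝ × ℝ => m (vec2 z.1 z.2) :=
    (hc.comp (continuous_fst.vec2 continuous_snd)).measurable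
  have := ((hm.indicator hS).stronglyMeasurable).integral_prod_right'
    (ν := (volume : Measure ℝ))
  have e : (fun s => underInt m s (v s)) = fun s =>
      ∫ t, {z : ℝ × ℝ | z.2 ≤ v z.1}.indicator (fun z => m (vec2 z.1 z.2)) (s, t) := by
    ext s
    rw [underInt, ← integral_indicator measurableSet_Iic]
    rfl
  rw [e]
  exact this

lemma measurableSet_subg {I : Set ℝ} (hI : MeasurableSet I) {v : ℝ → ℝ} (hv : Measurable v) :
    MeasurableSet (subg I v) := by
  have h0 : Measurable fun q : E2 => q 0 := by fun_prop
  have h1 : Measurable fun q : E2 => q 1 := by fun_prop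
  exact (h0 hI).inter (measurableSet_lt h1 (hv.comp h0))

lemma integral_underInt_eq (hc : Continuous m) (h : HasCompactSupport m) {I : Set ℝ}
    (hI : MeasurableSet I) (hm0 : ∀ q, q 0 ∉ I → m q = 0) {v : ℝ → ℝ} (hv : Measurable v) :
    ∫ s, underInt m s (v s) = ∫ q in subg I v, m q := by
  have hS := measurableSet_subg hI hv
  have hint := integrable_comp_vec2 ((hc.integrable_of_hasCompactSupport h).indicator hS)
  rw [← integral_indicator hS, integral_eq_integral_vec2, Measure.volume_eq_prod,
    integral_prod _ hint]
  congr 1 with s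
  by_cases hs : s ∈ I
  · rw [underInt, integral_Iic_eq_integral_Iio, ← integral_indicator measurableSet_Iio]
    congr 1 with t
    simp [indicator, subg, hs]
  · have h0 : ∀ t, m (vec2 s t) = 0 := fun t => hm0 _ (by simpa using hs)
    simp [underInt, indicator, h0]

lemma tendsto_integral_underInt (hc : Continuous m) (h : HasCompactSupport m) {v : ℕ → ℝ → ℝ}
    {u : ℝ → ℝ} (hv : ∀ n, Measurable (v n))
    (hlim : ∀ᵐ s, Tendsto (fun n => v n s) atTop (𝓝 (u s))) :
    Tendsto (fun n => ∫ s, underInt m s (v n s)) atTop (𝓝 (∫ s, underInt m s (u s))) := by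
  refine tendsto_integral_of_dominated_convergence _
    (fun n => (measurable_underInt_comp hc (hv n)).aestronglyMeasurable)
    (integrable_integral_abs_vec2 hc h)
    (fun n => Eventually.of_forall fun s => abs_underInt_le hc h s _) ?_
  filter_upwards [hlim] with s hs
  exact ((continuous_underInt hc h s).tendsto _).comp hs

lemma integrable_underInt_comp (hc : Continuous m) (h : HasCompactSupport m) {v : ℝ → ℝ}
    (hv : Measurable v) : Integrable fun s => underInt m s (v s) :=
  (integrable_integral_abs_vec2 hc h).mono' (measurable_underInt_comp hc hv).aestronglyMeasurable
    (Eventually.of_forall fun s => abs_underInt_le hc h s _)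

end underInt

lemma TestFun.contDiff_comp_graph {Ω : Set E2} {ζ : E2 → ℝ} (h : TestFun Ω ζ) {v : ℝ → ℝ}
    (hv : ContDiff ℝ 1 v) : ContDiff ℝ 1 fun s => ζ (vec2 s (v s)) :=
  h.contDiff.comp (contDiff_id.vec2 hv)

/-- The divergence, with respect to the plane coordinates, of the field `(ζ₁, ζ₂)`. -/
def divPair (ζ₁ ζ₂ : E2 → ℝ) (q : E2) : ℝ :=
  fderiv ℝ ζ₁ q (EuclideanSpace.single 0 1) + fderiv ℝ ζ₂ q (EuclideanSpace.single 1 1)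

section divPair

variable {Ω : Set E2} {ζ₁ ζ₂ : E2 → ℝ}

lemma continuous_divPair (h₁ : TestFun Ω ζ₁) (h₂ : TestFun Ω ζ₂) : Continuous (divPair ζ₁ ζ₂) :=
  (h₁.continuous_fderiv _).add (h₂.continuous_fderiv _)

lemma hasCompactSupport_divPair (h₁ : TestFun Ω ζ₁) (h₂ : TestFun Ω ζ₂) :
    HasCompactSupport (divPair ζ₁ ζ₂) :=
  (h₁.compact_fderiv _).add (h₂.compact_fderiv _)

lemma divPair_eq_zero (h₁ : TestFun Ω ζ₁) (h₂ : TestFun Ω ζ₂) {q : E2} (hq : q ∉ Ω) :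
    divPair ζ₁ ζ₂ q = 0 := by
  have : ∀ {ζ : E2 → ℝ}, TestFun Ω ζ → fderiv ℝ ζ q = 0 := fun h =>
    image_eq_zero_of_notMem_tsupport fun h' => hq (h.subset (tsupport_fderiv_subset ℝ h'))
  simp [divPair, this h₁, this h₂]

lemma integral_underInt_divPair (h₁ : TestFun Ω ζ₁) (h₂ : TestFun Ω ζ₂) {v : ℝ → ℝ}
    (hv : ContDiff ℝ 1 v) : ∫ s, underInt (divPair ζ₁ ζ₂) s (v s) =
      ∫ s, (v s * deriv (fun s => ζ₁ (vec2 s (v s))) s + ζ₂ (vec2 s (v s))) := by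
  have hvc : Continuous (deriv v) := hv.continuous_deriv (by norm_num)
  have hk1 := h₁.contDiff_comp_graph hv
  have hk1c := h₁.hasCompactSupport_comp_graph v
  have hk1d : Continuous (deriv fun s => ζ₁ (vec2 s (v s))) := hk1.continuous_deriv (by norm_num)
  have hi2 : Integrable fun s => ζ₂ (vec2 s (v s)) :=
    (h₂.contDiff_comp_graph hv).continuous.integrable_of_hasCompactSupport
      (h₂.hasCompactSupport_comp_graph v)
  have hi1 : Integrable fun s => v s * deriv (fun s => ζ₁ (vec2 s (v s))) s :=
    (hv.continuous.mul hk1d).integrable_of_hasCompactSupport hk1c.deriv.mul_left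
  have hu : ∀ s, underInt (divPair ζ₁ ζ₂) s (v s) =
      underInt (fun q => fderiv ℝ ζ₁ q (EuclideanSpace.single 0 1)) s (v s) +
        ζ₂ (vec2 s (v s)) := fun s => by
    rw [← h₂.integral_Iic_vertical s (v s)]
    exact integral_add (h₁.integrable_fderiv_vertical _ s).restrict
      (h₂.integrable_fderiv_vertical _ s).restrict
  simp only [hu]
  rw [integral_add (integrable_underInt_comp (h₁.continuous_fderiv _) (h₁.compact_fderiv _)
    hv.continuous.measurable) hi2, integral_add hi1 hi2]
  congr 1
  refine (h₁.integral_horizontal hv).trans ?_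
  rw [integral_mul_deriv_eq_deriv_mul_of_integrable (u := v) (u' := deriv v)
    (v := fun s => ζ₁ (vec2 s (v s)))
    (fun s _ => (hv.differentiable (by norm_num) s).hasDerivAt)
    (fun s _ => (hk1.differentiable (by norm_num) s).hasDerivAt) hi1
    ((hvc.mul hk1.continuous).integrable_of_hasCompactSupport hk1c.mul_left)
    ((hv.continuous.mul hk1.continuous).integrable_of_hasCompactSupport hk1c.mul_left)]
  simp only [mul_comm]

end divPair

lemma TestFun.tsupport_comp_graph_subset {Ω : Set E2} {ζ : E2 → ℝ} (h : TestFun Ω ζ) (v : ℝ → ℝ) :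
    tsupport (fun s => ζ (vec2 s (v s))) ⊆ (fun q : E2 => q 0) '' tsupport ζ := by
  have hc : Continuous fun q : E2 => q 0 := by fun_prop
  exact closure_minimal (fun s hs => ⟨_, subset_tsupport _ hs, rfl⟩)
    (h.compact.isCompact.image hc).isClosed

/-- Lower semicontinuity bound: fields on the strip that only vary compactly in the vertical
direction are admissible competitors for the anisotropic area. -/
lemma ofReal_integral_add_divPair_le_aniArea {φ : E2 → ℝ} (hφ : IsAnisotropy φ) {I : Set ℝ}
    (hI : IsOpen I) {u : ℝ → ℝ} (hum : Measurable u) (hui : Integrable u) {B : ℝ}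
    (huB : ∀ s, |u s| ≤ B) (hu0 : ∀ s ∉ I, u s = 0) {h₁ h₂ : ℝ → ℝ} (c₁ : ContDiff ℝ 1 h₁)
    (c₂ : ContDiff ℝ 1 h₂) (k₁ : HasCompactSupport h₁) (k₂ : HasCompactSupport h₂)
    (t₁ : tsupport h₁ ⊆ I) (t₂ : tsupport h₂ ⊆ I) {ζ₁ ζ₂ : E2 → ℝ} (hζ₁ : TestFun (strip I) ζ₁)
    (hζ₂ : TestFun (strip I) ζ₂)
    (hle : ∀ q, φ (vec2 (h₁ (q 0) + ζ₁ q) (h₂ (q 0) + ζ₂ q)) ≤ 1) :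
    ENNReal.ofReal ((∫ s, (u s * deriv h₁ s + h₂ s)) + ∫ q in subg I u, divPair ζ₁ ζ₂ q) ≤
      aniArea φ u I := by
  have hpc : Continuous fun q : E2 => q 0 := by fun_prop
  let L : Set ℝ := (tsupport h₁ ∪ tsupport h₂) ∪
    ((fun q : E2 => q 0) '' tsupport ζ₁ ∪ (fun q : E2 => q 0) '' tsupport ζ₂)
  have hL : IsCompact L := (k₁.isCompact.union k₂.isCompact).union
    ((hζ₁.compact.isCompact.image hpc).union (hζ₂.compact.isCompact.image hpc))
  have hLI : L ⊆ I := by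
    refine union_subset (union_subset t₁ t₂) (union_subset ?_ ?_)
    · rintro _ ⟨q, hq, rfl⟩; exact hζ₁.subset hq
    · rintro _ ⟨q, hq, rfl⟩; exact hζ₂.subset hq
  obtain ⟨δ, hδ, hδI⟩ := hL.exists_cthickening_subset_open hI hLI
  have hr : ∀ n : ℕ, 0 < δ / (n + 1) := fun n => by positivity
  let ρ : ℕ → ContDiffBump (0 : ℝ) := fun n =>
    ⟨δ / (n + 1) / 2, δ / (n + 1), half_pos (hr n), half_lt_self (hr n)⟩
  have hρI : ∀ n, Metric.cthickening (ρ n).rOut L ⊆ I := fun n =>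
    (Metric.cthickening_mono (div_le_self hδ.le (by simp)) _).trans hδI
  let v : ℕ → ℝ → ℝ := fun n => mollify (ρ n) u
  have hv : ∀ n, ContDiff ℝ 1 (v n) := fun n => mollify.contDiff _ hui.locallyIntegrable
  have hlim : ∀ᵐ s, Tendsto (fun n => v n s) atTop (𝓝 (u s)) := by
    refine ContDiffBump.ae_convolution_tendsto_right_of_locallyIntegrable (K := 2) ?_ ?_
      hui.locallyIntegrable
    · simpa [ρ, div_eq_mul_one_div δ] using
        (tendsto_one_div_add_atTop_nhds_zero_nat (𝕜 := ℝ)).const_mul δ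
    · exact Eventually.of_forall fun n => by simp only [ρ]; linarith
  have hd₁ : Continuous (deriv h₁) := c₁.continuous_deriv (by norm_num)
  have hi₂ : Integrable h₂ := c₂.continuous.integrable_of_hasCompactSupport k₂
  have hm := continuous_divPair hζ₁ hζ₂
  have hmc := hasCompactSupport_divPair hζ₁ hζ₂
  have hbound : ∀ n, ENNReal.ofReal ((∫ s, (v n s * deriv h₁ s + h₂ s)) +
      ∫ s, underInt (divPair ζ₁ ζ₂) s (v n s)) ≤ aniArea φ u I := fun n => by
    have hk₁ := hζ₁.contDiff_comp_graph (hv n)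
    have hk₂ := hζ₂.contDiff_comp_graph (hv n)
    have hs₁ := hζ₁.hasCompactSupport_comp_graph (v n)
    have hs₂ := hζ₂.hasCompactSupport_comp_graph (v n)
    have hts₁ := hζ₁.tsupport_comp_graph_subset (v n)
    have hts₂ := hζ₂.tsupport_comp_graph_subset (v n)
    have := ofReal_integral_mollify_le_aniArea hφ (ρ n) hui hu0 (c₁.add hk₁) (c₂.add hk₂)
      (k₁.add hs₁) (k₂.add hs₂) ?_ ?_ (fun s => by simpa using hle (vec2 s (v n s)))
    · refine le_of_eq_of_le ?_ this
      rw [integral_underInt_divPair hζ₁ hζ₂ (hv n), ← integral_add]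
      · congr 2 with s
        rw [deriv_fun_add (c₁.differentiable (by norm_num) s) (hk₁.differentiable (by norm_num) s)]
        simp only [v]
        ring
      · exact (((hv n).continuous.mul hd₁).integrable_of_hasCompactSupport
          k₁.deriv.mul_left).add hi₂
      · exact (((hv n).continuous.mul (hk₁.continuous_deriv
          (by norm_num))).integrable_of_hasCompactSupport hs₁.deriv.mul_left).add
          (hk₂.continuous.integrable_of_hasCompactSupport hs₂)
    · refine (Metric.cthickening_subset_of_subset _ ?_).trans (hρI n)
      refine (tsupport_add _ _).trans (union_subset ?_ (hts₁.trans ?_))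
      · exact subset_union_left.trans subset_union_left
      · exact subset_union_left.trans subset_union_right
    · refine (Metric.cthickening_subset_of_subset _ ?_).trans (hρI n)
      refine (tsupport_add _ _).trans (union_subset ?_ (hts₂.trans ?_))
      · exact subset_union_right.trans subset_union_left
      · exact subset_union_right.trans subset_union_right
  have hl₁ : Tendsto (fun n => ∫ s, (v n s * deriv h₁ s + h₂ s)) atTop
      (𝓝 (∫ s, (u s * deriv h₁ s + h₂ s))) := by
    refine tendsto_integral_of_dominated_convergence (fun s => B * |deriv h₁ s| + |h₂ s|)
      (fun n => (((hv n).continuous.mul hd₁).add c₂.continuous).aestronglyMeasurable)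
      (((hd₁.integrable_of_hasCompactSupport k₁.deriv).norm.const_mul B).add hi₂.norm)
      (fun n => Eventually.of_forall fun s => ?_) ?_
    · refine (abs_add_le _ _).trans ?_
      rw [abs_mul]
      gcongr
      exact mollify.abs_le _ huB s
    · filter_upwards [hlim] with s hs
      exact (hs.mul_const _).add_const _
  have hl₂ := tendsto_integral_underInt hm hmc (fun n => (hv n).continuous.measurable) hlim
  rw [integral_underInt_eq hm hmc hI.measurableSet
    (fun q hq => divPair_eq_zero hζ₁ hζ₂ (Ω := strip I) hq) hum] at hl₂
  exact le_of_tendsto ((ENNReal.continuous_ofReal.tendsto _).comp (hl₁.add hl₂))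
    (Eventually.of_forall hbound)

lemma aniPer_congr_ae {E F : Set E2} (h : E =ᵐ[volume] F) (φ : E2 → ℝ) (Ω : Set E2) :
    aniPer φ E Ω = aniPer φ F Ω := by
  have hn : ∀ x, IsOuterNormalAt E x = IsOuterNormalAt F x := fun x => by
    ext n
    rw [isOuterNormalAt_iff, isOuterNormalAt_iff]
    have : ∀ r, volume ((E ∆ halfPlane x n) ∩ Metric.ball x r) =
        volume ((F ∆ halfPlane x n) ∩ Metric.ball x r) := fun r =>
      measure_congr (ae_eq_set_inter (ae_eq_set_symmDiff h ae_eq_rfl) ae_eq_rfl)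
    simp only [this]
  have hr : redBoundary E = redBoundary F := by
    ext x
    simp only [redBoundary, hn]
  have hg : genNormal E = genNormal F := by
    ext1 x
    unfold genNormal
    rw [hn x]
  rw [aniPer, aniPer, hr, hg]

lemma quasiMeasurePreserving_coord_zero :
    Measure.QuasiMeasurePreserving (fun q : E2 => q 0) volume volume :=
  Measure.quasiMeasurePreserving_fst.comp
    (measurePreserving_planeCoord.quasiMeasurePreserving)

lemma subg_ae_eq {I : Set ℝ} (hI : MeasurableSet I) {u v : ℝ → ℝ}
    (h : ∀ᵐ s ∂volume.restrict I, u s = v s) : subg I u =ᵐ[volume] subg I v := by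
  rw [ae_restrict_iff' hI] at h
  filter_upwards [quasiMeasurePreserving_coord_zero.ae h] with q hq
  refine propext (and_congr_right fun hqI => ?_)
  rw [hq hqI]

lemma aniArea_congr_ae {J : Set ℝ} {u v : ℝ → ℝ} (h : ∀ᵐ s ∂volume.restrict J, u s = v s)
    (φ : E2 → ℝ) : aniArea φ u J = aniArea φ v J := by
  have : ∀ h₁ h₂ : ℝ → ℝ, ∫ s in J, (u s * deriv h₁ s + h₂ s) =
      ∫ s in J, (v s * deriv h₁ s + h₂ s) := fun h₁ h₂ => by
    refine integral_congr_ae ?_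
    filter_upwards [h] with s hs
    rw [hs]
  simp only [aniArea, this]

lemma Gfun_congr_ae {I : Set ℝ} {u v g k : ℝ → ℝ} (h : ∀ᵐ s ∂volume.restrict I, u s = v s)
    (hg : ∀ᵐ s ∂volume.restrict I, g s = k s) (φ : E2 → ℝ) (p : ℝ) :
    Gfun φ p g I u = Gfun φ p k I v := by
  rw [Gfun, Gfun, aniArea_congr_ae h]
  congr 1
  refine lintegral_congr_ae ?_
  filter_upwards [h, hg] with s hs hs'
  rw [hs, hs']

lemma exists_measurable_bounded_rep {I : Set ℝ} (hI : MeasurableSet I) {u : ℝ → ℝ}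
    (hu : AEStronglyMeasurable u (volume.restrict I)) (hb : supNorm u I < ⊤) :
    ∃ v : ℝ → ℝ, Measurable v ∧ (∀ s, |v s| ≤ (supNorm u I).toReal) ∧ (∀ s ∉ I, v s = 0) ∧
      ∀ᵐ s ∂volume.restrict I, u s = v s := by
  set B := (supNorm u I).toReal with hB
  have hB0 : 0 ≤ B := ENNReal.toReal_nonneg
  have hle : ∀ᵐ s ∂volume.restrict I, |u s| ≤ B := by
    filter_upwards [ae_le_essSup (f := fun s => (‖u s‖₊ : ℝ≥0∞))] with s hs
    have := ENNReal.toReal_mono hb.ne hs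
    simpa using this
  refine ⟨I.indicator fun s => max (-B) (min B (hu.mk u s)),
    (measurable_const.max (measurable_const.min hu.stronglyMeasurable_mk.measurable)).indicator hI,
    fun s => ?_, fun s hs => indicator_of_notMem hs _, ?_⟩
  · by_cases hs : s ∈ I
    · rw [indicator_of_mem hs, abs_le]
      exact ⟨le_max_left _ _, max_le (by linarith) (min_le_left _ _)⟩
    · rw [indicator_of_notMem hs, abs_zero]
      exact hB0
  · filter_upwards [hle, hu.ae_eq_mk, ae_restrict_mem hI] with s hs hm hsI
    rw [indicator_of_mem hsI, ← hm, min_eq_right (abs_le.mp hs).2, max_eq_right (abs_le.mp hs).1]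

lemma integrable_of_measurable_of_bounded {I : Set ℝ} (hI : volume I < ⊤) {u : ℝ → ℝ}
    (hu : Measurable u) {B : ℝ} (hB : ∀ s, |u s| ≤ B) (h0 : ∀ s ∉ I, u s = 0) : Integrable u := by
  refine (integrableOn_iff_integrable_of_support_subset (s := I) fun s hs => ?_).mp ?_
  · by_contra h
    exact hs (h0 s h)
  · exact Measure.integrableOn_of_bounded hI.ne hu.aestronglyMeasurable
      (Eventually.of_forall hB)

lemma mul_rpow_sub_one_mul_sub_ge {A B p : ℝ} (hB : 0 ≤ B) (hAB : B ≤ A) (hp : 1 ≤ p) :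
    A ^ p - B ^ p ≤ p * A ^ (p - 1) * (A - B) := by
  rcases (hB.trans hAB).eq_or_lt with h | hA
  · have : B = 0 := le_antisymm (h ▸ hAB) hB
    simp [← h, this]
  · have h1 := one_add_mul_self_le_rpow_one_add (s := B / A - 1)
      (by linarith [div_nonneg hB hA.le]) hp
    have h2 : B ^ p = A ^ p * (1 + (B / A - 1)) ^ p := by
      rw [← Real.mul_rpow hA.le (by linarith [div_nonneg hB hA.le])]
      congr 1
      field_simp
      ring
    have h3 : A ^ p = A ^ (p - 1) * A := by
      rw [← Real.rpow_add_one hA.ne', sub_add_cancel]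
    have h4 := mul_le_mul_of_nonneg_left h1 (Real.rpow_nonneg hA.le p)
    rw [← h2] at h4
    have h5 : A ^ p * (1 + p * (B / A - 1)) = A ^ p - p * A ^ (p - 1) * (A - B) := by
      rw [h3]
      field_simp
      ring
    linarith

/-- The pointwise comparison of fidelity terms under a perturbation `w` of the height `x` that
comes from a modification of the subgraph at heights in `(-γ, γ)`. -/
lemma abs_sub_rpow_le_of_height_bounds {x y w γ M p : ℝ} (hp : 1 ≤ p) (hy : |y| ≤ M)
    (hγ : 2 * M < γ) (hw₁ : w ≤ max (γ - max x (-γ)) 0) (hw₂ : -max (min x γ + γ) 0 ≤ w) :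
    |x + w - y| ^ p ≤ |x - y| ^ p + p * (γ + M) ^ (p - 1) * |w| := by
  have hM : 0 ≤ M := (abs_nonneg y).trans hy
  have hΛ : 0 ≤ p * (γ + M) ^ (p - 1) :=
    mul_nonneg (by linarith) (Real.rpow_nonneg (by linarith) _)
  have hkey : |x + w - y| ≤ |x - y| ∨ |x + w - y| ≤ γ + M := by
    obtain ⟨hy1, hy2⟩ := abs_le.mp hy
    rcases le_or_gt x γ with h1 | h1
    · rcases le_or_gt (-γ) x with h2 | h2
      · right
        rw [max_eq_left h2, max_eq_left (by linarith)] at hw₁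
        rw [min_eq_left h1, max_eq_left (by linarith)] at hw₂
        rw [abs_le]
        constructor <;> linarith
      · rw [max_eq_right h2.le, max_eq_left (by linarith)] at hw₁
        rw [min_eq_left h1, max_eq_right (by linarith)] at hw₂
        rcases le_or_gt (x + w - y) 0 with h3 | h3
        · left
          rw [abs_of_nonpos h3, abs_of_nonpos (by linarith)]
          linarith
        · right
          rw [abs_of_pos h3]
          linarith
    · rw [max_eq_left (by linarith : -γ ≤ x), max_eq_right (by linarith)] at hw₁
      rw [min_eq_right h1.le, max_eq_left (by linarith)] at hw₂
      rcases le_or_gt 0 (x + w - y) with h3 | h3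
      · left
        rw [abs_of_nonneg h3, abs_of_nonneg (by linarith)]
        linarith
      · right
        rw [abs_of_neg h3]
        linarith
  rcases le_total |x + w - y| |x - y| with h | h
  · have := Real.rpow_le_rpow (abs_nonneg _) h (by linarith : 0 ≤ p)
    linarith [mul_nonneg hΛ (abs_nonneg w)]
  · have hle : |x + w - y| ≤ γ + M ∨ |x + w - y| = |x - y| :=
      hkey.elim (fun h' => Or.inr (le_antisymm h' h)) Or.inl
    rcases hle with hle | heq
    · have h1 := mul_rpow_sub_one_mul_sub_ge (abs_nonneg (x - y)) h hp
      have h2 : |x + w - y| ^ (p - 1) ≤ (γ + M) ^ (p - 1) :=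
        Real.rpow_le_rpow (abs_nonneg _) hle (by linarith)
      have h3 : |x + w - y| - |x - y| ≤ |w| := by
        have := abs_sub_abs_le_abs_sub (x + w - y) (x - y)
        rwa [show x + w - y - (x - y) = w by ring] at this
      have h4 : p * |x + w - y| ^ (p - 1) * (|x + w - y| - |x - y|) ≤
          p * (γ + M) ^ (p - 1) * |w| :=
        mul_le_mul (by gcongr) h3 (by linarith) hΛ
      linarith
    · rw [heq]
      linarith [mul_nonneg hΛ (abs_nonneg w)]

lemma measurePreserving_vec2 :
    MeasurePreserving (fun z : ℝ × ℝ => vec2 z.1 z.2) (volume.prod volume) volume := by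
  have e : (fun z : ℝ × ℝ => vec2 z.1 z.2) = planeCoord.symm := by
    ext1 z
    rw [MeasurableEquiv.eq_symm_apply, planeCoord_vec2]
  rw [e, ← Measure.volume_eq_prod]
  exact measurePreserving_planeCoord.symm

lemma ae_ae_vec2 {P : E2 → Prop} (h : ∀ᵐ q, P q) : ∀ᵐ s : ℝ, ∀ᵐ t : ℝ, P (vec2 s t) :=
  Measure.ae_ae_of_ae_prod (measurePreserving_vec2.quasiMeasurePreserving.ae h)

/-- The difference of the characteristic functions of `F` and `E`. -/
def charDiff (E F : Set E2) (q : E2) : ℝ := F.indicator 1 q - E.indicator 1 q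

/-- The change of the length of the vertical slices when passing from `E` to `F`. -/
def sliceShift (E F : Set E2) (s : ℝ) : ℝ := ∫ t, charDiff E F (vec2 s t)

section slices

variable {E F : Set E2}

lemma measurable_charDiff (hE : MeasurableSet E) (hF : MeasurableSet F) :
    Measurable (charDiff E F) :=
  (measurable_one.indicator hF).sub (measurable_one.indicator hE)

lemma enorm_charDiff (q : E2) : ‖charDiff E F q‖ₑ = (E ∆ F).indicator 1 q := by
  by_cases h1 : q ∈ E <;> by_cases h2 : q ∈ F <;> simp [charDiff, h1, h2, mem_symmDiff]

lemma charDiff_eq_zero {q : E2} (h : q ∈ E ↔ q ∈ F) : charDiff E F q = 0 := by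
  by_cases h1 : q ∈ E
  · simp [charDiff, h1, h.mp h1]
  · simp [charDiff, h1, mt h.mpr h1]

lemma lintegral_enorm_charDiff (hE : MeasurableSet E) (hF : MeasurableSet F) :
    ∫⁻ q, ‖charDiff E F q‖ₑ = volume (E ∆ F) := by
  simp only [enorm_charDiff]
  exact lintegral_indicator_one (hE.symmDiff hF)

lemma integrable_charDiff (hE : MeasurableSet E) (hF : MeasurableSet F)
    (hfin : volume (E ∆ F) < ⊤) : Integrable (charDiff E F) :=
  ⟨(measurable_charDiff hE hF).aestronglyMeasurable, by
    rwa [HasFiniteIntegral, lintegral_enorm_charDiff hE hF]⟩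

lemma integrable_sliceShift (hE : MeasurableSet E) (hF : MeasurableSet F)
    (hfin : volume (E ∆ F) < ⊤) : Integrable (sliceShift E F) :=
  (integrable_comp_vec2 (integrable_charDiff hE hF hfin)).integral_prod_left

lemma lintegral_abs_sliceShift_le (hE : MeasurableSet E) (hF : MeasurableSet F) :
    ∫⁻ s, ENNReal.ofReal |sliceShift E F s| ≤ volume (E ∆ F) := by
  calc ∫⁻ s, ENNReal.ofReal |sliceShift E F s|
      ≤ ∫⁻ s, ∫⁻ t, ‖charDiff E F (vec2 s t)‖ₑ := lintegral_mono fun s => by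
        rw [← Real.enorm_eq_ofReal_abs]
        exact enorm_integral_le_lintegral_enorm _
    _ = ∫⁻ z : ℝ × ℝ, ‖charDiff E F (vec2 z.1 z.2)‖ₑ ∂(volume.prod volume) :=
        (lintegral_prod (fun z : ℝ × ℝ => ‖charDiff E F (vec2 z.1 z.2)‖ₑ)
          ((measurable_charDiff hE hF).enorm.comp
            measurePreserving_vec2.measurable).aemeasurable).symm
    _ = ∫⁻ q, ‖charDiff E F q‖ₑ :=
        measurePreserving_vec2.lintegral_comp (measurable_charDiff hE hF).enorm
    _ = volume (E ∆ F) := lintegral_enorm_charDiff hE hF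

variable {I : Set ℝ} {u : ℝ → ℝ} {γ : ℝ}

lemma ae_sliceShift_bounds (hI : MeasurableSet I) (hu : Measurable u) (hF : MeasurableSet F)
    (hfin : volume (subg I u ∆ F) < ⊤)
    (hEF : ∀ᵐ q, q ∉ box I (Ioo (-γ) γ) → (q ∈ subg I u ↔ q ∈ F)) :
    ∀ᵐ s, sliceShift (subg I u) F s ≤ max (γ - max (u s) (-γ)) 0 ∧
      -max (min (u s) γ + γ) 0 ≤ sliceShift (subg I u) F s := by
  have hE := measurableSet_subg hI hu
  filter_upwards [ae_ae_vec2 hEF,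
    (integrable_comp_vec2 (integrable_charDiff hE hF hfin)).prod_right_ae] with s hs hi
  constructor
  · rw [← Real.volume_real_Ico, ← integral_indicator_one measurableSet_Ico]
    refine integral_mono_ae hi ((integrable_indicator_iff measurableSet_Ico).mpr
      (integrableOn_const (by simp))) ?_
    filter_upwards [hs] with t ht
    by_cases hb : vec2 s t ∈ box I (Ioo (-γ) γ)
    · simp only [box, Set.mem_ofPred_eq, vec2_zero, vec2_one, mem_Ioo] at hb
      by_cases hut : t < u s
      · have : vec2 s t ∈ subg I u := by simp [subg, hb.1, hut]
        simp only [charDiff, indicator_of_mem this, Pi.one_apply]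
        have h1 : F.indicator (1 : E2 → ℝ) (vec2 s t) ≤ 1 :=
          indicator_le_self' (fun _ _ => zero_le_one) _
        linarith [indicator_nonneg (s := Ico (max (u s) (-γ)) γ) (f := (1 : ℝ → ℝ))
          (fun _ _ => zero_le_one) t]
      · have h2 : t ∈ Ico (max (u s) (-γ)) γ :=
          ⟨max_le (not_lt.mp hut) hb.2.1.le, hb.2.2⟩
        rw [indicator_of_mem h2]
        simp only [charDiff, Pi.one_apply]
        have h1 : F.indicator (1 : E2 → ℝ) (vec2 s t) ≤ 1 :=
          indicator_le_self' (fun _ _ => zero_le_one) _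
        linarith [indicator_nonneg (s := subg I u) (f := (1 : E2 → ℝ))
          (fun _ _ => zero_le_one) (vec2 s t)]
    · rw [charDiff_eq_zero (ht hb)]
      exact indicator_nonneg (fun _ _ => zero_le_one) _
  · rw [neg_le, ← sub_neg_eq_add, ← Real.volume_real_Ioo,
      ← integral_indicator_one measurableSet_Ioo, sliceShift, ← integral_neg]
    refine integral_mono_ae hi.neg ((integrable_indicator_iff measurableSet_Ioo).mpr
      (integrableOn_const (by simp))) ?_
    filter_upwards [hs] with t ht
    by_cases hb : vec2 s t ∈ box I (Ioo (-γ) γ)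
    · simp only [box, Set.mem_ofPred_eq, vec2_zero, vec2_one, mem_Ioo] at hb
      have h1 : (0 : ℝ) ≤ F.indicator (1 : E2 → ℝ) (vec2 s t) :=
        indicator_nonneg (fun _ _ => zero_le_one) _
      by_cases hut : t < u s
      · have h2 : t ∈ Ioo (-γ) (min (u s) γ) := ⟨hb.2.1, lt_min hut hb.2.2⟩
        rw [indicator_of_mem h2]
        have h3 : (subg I u).indicator (1 : E2 → ℝ) (vec2 s t) ≤ 1 :=
          indicator_le_self' (fun _ _ => zero_le_one) _
        simp only [charDiff, Pi.one_apply]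
        linarith
      · have : vec2 s t ∉ subg I u := by simp [subg, hut]
        simp only [charDiff, indicator_of_notMem this]
        linarith [indicator_nonneg (s := Ioo (-γ) (min (u s) γ)) (f := (1 : ℝ → ℝ))
          (fun _ _ => zero_le_one) t]
    · rw [charDiff_eq_zero (ht hb), neg_zero]
      exact indicator_nonneg (fun _ _ => zero_le_one) _

lemma lintegral_fidelity_le (hI : MeasurableSet I) (hu : Measurable u) (hF : MeasurableSet F)
    (hfin : volume (subg I u ∆ F) < ⊤)
    (hEF : ∀ᵐ q, q ∉ box I (Ioo (-γ) γ) → (q ∈ subg I u ↔ q ∈ F)) {g : ℝ → ℝ} {M p : ℝ}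
    (hp : 1 ≤ p) (hg : ∀ s, |g s| ≤ M) (hγ : 2 * M < γ) :
    ∫⁻ s in I, ENNReal.ofReal (|u s + sliceShift (subg I u) F s - g s| ^ p) ≤
      (∫⁻ s in I, ENNReal.ofReal (|u s - g s| ^ p)) +
        ENNReal.ofReal (p * (γ + M) ^ (p - 1)) * volume (subg I u ∆ F) := by
  have hE := measurableSet_subg hI hu
  have hM : 0 ≤ M := (abs_nonneg _).trans (hg 0)
  have hΛ : 0 ≤ p * (γ + M) ^ (p - 1) :=
    mul_nonneg (by linarith) (Real.rpow_nonneg (by linarith) _)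
  have hw := (integrable_sliceShift hE hF hfin).aestronglyMeasurable.aemeasurable.abs.ennreal_ofReal
  calc ∫⁻ s in I, ENNReal.ofReal (|u s + sliceShift (subg I u) F s - g s| ^ p)
      ≤ ∫⁻ s in I, (ENNReal.ofReal (|u s - g s| ^ p) + ENNReal.ofReal (p * (γ + M) ^ (p - 1)) *
          ENNReal.ofReal |sliceShift (subg I u) F s|) := by
        refine lintegral_mono_ae (ae_restrict_of_ae ?_)
        filter_upwards [ae_sliceShift_bounds hI hu hF hfin hEF] with s hs
        rw [← ENNReal.ofReal_mul hΛ, ← ENNReal.ofReal_add (by positivity)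
          (mul_nonneg hΛ (abs_nonneg _))]
        exact ENNReal.ofReal_le_ofReal
          (abs_sub_rpow_le_of_height_bounds hp (hg s) hγ hs.1 hs.2)
    _ = (∫⁻ s in I, ENNReal.ofReal (|u s - g s| ^ p)) + ENNReal.ofReal (p * (γ + M) ^ (p - 1)) *
          ∫⁻ s in I, ENNReal.ofReal |sliceShift (subg I u) F s| := by
        rw [lintegral_add_right' _ (hw.restrict.const_mul _),
          lintegral_const_mul' _ _ ENNReal.ofReal_ne_top]
    _ ≤ _ := by
        gcongr
        exact (setLIntegral_le_lintegral _ _).trans (lintegral_abs_sliceShift_le hE hF)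

/-- Fubini for the divergence of a vector field that depends only on the first variable near
`E ∆ F`. -/
lemma integral_sliceShift_mul (hE : MeasurableSet E) (hF : MeasurableSet F)
    (hfin : volume (E ∆ F) < ⊤) {k : ℝ → ℝ} {m : E2 → ℝ} (hm : Integrable m)
    (hb : ∃ C, ∀ q, |m q| ≤ C) (hmk : ∀ᵐ q, charDiff E F q * m q = charDiff E F q * k (q 0)) :
    ∫ s, sliceShift E F s * k s = (∫ q in F, m q) - ∫ q in E, m q := by
  obtain ⟨C, hC⟩ := hb
  have hi : Integrable fun q => charDiff E F q * m q :=
    (integrable_charDiff hE hF hfin).mul_bdd hm.aestronglyMeasurable (Eventually.of_forall hC)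
  have h1 : ∫ q, charDiff E F q * m q = (∫ q in F, m q) - ∫ q in E, m q := by
    rw [← integral_indicator hF, ← integral_indicator hE,
      ← integral_sub (hm.indicator hF) (hm.indicator hE)]
    congr 1 with q
    by_cases h1 : q ∈ E <;> by_cases h2 : q ∈ F <;> simp [charDiff, h1, h2]
  rw [← h1, integral_eq_integral_vec2, Measure.volume_eq_prod,
    integral_prod _ (integrable_comp_vec2 hi)]
  refine integral_congr_ae ?_
  filter_upwards [ae_ae_vec2 hmk] with s hs
  rw [sliceShift, ← integral_mul_const]
  refine integral_congr_ae ?_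
  filter_upwards [hs] with t ht
  rw [ht, vec2_zero]

end slices

section divPair

variable {Ω : Set E2} {ζ₁ ζ₂ ξ₁ ξ₂ : E2 → ℝ}

lemma integrable_divPair (h₁ : TestFun Ω ζ₁) (h₂ : TestFun Ω ζ₂) : Integrable (divPair ζ₁ ζ₂) :=
  (h₁.integrable_fderiv _).add (h₂.integrable_fderiv _)

lemma divPair_add (h₁ : TestFun Ω ζ₁) (h₂ : TestFun Ω ζ₂) (k₁ : TestFun Ω ξ₁)
    (k₂ : TestFun Ω ξ₂) (q : E2) : divPair (fun x => ζ₁ x + ξ₁ x) (fun x => ζ₂ x + ξ₂ x) q =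
      divPair ζ₁ ζ₂ q + divPair ξ₁ ξ₂ q := by
  unfold divPair
  rw [fderiv_fun_add (h₁.differentiable q) (k₁.differentiable q),
    fderiv_fun_add (h₂.differentiable q) (k₂.differentiable q), add_apply, add_apply]
  ring

lemma divPair_const_mul (h₁ : TestFun Ω ζ₁) (h₂ : TestFun Ω ζ₂) (c : ℝ) (q : E2) :
    divPair (fun x => c * ζ₁ x) (fun x => c * ζ₂ x) q = c * divPair ζ₁ ζ₂ q := by
  unfold divPair
  rw [fderiv_const_mul (h₁.differentiable q), fderiv_const_mul (h₂.differentiable q), smul_apply,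
    smul_apply, smul_eq_mul, smul_eq_mul]
  ring

lemma divPair_components {T : E2 → E2} (hT : ContDiff ℝ 1 T) (q : E2) :
    divPair (fun x => T x 0) (fun x => T x 1) q = div2 T q := by
  rw [div2_eq_sum hT, Fin.sum_univ_two, divPair]

lemma div2_vec2 (h₁ : TestFun Ω ζ₁) (h₂ : TestFun Ω ζ₂) (q : E2) :
    div2 (fun x => vec2 (ζ₁ x) (ζ₂ x)) q = divPair ζ₁ ζ₂ q := by
  rw [← divPair_components (h₁.contDiff.vec2 h₂.contDiff)]
  simp only [vec2_zero, vec2_one]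

lemma tsupport_vec2_subset (ζ₁ ζ₂ : E2 → ℝ) :
    tsupport (fun x => vec2 (ζ₁ x) (ζ₂ x)) ⊆ tsupport ζ₁ ∪ tsupport ζ₂ := by
  refine closure_minimal (fun x hx => ?_) ((isClosed_tsupport _).union (isClosed_tsupport _))
  by_contra h
  rw [mem_union, not_or] at h
  refine hx ?_
  simp only [image_eq_zero_of_notMem_tsupport h.1, image_eq_zero_of_notMem_tsupport h.2]
  ext i; fin_cases i <;> simp

lemma testField_vec2 {φ : E2 → ℝ} (h₁ : TestFun Ω ζ₁) (h₂ : TestFun Ω ζ₂)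
    (hle : ∀ x, φ (vec2 (ζ₁ x) (ζ₂ x)) ≤ 1) : TestField φ Ω fun x => vec2 (ζ₁ x) (ζ₂ x) where
  contDiff := h₁.contDiff.vec2 h₂.contDiff
  compact := (h₁.compact.isCompact.union h₂.compact.isCompact).of_isClosed_subset
    (isClosed_tsupport _) (tsupport_vec2_subset ζ₁ ζ₂)
  subset := (tsupport_vec2_subset ζ₁ ζ₂).trans (union_subset h₁.subset h₂.subset)
  le_one := hle

lemma vec2_zero_zero : vec2 0 0 = 0 := by
  ext i; fin_cases i <;> simp

lemma smul_vec2 (c x y : ℝ) : c • vec2 x y = vec2 (c * x) (c * y) := by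
  ext i; fin_cases i <;> simp

lemma vec2_add_vec2 (x y x' y' : ℝ) : vec2 x y + vec2 x' y' = vec2 (x + x') (y + y') := by
  ext i; fin_cases i <;> simp

lemma contDiff_coord (i : Fin 2) : ContDiff ℝ 1 fun q : E2 => q i :=
  (EuclideanSpace.proj (𝕜 := ℝ) i).contDiff

lemma divPair_comp_coord_zero {h₁ h₂ : ℝ → ℝ} (c₁ : ContDiff ℝ 1 h₁) (c₂ : ContDiff ℝ 1 h₂)
    (q : E2) : divPair (fun x => h₁ (x 0)) (fun x => h₂ (x 0)) q = deriv h₁ (q 0) := by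
  have h0 : HasFDerivAt (fun x : E2 => x 0) (EuclideanSpace.proj (𝕜 := ℝ) (0 : Fin 2)) q :=
    (EuclideanSpace.proj (𝕜 := ℝ) (0 : Fin 2)).hasFDerivAt
  have e : ∀ h : ℝ → ℝ, ContDiff ℝ 1 h → fderiv ℝ (fun x : E2 => h (x 0)) q =
      deriv h (q 0) • EuclideanSpace.proj (𝕜 := ℝ) (0 : Fin 2) := fun h hc =>
    ((hc.differentiable (by norm_num) (q 0)).hasDerivAt.comp_hasFDerivAt q h0).fderiv
  rw [divPair, e h₁ c₁, e h₂ c₂]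
  simp

lemma divPair_congr {q : E2} (h₁ : ζ₁ =ᶠ[𝓝 q] ξ₁) (h₂ : ζ₂ =ᶠ[𝓝 q] ξ₂) :
    divPair ζ₁ ζ₂ q = divPair ξ₁ ξ₂ q := by
  rw [divPair, divPair, h₁.fderiv_eq, h₂.fderiv_eq]

end divPair

section finiteness

variable {φ : E2 → ℝ} {I : Set ℝ}

lemma aniArea_zero_le (hφ : IsAnisotropy φ) (hI : volume I < ⊤) :
    aniArea φ (fun _ => 0) I < ⊤ := by
  obtain ⟨c, hc, hb⟩ := hφ.exists_bounds
  refine lt_of_le_of_lt (b := ENNReal.ofReal (c⁻¹ * volume.real I)) ?_ ENNReal.ofReal_lt_top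
  unfold aniArea
  refine iSup_le fun h₁ => iSup_le fun h₂ => iSup_le fun _ => iSup_le fun _ => iSup_le fun _ =>
    iSup_le fun _ => iSup_le fun _ => iSup_le fun _ => iSup_le fun hle =>
    ENNReal.ofReal_le_ofReal ?_
  refine (Real.le_norm_self _).trans (norm_setIntegral_le_of_norm_le_const hI fun s hs => ?_)
  have h1 : ‖vec2 (h₁ s) (h₂ s)‖ ≤ c⁻¹ := by
    rw [← one_div, le_div_iff₀ hc, mul_comm]
    exact (hb _).1.trans (hle s hs)
  have h2 := (PiLp.norm_apply_le (vec2 (h₁ s) (h₂ s)) 1).trans h1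
  simpa using h2

lemma Gfun_zero_lt_top (hφ : IsAnisotropy φ) (hI : volume I < ⊤) {g : ℝ → ℝ} {M p : ℝ}
    (hp : 0 ≤ p) (hg : ∀ s, |g s| ≤ M) : Gfun φ p g I (fun _ => 0) < ⊤ := by
  refine ENNReal.add_lt_top.mpr ⟨aniArea_zero_le hφ hI, ?_⟩
  calc ∫⁻ s in I, ENNReal.ofReal (|0 - g s| ^ p) ≤ ∫⁻ _ in I, ENNReal.ofReal (M ^ p) := by
        refine lintegral_mono fun s => ENNReal.ofReal_le_ofReal ?_
        rw [zero_sub, abs_neg]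
        exact Real.rpow_le_rpow (abs_nonneg _) (hg s) hp
    _ < ⊤ := by
        rw [setLIntegral_const]
        exact ENNReal.mul_lt_top ENNReal.ofReal_lt_top hI

lemma perVar_subg_lt_top (hφ : IsAnisotropy φ) (hI : IsOpen I) {u : ℝ → ℝ} (hum : Measurable u)
    (hui : Integrable u) {B : ℝ} (huB : ∀ s, |u s| ≤ B) (hu0 : ∀ s ∉ I, u s = 0)
    (hfin : aniArea φ u I < ⊤) {Ω : Set E2} (hΩ : Ω ⊆ strip I) :
    perVar (subg I u) Ω < ⊤ := by
  obtain ⟨c, hc, hb⟩ := hφ.exists_bounds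
  refine lt_of_le_of_lt (b := ENNReal.ofReal c⁻¹ * aniArea φ u I) ?_
    (ENNReal.mul_lt_top ENNReal.ofReal_lt_top hfin)
  unfold perVar
  refine iSup_le fun T => iSup_le fun hT => iSup_le fun hTc => iSup_le fun hTs =>
    iSup_le fun hT1 => ?_
  have hζ := testFun_component hT hTc (hTs.trans hΩ)
  have := ofReal_integral_add_divPair_le_aniArea hφ hI hum hui huB hu0 (h₁ := fun _ => 0)
    (h₂ := fun _ => 0) contDiff_const contDiff_const HasCompactSupport.zero HasCompactSupport.zero
    (by simp [tsupport]) (by simp [tsupport]) ((hζ 0).const_mul c) ((hζ 1).const_mul c) fun q => by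
      rw [zero_add, zero_add, ← smul_vec2, vec2_eta]
      refine (hb _).2.trans ?_
      rw [norm_smul, Real.norm_of_nonneg hc.le, inv_mul_cancel_left₀ hc.ne']
      exact hT1 q
  simp only [divPair_const_mul (hζ 0) (hζ 1), divPair_components hT, integral_const_mul,
    deriv_const', mul_zero, add_zero, integral_zero, zero_add] at this
  calc ENNReal.ofReal (∫ x in subg I u, div2 T x)
      = ENNReal.ofReal c⁻¹ * ENNReal.ofReal (c * ∫ x in subg I u, div2 T x) := by
        rw [← ENNReal.ofReal_mul (by positivity), inv_mul_cancel_left₀ hc.ne']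
    _ ≤ _ := by gcongr

end finiteness

/-- The competitor inequality: testing the area of the sheared function `u + w` (with `w` the slice
shift from the subgraph of `u` to `F`) together with a field in the subgraph of `u`. -/
lemma integral_add_sliceShift_le {φ : E2 → ℝ} (hφ : IsAnisotropy φ) {I : Set ℝ} (hI : IsOpen I)
    {u : ℝ → ℝ} (hum : Measurable u) (hui : Integrable u) {B : ℝ} (huB : ∀ s, |u s| ≤ B)
    (hu0 : ∀ s ∉ I, u s = 0) (hA : aniArea φ u I < ⊤) {Ω F K : Set E2} (hΩ : IsOpen Ω)
    (hΩI : Ω ⊆ strip I) (hF : MeasurableSet F) (hFΩ : perVar F Ω < ⊤) (hP : aniPer φ F Ω < ⊤)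
    (hK : IsCompact K) (hKΩ : K ⊆ Ω) (hEF : ∀ᵐ q, q ∉ K → (q ∈ subg I u ↔ q ∈ F))
    (hfin : volume (subg I u ∆ F) < ⊤) {S : E2 → E2} (hS : TestField φ Ω S) {h₁ h₂ : ℝ → ℝ}
    (c₁ : ContDiff ℝ 1 h₁) (c₂ : ContDiff ℝ 1 h₂) (k₁ : HasCompactSupport h₁)
    (k₂ : HasCompactSupport h₂) (t₁ : tsupport h₁ ⊆ I) (t₂ : tsupport h₂ ⊆ I)
    (hle : ∀ s ∈ I, φ (vec2 (h₁ s) (h₂ s)) ≤ 1) :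
    (∫ s in I, ((u s + sliceShift (subg I u) F s) * deriv h₁ s + h₂ s)) +
      ∫ q in subg I u, div2 S q ≤ (aniPer φ F Ω).toReal + (aniArea φ u I).toReal := by
  have hE := measurableSet_subg hI.measurableSet hum
  have hle' : ∀ s, φ (vec2 (h₁ s) (h₂ s)) ≤ 1 := fun s => by
    by_cases hs : s ∈ I
    · exact hle s hs
    · rw [image_eq_zero_of_notMem_tsupport fun h => hs (t₁ h),
        image_eq_zero_of_notMem_tsupport fun h => hs (t₂ h), vec2_zero_zero, hφ.map_zero]
      exact zero_le_one
  obtain ⟨L, hL, hKL, hLΩ⟩ := exists_compact_between (hK.union hS.compact.isCompact) hΩ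
    (union_subset hKΩ hS.subset)
  obtain ⟨η, hη, hη1, hη01⟩ := exists_testFun hL hΩ hLΩ
  have hζ₁ : TestFun Ω fun q => η q * h₁ (q 0) := hη.mul_right (c₁.comp (contDiff_coord 0))
  have hζ₂ : TestFun Ω fun q => η q * h₂ (q 0) := hη.mul_right (c₂.comp (contDiff_coord 0))
  have hS₀ := testFun_component hS.contDiff hS.compact hS.subset 0
  have hS₁ := testFun_component hS.contDiff hS.compact hS.subset 1
  set m := divPair (fun q => η q * h₁ (q 0)) fun q => η q * h₂ (q 0) with hm
  have hmi : Integrable m := integrable_divPair hζ₁ hζ₂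
  have hw := integrable_sliceShift hE hF hfin
  have hd : Continuous (deriv h₁) := c₁.continuous_deriv (by norm_num)
  have hfub : ∫ s, sliceShift (subg I u) F s * deriv h₁ s =
      (∫ q in F, m q) - ∫ q in subg I u, m q := by
    refine integral_sliceShift_mul hE hF hfin hmi ?_ ?_
    · exact (continuous_divPair hζ₁ hζ₂).bounded_above_of_compact_support
        (hasCompactSupport_divPair hζ₁ hζ₂)
    · filter_upwards [hEF] with q hq
      by_cases hqK : q ∈ K
      · have hη' : ∀ᶠ x in 𝓝 q, η x = 1 := by
          filter_upwards [isOpen_interior.mem_nhds (hKL (Or.inl hqK))] with x hx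
          exact hη1 x (interior_subset hx)
        rw [hm, divPair_congr (ξ₁ := fun x => h₁ (x 0)) (ξ₂ := fun x => h₂ (x 0)),
          divPair_comp_coord_zero c₁ c₂]
        · filter_upwards [hη'] with x hx
          rw [hx, one_mul]
        · filter_upwards [hη'] with x hx
          rw [hx, one_mul]
      · rw [charDiff_eq_zero (hq hqK), zero_mul, zero_mul]
  have hPF : ∫ q in F, m q ≤ (aniPer φ F Ω).toReal := by
    rw [← ENNReal.ofReal_le_iff_le_toReal hP.ne]
    have := ofReal_integral_div2_le_aniPer hφ hF hΩ hFΩ (testField_vec2 (φ := φ) hζ₁ hζ₂ fun q => by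
      rw [← smul_vec2, hφ.smul_eq, abs_of_nonneg (hη01 q).1]
      exact mul_le_one₀ (hη01 q).2 (hφ.nonneg _) (hle' _))
    simpa only [div2_vec2 hζ₁ hζ₂] using this
  have hlsc := ofReal_integral_add_divPair_le_aniArea hφ hI hum hui huB hu0 c₁ c₂ k₁ k₂ t₁ t₂
    (((hζ₁.const_mul (-1)).add hS₀).mono hΩI) (((hζ₂.const_mul (-1)).add hS₁).mono hΩI) fun q => by
      have e : vec2 (h₁ (q 0) + (-1 * (η q * h₁ (q 0)) + S q 0))
          (h₂ (q 0) + (-1 * (η q * h₂ (q 0)) + S q 1)) =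
          (1 - η q) • vec2 (h₁ (q 0)) (h₂ (q 0)) + S q := by
        rw [smul_vec2, ← vec2_eta (S q), vec2_add_vec2, vec2_zero, vec2_one]
        congr 1 <;> ring
      rw [e]
      by_cases hq : q ∈ tsupport S
      · rw [hη1 q (interior_subset (hKL (Or.inr hq))), sub_self, zero_smul, zero_add]
        exact hS.le_one q
      · rw [image_eq_zero_of_notMem_tsupport hq, add_zero, hφ.smul_eq,
          abs_of_nonneg (by linarith [(hη01 q).2])]
        exact mul_le_one₀ (by linarith [(hη01 q).1]) (hφ.nonneg _) (hle' _)
  rw [ENNReal.ofReal_le_iff_le_toReal hA.ne] at hlsc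
  have hdiv : ∀ q, divPair (fun x => -1 * (η x * h₁ (x 0)) + S x 0)
      (fun x => -1 * (η x * h₂ (x 0)) + S x 1) q = -1 * m q + div2 S q := fun q => by
    rw [divPair_add (hζ₁.const_mul (-1)) (hζ₂.const_mul (-1)) hS₀ hS₁,
      divPair_const_mul hζ₁ hζ₂, divPair_components hS.contDiff]
  have hSi : Integrable (div2 S) := by
    have : div2 S = divPair (fun x => S x 0) fun x => S x 1 := by
      ext q
      rw [divPair_components hS.contDiff]
    rw [this]
    exact integrable_divPair hS₀ hS₁
  simp only [hdiv] at hlsc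
  rw [integral_add (hmi.const_mul _).integrableOn hSi.integrableOn, integral_const_mul] at hlsc
  have hdb : ∃ C, ∀ s, ‖deriv h₁ s‖ ≤ C := hd.bounded_above_of_compact_support k₁.deriv
  obtain ⟨C, hC⟩ := hdb
  have hsplit : ∫ s in I, ((u s + sliceShift (subg I u) F s) * deriv h₁ s + h₂ s) =
      (∫ s, (u s * deriv h₁ s + h₂ s)) + ∫ s, sliceShift (subg I u) F s * deriv h₁ s := by
    rw [setIntegral_eq_integral_of_forall_compl_eq_zero, ← integral_add]
    · congr 1 with s
      ring
    · exact (hui.mul_bdd hd.aestronglyMeasurable (Eventually.of_forall hC)).add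
        (c₂.continuous.integrable_of_hasCompactSupport k₂)
    · exact hw.mul_bdd hd.aestronglyMeasurable (Eventually.of_forall hC)
    · intro s hs
      rw [image_eq_zero_of_notMem_tsupport fun h => hs (t₂ h),
        image_eq_zero_of_notMem_tsupport fun h => hs (t₁ (tsupport_deriv_subset h)), mul_zero,
        add_zero]
  rw [hsplit, hfub]
  linarith

lemma aniArea_add_sliceShift_add_le {φ : E2 → ℝ} (hφ : IsAnisotropy φ) {I : Set ℝ} (hI : IsOpen I)
    {u : ℝ → ℝ} (hum : Measurable u) (hui : Integrable u) {B : ℝ} (huB : ∀ s, |u s| ≤ B)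
    (hu0 : ∀ s ∉ I, u s = 0) (hA : aniArea φ u I < ⊤) {Ω F K : Set E2} (hΩ : IsOpen Ω)
    (hΩI : Ω ⊆ strip I) (hF : MeasurableSet F) (hFΩ : perVar F Ω < ⊤) (hP : aniPer φ F Ω < ⊤)
    (hK : IsCompact K) (hKΩ : K ⊆ Ω) (hEF : ∀ᵐ q, q ∉ K → (q ∈ subg I u ↔ q ∈ F))
    (hfin : volume (subg I u ∆ F) < ⊤) {S : E2 → E2} (hS : TestField φ Ω S) :
    (aniArea φ (fun s => u s + sliceShift (subg I u) F s) I).toReal + ∫ q in subg I u, div2 S q ≤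
        (aniPer φ F Ω).toReal + (aniArea φ u I).toReal ∧
      aniArea φ (fun s => u s + sliceShift (subg I u) F s) I < ⊤ := by
  set c := (aniPer φ F Ω).toReal + (aniArea φ u I).toReal - ∫ q in subg I u, div2 S q with hc
  have hc0 : 0 ≤ c := by
    have := integral_add_sliceShift_le hφ hI hum hui huB hu0 hA hΩ hΩI hF hFΩ hP hK hKΩ hEF hfin hS
      (h₁ := fun _ => 0) (h₂ := fun _ => 0) contDiff_const contDiff_const HasCompactSupport.zero
      HasCompactSupport.zero (by simp [tsupport]) (by simp [tsupport])
      (by simp [vec2_zero_zero, hφ.map_zero])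
    simp only [deriv_const', mul_zero, add_zero, integral_zero] at this
    linarith
  have hle : aniArea φ (fun s => u s + sliceShift (subg I u) F s) I ≤ ENNReal.ofReal c := by
    conv_lhs => unfold aniArea
    refine iSup_le fun h₁ => iSup_le fun h₂ => iSup_le fun c₁ => iSup_le fun c₂ => iSup_le fun k₁ =>
      iSup_le fun k₂ => iSup_le fun t₁ => iSup_le fun t₂ => iSup_le fun h =>
      ENNReal.ofReal_le_ofReal ?_
    have := integral_add_sliceShift_le hφ hI hum hui huB hu0 hA hΩ hΩI hF hFΩ hP hK hKΩ hEF hfin hS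
      c₁ c₂ k₁ k₂ t₁ t₂ h
    linarith
  refine ⟨?_, hle.trans_lt ENNReal.ofReal_lt_top⟩
  have := ENNReal.toReal_le_of_le_ofReal hc0 hle
  linarith

/-- Minimizers of `G` among bounded measurable functions vanishing outside `I`: the competitor
inequality for subgraphs. -/
lemma aniPer_subg_le_of_minimizer {φ : E2 → ℝ} (hφ : IsAnisotropy φ) {I : Set ℝ} (hI : IsOpen I)
    (hIfin : volume I < ⊤) {u g : ℝ → ℝ} (hum : Measurable u) {B M p γ : ℝ}
    (huB : ∀ s, |u s| ≤ B) (hu0 : ∀ s ∉ I, u s = 0) (hg : ∀ s, |g s| ≤ M) (hp : 1 ≤ p)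
    (hmin : ∀ v, IntegrableOn v I → Gfun φ p g I u ≤ Gfun φ p g I v) (hγ : 2 * M < γ)
    {Ω F K : Set E2} (hΩ : IsOpen Ω) (hΩI : Ω ⊆ box I (Ioo (-γ) γ)) (hF : MeasurableSet F)
    (hFΩ : perVar F Ω < ⊤) (hK : IsCompact K) (hKΩ : K ⊆ Ω)
    (hEF : ∀ᵐ q, q ∉ K → (q ∈ subg I u ↔ q ∈ F)) :
    aniPer φ (subg I u) Ω ≤ aniPer φ F Ω +
      ENNReal.ofReal (p * (γ + M) ^ (p - 1)) * volume (subg I u ∆ F) := by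
  rcases eq_or_lt_of_le (le_top : aniPer φ F Ω ≤ ⊤) with hP | hP
  · simp [hP]
  have hM : 0 ≤ M := (abs_nonneg _).trans (hg 0)
  set Λ := p * (γ + M) ^ (p - 1) with hΛ
  have hΛ0 : 0 ≤ Λ := mul_nonneg (by linarith) (Real.rpow_nonneg (by linarith) _)
  have hE := measurableSet_subg hI.measurableSet hum
  have hui := integrable_of_measurable_of_bounded hIfin hum huB hu0
  have hGu : Gfun φ p g I u < ⊤ :=
    (hmin _ integrableOn_zero).trans_lt (Gfun_zero_lt_top hφ hIfin (by linarith) hg)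
  obtain ⟨hA, hX⟩ := ENNReal.add_lt_top.mp hGu
  have hΩs : Ω ⊆ strip I := fun q hq => (hΩI hq).1
  have hfin : volume (subg I u ∆ F) < ⊤ := by
    refine (measure_mono_ae ?_).trans_lt hK.measure_lt_top
    filter_upwards [hEF] with q hq hqs
    by_contra hqK
    have := hq hqK
    rcases hqs with h | h
    · exact h.2 (this.mp h.1)
    · exact h.2 (this.mpr h.1)
  have hfid := lintegral_fidelity_le hI.measurableSet hum hF hfin (γ := γ)
    (by filter_upwards [hEF] with q hq hqb using hq fun hqK => hqb (hΩI (hKΩ hqK))) hp hg hγ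
  have key : ∀ S, TestField φ Ω S → ∫ q in subg I u, div2 S q ≤
      (aniPer φ F Ω).toReal + Λ * (volume (subg I u ∆ F)).toReal := fun S hS => by
    obtain ⟨h1, h2⟩ := aniArea_add_sliceShift_add_le hφ hI hum hui huB hu0 hA hΩ hΩs hF hFΩ hP hK
      hKΩ hEF hfin hS
    have h3 := hmin (fun s => u s + sliceShift (subg I u) F s)
      (hui.add (integrable_sliceShift hE hF hfin)).integrableOn
    have h4 := h3.trans (add_le_add_right hfid _)
    rw [Gfun, add_comm (∫⁻ s in I, ENNReal.ofReal (|u s - g s| ^ p)), ← add_assoc] at h4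
    have h5 := (ENNReal.add_le_add_iff_right hX.ne).mp h4
    have h6 : ENNReal.ofReal Λ * volume (subg I u ∆ F) < ⊤ :=
      ENNReal.mul_lt_top ENNReal.ofReal_lt_top hfin
    have h7 := ENNReal.toReal_mono (ENNReal.add_lt_top.mpr ⟨h2, h6⟩).ne h5
    rw [ENNReal.toReal_add h2.ne h6.ne, ENNReal.toReal_mul, ENNReal.toReal_ofReal hΛ0] at h7
    linarith
  refine (aniPer_le_of_forall_testField hφ hE hΩ
    (perVar_subg_lt_top hφ hI hum hui huB hu0 hA hΩs) key).trans_eq ?_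
  rw [ENNReal.ofReal_add ENNReal.toReal_nonneg (mul_nonneg hΛ0 ENNReal.toReal_nonneg),
    ENNReal.ofReal_mul hΛ0, ENNReal.ofReal_toReal hP.ne, ENNReal.ofReal_toReal hfin.ne]

/-- minimizers of `G` are `(γ,Λ)`-local minimizers of `𝒜_φ`. -/
theorem stmt4
    (φ : E2 → ℝ) (hφ : IsAnisotropy φ) (hpm : PartiallyMonotone φ)
    (a b : ℝ) (hab : a < b) (p : ℝ) (hp : 1 ≤ p)
    (g : ℝ → ℝ) (hg : AEStronglyMeasurable g (volume.restrict (Set.Ioo a b)))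
    (hgb : supNorm g (Set.Ioo a b) < ⊤)
    (u : ℝ → ℝ) (hu : IsMinimizerG φ p g (Set.Ioo a b) u)
    (huBV : BVOn u (Set.Ioo a b)) (hub : supNorm u (Set.Ioo a b) < ⊤)
    (γ : ℝ) (hγ : 2 * (supNorm g (Set.Ioo a b)).toReal < γ) :
    IsGammaLambdaLocMin φ γ (p * (γ + (supNorm g (Set.Ioo a b)).toReal) ^ (p - 1))
      (Set.Ioo a b) u := by
  intro Ω hΩ hΩc hΩb F hF hK hKΩ
  have hI : MeasurableSet (Ioo a b) := measurableSet_Ioo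
  obtain ⟨u₀, hum, huB, hu0, huu⟩ :=
    exists_measurable_bounded_rep hI hu.1.aestronglyMeasurable hub
  obtain ⟨g₀, -, hgM, -, hgg⟩ := exists_measurable_bounded_rep hI hg hgb
  have hE := subg_ae_eq hI huu
  have hmin : ∀ v, IntegrableOn v (Ioo a b) →
      Gfun φ p g₀ (Ioo a b) u₀ ≤ Gfun φ p g₀ (Ioo a b) v := fun v hv => by
    rw [← Gfun_congr_ae huu hgg, ← Gfun_congr_ae (Eventually.of_forall fun _ => rfl) hgg]
    exact hu.2 v hv
  have hEF : ∀ᵐ q, q ∉ closure (subg (Ioo a b) u ∆ F) → (q ∈ subg (Ioo a b) u₀ ↔ q ∈ F) := by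
    filter_upwards [hE.mem_iff] with q hq hqK
    rw [← hq]
    by_contra h
    refine hqK (subset_closure ?_)
    rw [mem_symmDiff]
    tauto
  have hV : volume (subg (Ioo a b) u ∆ F) = volume (subg (Ioo a b) u₀ ∆ F) :=
    measure_congr (ae_eq_set_symmDiff hE ae_eq_rfl)
  rw [aniPer_congr_ae hE, hV]
  exact aniPer_subg_le_of_minimizer hφ isOpen_Ioo measure_Ioo_lt_top hum huB hu0 hgM hp hmin hγ hΩ
    (subset_closure.trans hΩb) hF.1 (hF.2 Ω hΩ hΩc fun q hq => (hΩb hq).1) hK hKΩ hEF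

end
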